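/- Fix natural numbers n, r, d with r < n, and let F be the finite set of triples (δ,a,b) with δ ∈ {0,1}^n taking the value 1 exactly n−r times, a, b ∈ ℕ^n with |a|+|b| = d, and a_i = b_i = 0 whenever δ_i = 0. Let S = ℤ[e_1,…,e_n,f]. Let M ⊆ S^F be the set of tuples (f_{(δ,a,b)})_{(δ,a,b)∈F} satisfying relations I, IIa, IIb, IIc′, III′ (with III′ interpreted as: the sum, an element of ℚ[e_1,…,e_n,f], lies in f^{|b|}·S). Then M is a subring of the product ring S^F, and M is a free S-module (for the diagonal S-action) whose rank equals the cardinality of F. -/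

import Mathlib

set_option synthInstance.maxHeartbeats 1000000

open MvPolynomial Finset

noncomputable section

/-- Triples `(δ, a, b)` with `δ : Fin n → Bool` and `a, b : Fin n → ℕ`. -/
abbrev Triple (n : ℕ) := (Fin n → Bool) × (Fin n → ℕ) × (Fin n → ℕ)

/-- Membership in the indexing set `F` of torus-fixed points of `Q_d(r,n)`:
`δ` takes the value 1 (`true`) exactly `n-r` times, `|a| + |b| = d`, and
`a_i = b_i = 0` whenever `δ_i = 0`. -/
def inF (n r d : ℕ) (t : Triple n) : Prop :=
  (Finset.univ.filter fun i => t.1 i = true).card = n - r ∧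
    (∑ i, (t.2.1 i + t.2.2 i)) = d ∧
    (∀ i, t.1 i = false → t.2.1 i = 0 ∧ t.2.2 i = 0)

/-- `S = ℤ[e_1, …, e_n, f]`. -/
abbrev SZ (n : ℕ) := MvPolynomial (Option (Fin n)) ℤ

/-- `S_ℚ = ℚ[e_1, …, e_n, f]`. -/
abbrev SQ (n : ℕ) := MvPolynomial (Option (Fin n)) ℚ

/-- The variable `e_i` of `S`. -/
def eZ {n : ℕ} (i : Fin n) : SZ n := X (some i)

/-- The variable `f` of `S`. -/
def fZ {n : ℕ} : SZ n := X none

/-- The variable `f` of `S_ℚ`. -/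
def fQ {n : ℕ} : SQ n := X none

/-- The inclusion `ℤ[e_1,…,e_n,f] → ℚ[e_1,…,e_n,f]`. -/
def toQ {n : ℕ} : SZ n →+* SQ n := MvPolynomial.map (Int.castRingHom ℚ)

open scoped Classical in
/-- Extension by zero of a tuple indexed by `F` to all triples. -/
def extTuple (n r d : ℕ) (g : {t : Triple n // inF n r d t} → SZ n) :
    Triple n → SZ n :=
  fun t => if h : inF n r d t then g ⟨t, h⟩ else 0

/-- Relation I. -/
def RelI (n r d : ℕ) (g : Triple n → SZ n) : Prop :=
  ∀ (δ δ' : Fin n → Bool) (a b a' b' : Fin n → ℕ) (i j : Fin n),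
    inF n r d (δ, a, b) → inF n r d (δ', a', b') → i ≠ j →
    (∀ k, k ≠ i → k ≠ j → δ k = δ' k ∧ a k = a' k ∧ b k = b' k) →
    δ i = true → δ' j = true → δ j = false → δ' i = false →
    (eZ j - eZ i + C ((a' j : ℤ) - (a i : ℤ)) * fZ) ∣
      (g (δ, a, b) - g (δ', a', b'))

/-- Relation II(a). -/
def RelIIa (n r d : ℕ) (g : Triple n → SZ n) : Prop :=
  ∀ (δ : Fin n → Bool) (a b a' : Fin n → ℕ) (i j : Fin n),
    inF n r d (δ, a, b) → inF n r d (δ, a', b) → i ≠ j →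
    (∀ k, k ≠ i → k ≠ j → a k = a' k) →
    (eZ j - eZ i + C ((a' j : ℤ) - (a i : ℤ)) * fZ) ∣
      (g (δ, a, b) - g (δ, a', b))

/-- Relation II(b). -/
def RelIIb (n r d : ℕ) (g : Triple n → SZ n) : Prop :=
  ∀ (δ : Fin n → Bool) (a b b' : Fin n → ℕ) (i j : Fin n),
    inF n r d (δ, a, b) → inF n r d (δ, a, b') → i ≠ j →
    (∀ k, k ≠ i → k ≠ j → b k = b' k) →
    (eZ j - eZ i + C ((b i : ℤ) - (b' j : ℤ)) * fZ) ∣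
      (g (δ, a, b) - g (δ, a, b'))

/-- Relation II(c)′. -/
def RelIIc' (n r d : ℕ) (g : Triple n → SZ n) : Prop :=
  ∀ (δ : Fin n → Bool) (a b a' b' : Fin n → ℕ) (i j : Fin n),
    inF n r d (δ, a, b) → inF n r d (δ, a', b) → inF n r d (δ, a, b') →
    i ≠ j →
    (∀ k, k ≠ i → k ≠ j → a k = a' k) →
    (∀ k, k ≠ i → k ≠ j → b k = b' k) →
    ((a' j : ℤ) - (a i : ℤ) = (b i : ℤ) - (b' j : ℤ)) →
    (eZ j - eZ i + C ((a' j : ℤ) - (a i : ℤ)) * fZ) ^ 2 ∣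
      (g (δ, a, b) - g (δ, a', b) - g (δ, a, b') + g (δ, a', b'))

/-- Relation III′: the sum, an element of `ℚ[e_1,…,e_n,f]`, lies in
`f^{|b|} · ℤ[e_1,…,e_n,f]`. -/
def RelIII' (n r d : ℕ) (g : Triple n → SZ n) : Prop :=
  ∀ (δ : Fin n → Bool) (a b : Fin n → ℕ),
    inF n r d (δ, a, b) → b ≠ 0 →
    ∃ h : SZ n,
      ∑ c ∈ Finset.Icc 0 b,
        C ((-1 : ℚ) ^ (∑ i, c i) /
            ((∏ i, ((c i).factorial : ℚ)) * ∏ i, ((b i - c i).factorial : ℚ))) *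
          toQ (g (δ, a + c, b - c))
        = fQ ^ (∑ i, b i) * toQ h

/-! ### Linear forms -/

/-- The linear form `e_j - e_i + k f`. -/
def lin {n : ℕ} (i j : Fin n) (k : ℤ) : SZ n := eZ j - eZ i + C k * fZ

/-- The substitution `e_j ↦ e_i - k f`, whose kernel is generated by `lin i j k`. -/
def rho {n : ℕ} (i j : Fin n) (k : ℤ) : SZ n →ₐ[ℤ] SZ n :=
  aeval fun o => if o = some j then eZ i - C k * fZ else X o

lemma rho_lin {n : ℕ} {i j : Fin n} (hij : i ≠ j) (k : ℤ) : rho i j k (lin i j k) = 0 := by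
  simp [rho, lin, eZ, fZ, hij]

lemma lin_dvd_self_sub_rho {n : ℕ} (i j : Fin n) (k : ℤ) (x : SZ n) :
    lin i j k ∣ x - rho i j k x := by
  have h : (Ideal.Quotient.mkₐ ℤ (Ideal.span {lin i j k})).comp (rho i j k) =
      Ideal.Quotient.mkₐ ℤ (Ideal.span {lin i j k}) := by
    apply MvPolynomial.algHom_ext
    intro o
    simp only [AlgHom.comp_apply, rho, aeval_X]
    split_ifs with ho
    · subst ho
      simp only [Ideal.Quotient.mkₐ_eq_mk]
      rw [eq_comm, Ideal.Quotient.eq, Ideal.mem_span_singleton]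
      exact ⟨1, by simp only [lin, eZ]; ring⟩
    · rfl
  have h2 := congrArg (fun φ => φ x) h
  simp only [AlgHom.comp_apply, Ideal.Quotient.mkₐ_eq_mk] at h2
  rw [eq_comm, Ideal.Quotient.eq, Ideal.mem_span_singleton] at h2
  exact h2

lemma lin_dvd_iff {n : ℕ} {i j : Fin n} (hij : i ≠ j) (k : ℤ) (x : SZ n) :
    lin i j k ∣ x ↔ rho i j k x = 0 := by
  constructor
  · rintro ⟨y, rfl⟩
    rw [map_mul, rho_lin hij, zero_mul]
  · intro h
    simpa [h] using lin_dvd_self_sub_rho i j k x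

lemma eval_eq_zero_of_lin_dvd {n : ℕ} {i j : Fin n} {k : ℤ} {x : SZ n} (h : lin i j k ∣ x)
    (v : Option (Fin n) → ℤ) (hv : v (some j) - v (some i) + k * v none = 0) :
    MvPolynomial.eval v x = 0 := by
  obtain ⟨y, rfl⟩ := h
  rw [map_mul]
  simp [lin, eZ, fZ, hv]

lemma lin_dvd_lin {n : ℕ} {i j : Fin n} (hij : i ≠ j) {k : ℤ} {p q : Fin n} {l : ℤ}
    (h : lin i j k ∣ lin p q l) :
    (p = i ∧ q = j ∧ l = k) ∨ (p = j ∧ q = i ∧ l = -k) ∨ (p = q ∧ l = 0) := by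
  have key : ∀ v : Option (Fin n) → ℤ, v (some j) - v (some i) + k * v none = 0 →
      v (some q) - v (some p) + l * v none = 0 := by
    intro v hv
    simpa [lin, eZ, fZ] using eval_eq_zero_of_lin_dvd h v hv
  have h1 := key (fun o => o.elim 1 fun x => if x = j then -k else 0) (by simp [hij])
  simp only [Option.elim_some, Option.elim_none] at h1
  by_cases hpq : p = q
  · subst hpq
    exact Or.inr (Or.inr ⟨rfl, by simpa using h1⟩)
  have h2 : ∀ x, x ≠ i → x ≠ j → p ≠ x ∧ q ≠ x := by
    intro x hxi hxj
    have := key (fun o => o.elim 0 fun y => if y = x then 1 else 0)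
      (by simp [hxi.symm, hxj.symm])
    simp only [Option.elim_some, Option.elim_none] at this
    constructor <;> rintro rfl <;> grind
  by_cases hpi : p = i
  · subst hpi
    have : q = j := by
      by_contra hqj
      exact (h2 q (Ne.symm hpq) hqj).2 rfl
    subst this
    refine Or.inl ⟨rfl, rfl, ?_⟩
    grind
  · have hpj : p = j := by
      by_contra hpj
      exact (h2 p hpi hpj).1 rfl
    subst hpj
    have : q = i := by
      by_contra hqi
      exact (h2 q hqi (Ne.symm hpq)).2 rfl
    subst this
    refine Or.inr (Or.inl ⟨rfl, rfl, ?_⟩)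
    grind

lemma lin_ne_zero {n : ℕ} {i j : Fin n} {k : ℤ} (h : i ≠ j ∨ k ≠ 0) : lin i j k ≠ 0 := by
  intro h0
  have key : ∀ v : Option (Fin n) → ℤ, v (some j) - v (some i) + k * v none = 0 := by
    intro v
    simpa [lin, eZ, fZ] using congrArg (MvPolynomial.eval v) h0
  have h1 := key (fun o => o.elim 1 fun x => 0)
  have h2 := key (fun o => o.elim 0 fun x => if x = j then 1 else 0)
  simp only [Option.elim_some, Option.elim_none] at h1 h2
  grind

lemma prime_lin {n : ℕ} {i j : Fin n} (hij : i ≠ j) (k : ℤ) : Prime (lin i j k) := by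
  refine ⟨lin_ne_zero (Or.inl hij), fun hu => ?_, fun x y h => ?_⟩
  · have := (lin_dvd_iff hij k 1).1 hu.dvd
    simp at this
  · simpa [lin_dvd_iff hij] using h

lemma lin_neg_swap {n : ℕ} (i j : Fin n) (k : ℤ) : lin j i (-k) = - lin i j k := by
  simp [lin]; ring

/-! ### Relation III′ as a polynomiality condition -/

lemma toQ_injective {n : ℕ} : Function.Injective (toQ (n := n)) :=
  MvPolynomial.map_injective _ (RingHom.injective_int _)

lemma inF_of_add_eq {n r d : ℕ} {δ : Fin n → Bool} {a b a' b' : Fin n → ℕ}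
    (h : inF n r d (δ, a, b)) (hab : a + b = a' + b') : inF n r d (δ, a', b') := by
  obtain ⟨h1, h2, h3⟩ := h
  have hab' : ∀ i, a i + b i = a' i + b' i := fun i => congrFun hab i
  refine ⟨h1, ?_, fun i hi => ?_⟩
  · rw [← h2]
    exact Finset.sum_congr rfl fun i _ => (hab' i).symm
  · have := h3 i hi
    have := hab' i
    dsimp only at *
    omega

/-- On each component of fixed points of the torus of `GL_n`, the tuple is given by a polynomial
in the `a_i f`. -/
def PolyOnComponents (n r d : ℕ) (g : Triple n → SZ n) : Prop :=
  ∀ (δ : Fin n → Bool) (m : Fin n → ℕ), ∃ P : MvPolynomial (Fin n) (SZ n),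
    ∀ a b, inF n r d (δ, a, b) → a + b = m →
      g (δ, a, b) = MvPolynomial.eval (fun i => (a i : SZ n) * fZ) P

lemma exists_alternating_sum_pow {n : ℕ} (a k : ℕ) : ∀ b : ℕ, ∃ h : SZ n,
    ∑ c ∈ Finset.Icc 0 b,
      C ((-1 : ℚ) ^ c / ((c.factorial : ℚ) * ((b - c).factorial : ℚ))) *
        toQ ((((a + c : ℕ) : SZ n) * fZ) ^ k) = fQ ^ b * toQ h := by
  induction k with
  | zero =>
    intro b
    rcases Nat.eq_zero_or_pos b with rfl | hb
    · exact ⟨1, by simp⟩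
    · refine ⟨0, ?_⟩
      simp only [pow_zero, map_one, mul_one, map_zero, mul_zero]
      rw [← map_sum]
      have : ∑ c ∈ Finset.Icc 0 b, ((-1 : ℚ) ^ c / ((c.factorial : ℚ) * ((b - c).factorial : ℚ)))
          = (∑ c ∈ Finset.range (b + 1), (-1 : ℤ) ^ c * (b.choose c : ℤ) : ℤ) /
            (b.factorial : ℚ) := by
        push_cast
        rw [Finset.sum_div, ← Nat.range_succ_eq_Icc_zero]
        refine Finset.sum_congr rfl fun c hc => ?_
        have hcb : c ≤ b := Nat.lt_succ_iff.1 (Finset.mem_range.1 hc)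
        rw [Nat.cast_choose ℚ hcb]
        have := Nat.factorial_ne_zero b
        field_simp
      rw [this, Int.alternating_sum_range_choose_of_ne hb.ne']
      simp
  | succ k ih =>
    intro b
    obtain ⟨h1, hh1⟩ := ih b
    rcases Nat.eq_zero_or_pos b with rfl | hb
    · refine ⟨((a : SZ n) * fZ) ^ (k + 1), by simp⟩
    obtain ⟨b, rfl⟩ : ∃ b', b = b' + 1 := ⟨b - 1, by omega⟩
    obtain ⟨h2, hh2⟩ := ih b
    refine ⟨((a + (b + 1) : ℕ) : SZ n) * fZ * h1 - h2, ?_⟩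
    have hf : toQ (fZ (n := n)) = fQ := by simp [toQ, fZ, fQ]
    have e1 : fQ ^ (b + 1) * toQ (((a + (b + 1) : ℕ) : SZ n) * fZ * h1 - h2) =
        (((a + (b + 1) : ℕ) : SQ n) * fQ) * (fQ ^ (b + 1) * toQ h1) -
          fQ * (fQ ^ b * toQ h2) := by
      simp only [map_sub, map_mul, hf, map_natCast]
      ring
    rw [e1, ← hh1, ← hh2, ← Nat.range_succ_eq_Icc_zero, ← Nat.range_succ_eq_Icc_zero,
      Finset.sum_range_succ, Finset.sum_range_succ _ (b + 1), mul_add, add_sub_right_comm,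
      Finset.mul_sum, Finset.mul_sum, ← Finset.sum_sub_distrib]
    congr 1
    · refine Finset.sum_congr rfl fun c hc => ?_
      have hcb : c ≤ b := Nat.lt_succ_iff.1 (Finset.mem_range.1 hc)
      obtain ⟨e, rfl⟩ := Nat.exists_eq_add_of_le hcb
      have : c + e + 1 - c = e + 1 := by omega
      rw [this, Nat.add_sub_cancel_left, Nat.factorial_succ]
      have e2 : (-1 : ℚ) ^ c / ((c.factorial : ℚ) * (e.factorial : ℚ)) =
          (e + 1) * ((-1 : ℚ) ^ c / ((c.factorial : ℚ) * (((e + 1) * e.factorial : ℕ) : ℚ))) := by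
        have := Nat.factorial_ne_zero e
        have := Nat.factorial_ne_zero c
        push_cast
        field_simp
      rw [e2]
      simp only [map_pow, map_mul, hf, map_natCast, map_add, map_one]
      push_cast
      ring
    · simp only [map_pow, map_mul, hf, map_natCast]
      ring

lemma Icc_zero_eq_piFinset {n : ℕ} (b : Fin n → ℕ) :
    Finset.Icc 0 b = Fintype.piFinset fun i => Finset.Icc 0 (b i) := by
  ext x
  simp [Fintype.mem_piFinset, Pi.le_def]

lemma exists_alternating_sum_eval {n : ℕ} (a b : Fin n → ℕ) (P : MvPolynomial (Fin n) (SZ n)) :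
    ∃ h : SZ n, ∑ c ∈ Finset.Icc 0 b,
      C ((-1 : ℚ) ^ (∑ i, c i) /
          ((∏ i, ((c i).factorial : ℚ)) * ∏ i, ((b i - c i).factorial : ℚ))) *
        toQ (MvPolynomial.eval (fun i => ((a i + c i : ℕ) : SZ n) * fZ) P)
      = fQ ^ (∑ i, b i) * toQ h := by
  induction P using MvPolynomial.induction_on' with
  | add p q hp hq =>
    obtain ⟨h, hh⟩ := hp
    obtain ⟨h', hh'⟩ := hq
    refine ⟨h + h', ?_⟩
    rw [map_add, mul_add, ← hh, ← hh', ← Finset.sum_add_distrib]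
    exact Finset.sum_congr rfl fun c _ => by rw [map_add, map_add, mul_add]
  | monomial u s =>
    choose h hh using fun i => exists_alternating_sum_pow (n := n) (a i) (u i) (b i)
    refine ⟨s * ∏ i, h i, ?_⟩
    have e1 : fQ ^ (∑ i, b i) * toQ (s * ∏ i, h i) = toQ s * ∏ i, (fQ ^ b i * toQ (h i)) := by
      rw [map_mul, map_prod, Finset.prod_mul_distrib, Finset.prod_pow_eq_pow_sum]
      ring
    rw [e1]
    simp_rw [← hh]
    rw [Finset.prod_univ_sum, Icc_zero_eq_piFinset, Finset.mul_sum]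
    refine Finset.sum_congr rfl fun c _ => ?_
    rw [Finset.prod_mul_distrib, ← map_prod C, Finset.prod_div_distrib, Finset.prod_mul_distrib,
      Finset.prod_pow_eq_pow_sum, MvPolynomial.eval_monomial, map_mul, ← map_prod toQ,
      Finsupp.prod_fintype _ _ (fun i => pow_zero _)]
    ring

lemma PolyOnComponents.relIII' {n r d : ℕ} {g : Triple n → SZ n}
    (hg : PolyOnComponents n r d g) : RelIII' n r d g := by
  intro δ a b hab _
  obtain ⟨P, hP⟩ := hg δ (a + b)
  obtain ⟨h, hh⟩ := exists_alternating_sum_eval a b P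
  refine ⟨h, hh ▸ Finset.sum_congr rfl fun c hc => ?_⟩
  have hcb : c ≤ b := (Finset.mem_Icc.1 hc).2
  have hadd : a + c + (b - c) = a + b := by rw [add_assoc, add_tsub_cancel_of_le hcb]
  rw [hP _ _ (inF_of_add_eq hab hadd.symm) hadd]
  rfl

lemma sum_choose_inversion {x m : ℕ} (hx : x ≤ m) (y : ℕ) :
    ∑ k ∈ Finset.Icc 0 m, (if y ≤ k then (x.descFactorial k : ℚ) *
      ((-1 : ℚ) ^ (k - y) / (((k - y).factorial : ℚ) * (y.factorial : ℚ))) else 0) =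
      if x = y then 1 else 0 := by
  have h1 : ∀ k, (if y ≤ k then (x.descFactorial k : ℚ) *
      ((-1 : ℚ) ^ (k - y) / (((k - y).factorial : ℚ) * (y.factorial : ℚ))) else 0) =
      if y ≤ k then ((((x.choose k * k.choose y : ℕ) : ℤ) * (-1) ^ (k - y) : ℤ) : ℚ) else 0 := by
    intro k
    split_ifs with hk
    · rw [Nat.descFactorial_eq_factorial_mul_choose]
      push_cast
      rw [Nat.cast_choose ℚ hk]
      field_simp
    · rfl
  simp_rw [h1]
  rw [← Finset.sum_filter]
  have h2 : (Finset.Icc 0 m).filter (fun k => y ≤ k) = Finset.Icc y m := by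
    ext k; simp; tauto
  rw [h2]
  by_cases hxy : y ≤ x
  · have h3 : ∑ k ∈ Finset.Icc y m, ((((x.choose k * k.choose y : ℕ) : ℤ) * (-1) ^ (k - y) : ℤ) : ℚ)
        = ∑ k ∈ Finset.Icc y x,
            ((((x.choose k * k.choose y : ℕ) : ℤ) * (-1) ^ (k - y) : ℤ) : ℚ) := by
      symm
      apply Finset.sum_subset (Finset.Icc_subset_Icc_right hx)
      intro k hk hk'
      have : x < k := by
        simp only [Finset.mem_Icc] at hk hk'
        omega
      simp [Nat.choose_eq_zero_of_lt this]
    rw [h3]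
    obtain ⟨e, rfl⟩ := Nat.exists_eq_add_of_le hxy
    have h4 : ∑ k ∈ Finset.Icc y (y + e),
        ((((y + e).choose k * k.choose y : ℕ) : ℤ) * (-1) ^ (k - y) : ℤ) =
        (y + e).choose y * ∑ l ∈ Finset.range (e + 1), (-1 : ℤ) ^ l * (e.choose l : ℤ) := by
      rw [Finset.mul_sum]
      refine Finset.sum_bij' (fun k _ => k - y) (fun l _ => l + y) ?_ ?_ ?_ ?_ ?_
      · intro k hk; simp at hk ⊢; omega
      · intro k hk; simp at hk ⊢; omega
      · intro k hk; simp at hk ⊢; omega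
      · intro k hk; simp
      · intro k hk
        simp only [Finset.mem_Icc] at hk
        rw [Nat.choose_mul hk.1, Nat.add_sub_cancel_left]
        push_cast
        ring
    rw [← Int.cast_sum, h4, Int.alternating_sum_range_choose]
    by_cases he : e = 0
    · simp [he]
    · simp [he]
  · rw [Finset.sum_eq_zero, if_neg (by omega)]
    intro k hk
    have : x < k := by
      simp only [Finset.mem_Icc] at hk
      omega
    simp [Nat.choose_eq_zero_of_lt this]

lemma prod_range_sub_mul_eq_descFactorial {n : ℕ} (x k : ℕ) (u : SZ n) :
    ∏ l ∈ Finset.range k, (((x : SZ n) - (l : SZ n)) * u) = (x.descFactorial k : SZ n) * u ^ k := by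
  induction k with
  | zero => simp
  | succ k ih =>
    rw [Finset.prod_range_succ, ih, Nat.descFactorial_succ, pow_succ]
    by_cases hk : k ≤ x
    · push_cast [hk]
      ring
    · have : x.descFactorial k = 0 := Nat.descFactorial_of_lt (by omega)
      simp [this]

lemma RelIII'.polyOnComponents {n r d : ℕ} {g : Triple n → SZ n}
    (hg : RelIII' n r d g) : PolyOnComponents n r d g := by
  intro δ m
  by_cases hm : ∃ a b, inF n r d (δ, a, b) ∧ a + b = m
  swap
  · exact ⟨0, fun a b h1 h2 => (hm ⟨a, b, h1, h2⟩).elim⟩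
  obtain ⟨a₀, b₀, h0, rfl⟩ := hm
  set m := a₀ + b₀ with hmdef
  have hF : ∀ y ∈ Finset.Icc 0 m, inF n r d (δ, m - y, y) := fun y hy =>
    inF_of_add_eq h0 (by rw [tsub_add_cancel_of_le (Finset.mem_Icc.1 hy).2])
  let G : (Fin n → ℕ) → SQ n := fun y => toQ (g (δ, m - y, y))
  have hh : ∀ k, ∃ h : SZ n, k ∈ Finset.Icc 0 m →
      ∑ y ∈ Finset.Icc 0 m, C (∏ i, if y i ≤ k i then ((-1 : ℚ) ^ (k i - y i) /
        (((k i - y i).factorial : ℚ) * ((y i).factorial : ℚ))) else 0) * G y =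
        fQ ^ (∑ i, k i) * toQ h := by
    intro k
    by_cases hk : k ∈ Finset.Icc 0 m
    swap
    · exact ⟨0, fun h => (hk h).elim⟩
    have hkm : k ≤ m := (Finset.mem_Icc.1 hk).2
    have key : ∃ h : SZ n, ∑ c ∈ Finset.Icc 0 k,
        C ((-1 : ℚ) ^ (∑ i, c i) /
            ((∏ i, ((c i).factorial : ℚ)) * ∏ i, ((k i - c i).factorial : ℚ))) *
          toQ (g (δ, m - k + c, k - c)) = fQ ^ (∑ i, k i) * toQ h := by
      by_cases hk0 : k = 0
      · subst hk0
        exact ⟨g (δ, m, 0), by simp⟩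
      · exact hg δ (m - k) k (hF k hk) hk0
    obtain ⟨h, hh⟩ := key
    refine ⟨h, fun _ => ?_⟩
    rw [← hh]
    have hsub : Finset.Icc 0 k ⊆ Finset.Icc 0 m := Finset.Icc_subset_Icc_right hkm
    rw [← Finset.sum_subset hsub]
    · refine Finset.sum_bij' (fun y _ => k - y) (fun c _ => k - c) ?_ ?_ ?_ ?_ ?_
      · intro y hy; simp
      · intro y hy; simp
      · intro y hy; exact tsub_tsub_cancel_of_le (Finset.mem_Icc.1 hy).2
      · intro y hy; exact tsub_tsub_cancel_of_le (Finset.mem_Icc.1 hy).2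
      · intro y hy
        have hyk := (Finset.mem_Icc.1 hy).2
        have e1 : m - k + (k - y) = m - y := tsub_add_tsub_cancel hkm hyk
        have e2 : k - (k - y) = y := tsub_tsub_cancel_of_le hyk
        rw [e1, e2]
        congr 2
        rw [← Finset.prod_mul_distrib, ← Finset.prod_pow_eq_pow_sum, ← Finset.prod_div_distrib]
        refine Finset.prod_congr rfl fun i _ => ?_
        have e3 : k i - (k i - y i) = y i := congrFun e2 i
        rw [if_pos (hyk i), Pi.sub_apply, e3]
    · intro y _ hy
      obtain ⟨i, hi⟩ : ∃ i, ¬ y i ≤ k i := by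
        by_contra! hcon
        exact hy (Finset.mem_Icc.2 ⟨zero_le, hcon⟩)
      rw [Finset.prod_eq_zero (Finset.mem_univ i) (if_neg hi), C_0, zero_mul]
  choose h hh using hh
  refine ⟨∑ k ∈ Finset.Icc 0 m, C (h k) * ∏ i, ∏ l ∈ Finset.range (k i),
    (C ((m i : SZ n) * fZ - (l : SZ n) * fZ) - X i), fun a b hab hadd => ?_⟩
  apply toQ_injective
  have hf : toQ (fZ (n := n)) = fQ := by simp [toQ, fZ, fQ]
  have hb : b ∈ Finset.Icc 0 m := Finset.mem_Icc.2 ⟨zero_le, hadd ▸ le_add_self⟩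
  have ha : a = m - b := by rw [← hadd, add_tsub_cancel_right]
  have e1 : toQ (MvPolynomial.eval (fun i => (a i : SZ n) * fZ)
      (∑ k ∈ Finset.Icc 0 m, C (h k) * ∏ i, ∏ l ∈ Finset.range (k i),
        (C ((m i : SZ n) * fZ - (l : SZ n) * fZ) - X i))) =
      ∑ k ∈ Finset.Icc 0 m, C (∏ i, ((b i).descFactorial (k i) : ℚ)) *
        (fQ ^ (∑ i, k i) * toQ (h k)) := by
    rw [map_sum, map_sum]
    refine Finset.sum_congr rfl fun k _ => ?_
    rw [map_mul, eval_C, map_prod]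
    have e2 : ∀ i, MvPolynomial.eval (fun i => (a i : SZ n) * fZ) (∏ l ∈ Finset.range (k i),
        (C ((m i : SZ n) * fZ - (l : SZ n) * fZ) - X i)) =
        ((b i).descFactorial (k i) : SZ n) * fZ ^ k i := by
      intro i
      rw [map_prod, ← prod_range_sub_mul_eq_descFactorial]
      refine Finset.prod_congr rfl fun l _ => ?_
      have : m i = a i + b i := (congrFun hadd i).symm
      rw [this]
      simp
      ring
    simp_rw [e2]
    rw [Finset.prod_mul_distrib, Finset.prod_pow_eq_pow_sum, map_mul, map_mul, map_pow, hf,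
      map_prod]
    simp only [map_natCast, map_prod]
    ring
  rw [e1, Finset.sum_congr rfl fun k hk => by rw [← hh k hk]]
  simp_rw [Finset.mul_sum]
  rw [Finset.sum_comm]
  have e3 : ∀ y ∈ Finset.Icc 0 m, ∑ k ∈ Finset.Icc 0 m,
      C (∏ i, ((b i).descFactorial (k i) : ℚ)) * (C (∏ i, if y i ≤ k i then
        ((-1 : ℚ) ^ (k i - y i) / (((k i - y i).factorial : ℚ) * ((y i).factorial : ℚ))) else 0)
          * G y) = if b = y then G y else 0 := by
    intro y _
    have e4 : ∏ i, ∑ k ∈ Finset.Icc 0 (m i), (if y i ≤ k then ((b i).descFactorial k : ℚ) *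
      ((-1 : ℚ) ^ (k - y i) / (((k - y i).factorial : ℚ) * ((y i).factorial : ℚ))) else 0) =
        if b = y then 1 else 0 := by
      rw [Finset.prod_congr rfl fun i _ =>
        sum_choose_inversion ((Finset.mem_Icc.1 hb).2 i) (y i)]
      split_ifs with hby
      · exact Finset.prod_eq_one fun i _ => if_pos (congrFun hby i)
      · obtain ⟨i, hi⟩ := Function.ne_iff.1 hby
        exact Finset.prod_eq_zero (Finset.mem_univ i) (if_neg hi)
    rw [Finset.prod_univ_sum, ← Icc_zero_eq_piFinset] at e4
    have e5 : (if b = y then G y else 0) = C (if b = y then (1 : ℚ) else 0) * G y := by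
      split_ifs <;> simp
    rw [e5, ← e4, map_sum, Finset.sum_mul]
    refine Finset.sum_congr rfl fun k _ => ?_
    rw [← mul_assoc, ← C_mul, ← Finset.prod_mul_distrib]
    congr 2
    refine Finset.prod_congr rfl fun i _ => ?_
    rw [mul_ite, mul_zero]
  rw [Finset.sum_congr rfl e3, Finset.sum_ite_eq, if_pos hb, ha]

/-! ### The algebra of tuples satisfying the relations -/

/-- The torus-fixed points. -/
abbrev FixedPt (n r d : ℕ) := {t : Triple n // inF n r d t}

lemma inF.add_le {n r d : ℕ} {t : Triple n} (h : inF n r d t) (i : Fin n) :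
    t.2.1 i + t.2.2 i ≤ d := by
  rw [← h.2.1]
  exact Finset.single_le_sum (f := fun i => t.2.1 i + t.2.2 i) (fun _ _ => Nat.zero_le _)
    (Finset.mem_univ i)

instance (n r d : ℕ) : Finite (FixedPt n r d) := by
  let φ : FixedPt n r d → (Fin n → Bool) × (Fin n → Fin (d + 1)) × (Fin n → Fin (d + 1)) :=
    fun t => (t.1.1, fun i => ⟨t.1.2.1 i, by have := t.2.add_le i; omega⟩,
      fun i => ⟨t.1.2.2 i, by have := t.2.add_le i; omega⟩)
  refine Finite.of_injective φ ?_
  rintro ⟨⟨δ, a, b⟩, h⟩ ⟨⟨δ', a', b'⟩, h'⟩ heq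
  simp only [φ, Prod.mk.injEq, funext_iff, Fin.mk.injEq] at heq
  simp only [Subtype.mk.injEq, Prod.mk.injEq, funext_iff]
  exact heq

instance (n r d : ℕ) : Fintype (FixedPt n r d) := Fintype.ofFinite _

lemma inF.mixed {n r d : ℕ} {δ : Fin n → Bool} {a b a' b' : Fin n → ℕ}
    (h : inF n r d (δ, a, b)) (ha : inF n r d (δ, a', b)) (hb : inF n r d (δ, a, b')) :
    inF n r d (δ, a', b') := by
  obtain ⟨h1, h2, h3⟩ := h
  obtain ⟨-, ha2, ha3⟩ := ha
  obtain ⟨-, hb2, hb3⟩ := hb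
  refine ⟨h1, ?_, fun i hi => ⟨(ha3 i hi).1, (hb3 i hi).2⟩⟩
  simp only [Finset.sum_add_distrib] at *
  omega

/-- The conjunction of the relations defining the integral Chow ring, with relation III′ replaced
by its polynomial form. -/
structure Rels (n r d : ℕ) (g : Triple n → SZ n) : Prop where
  relI : RelI n r d g
  relIIa : RelIIa n r d g
  relIIb : RelIIb n r d g
  relIIc : RelIIc' n r d g
  poly : PolyOnComponents n r d g

lemma rels_iff {n r d : ℕ} {g : Triple n → SZ n} :
    Rels n r d g ↔ RelI n r d g ∧ RelIIa n r d g ∧ RelIIb n r d g ∧ RelIIc' n r d g ∧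
      RelIII' n r d g :=
  ⟨fun h => ⟨h.1, h.2, h.3, h.4, h.5.relIII'⟩,
    fun h => ⟨h.1, h.2.1, h.2.2.1, h.2.2.2.1, h.2.2.2.2.polyOnComponents⟩⟩

lemma Rels.congr {n r d : ℕ} {g g' : Triple n → SZ n} (h : Rels n r d g)
    (hg : ∀ t, inF n r d t → g t = g' t) : Rels n r d g' where
  relI δ δ' a b a' b' i j h1 h2 := by
    rw [← hg _ h1, ← hg _ h2]
    exact h.relI δ δ' a b a' b' i j h1 h2
  relIIa δ a b a' i j h1 h2 := by
    rw [← hg _ h1, ← hg _ h2]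
    exact h.relIIa δ a b a' i j h1 h2
  relIIb δ a b b' i j h1 h2 := by
    rw [← hg _ h1, ← hg _ h2]
    exact h.relIIb δ a b b' i j h1 h2
  relIIc δ a b a' b' i j h1 h2 h3 := by
    rw [← hg _ h1, ← hg _ h2, ← hg _ h3, ← hg _ (h1.mixed h2 h3)]
    exact h.relIIc δ a b a' b' i j h1 h2 h3
  poly δ m := by
    obtain ⟨P, hP⟩ := h.poly δ m
    exact ⟨P, fun a b hab => by rw [← hg _ hab]; exact hP a b hab⟩

/-- Functions on all triples whose restriction to the fixed points satisfies the relations. -/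
def totalChow (n r d : ℕ) : Subalgebra (SZ n) (Triple n → SZ n) where
  carrier := {g | Rels n r d g}
  mul_mem' {g g'} h h' := {
    relI := fun δ δ' a b a' b' i j h1 h2 hij hk p1 p2 p3 p4 =>
      dvd_mul_sub_mul (h.relI δ δ' a b a' b' i j h1 h2 hij hk p1 p2 p3 p4)
        (h'.relI δ δ' a b a' b' i j h1 h2 hij hk p1 p2 p3 p4)
    relIIa := fun δ a b a' i j h1 h2 hij hk =>
      dvd_mul_sub_mul (h.relIIa δ a b a' i j h1 h2 hij hk) (h'.relIIa δ a b a' i j h1 h2 hij hk)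
    relIIb := fun δ a b b' i j h1 h2 hij hk =>
      dvd_mul_sub_mul (h.relIIb δ a b b' i j h1 h2 hij hk) (h'.relIIb δ a b b' i j h1 h2 hij hk)
    relIIc := fun δ a b a' b' i j h1 h2 h3 hij hk hk' heq => by
      have h4 := h1.mixed h2 h3
      obtain ⟨u, hu⟩ := h.relIIa δ a b a' i j h1 h2 hij hk
      obtain ⟨v, hv⟩ := h.relIIb δ a b b' i j h1 h3 hij hk'
      obtain ⟨w, hw⟩ := h.relIIc δ a b a' b' i j h1 h2 h3 hij hk hk' heq
      obtain ⟨u', hu'⟩ := h'.relIIb δ a' b b' i j h2 h4 hij hk'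
      obtain ⟨v', hv'⟩ := h'.relIIa δ a b' a' i j h3 h4 hij hk
      obtain ⟨w', hw'⟩ := h'.relIIc δ a b a' b' i j h1 h2 h3 hij hk hk' heq
      rw [← heq] at hv hu'
      refine ⟨g (δ, a, b) * w' + u * u' + v * v' + w * g' (δ, a', b'), ?_⟩
      simp only [Pi.mul_apply]
      linear_combination g (δ, a, b) * hw' + (g' (δ, a', b) - g' (δ, a', b')) * hu +
        (eZ j - eZ i + C ((a' j : ℤ) - a i) * fZ) * u * hu' +
        (g' (δ, a, b') - g' (δ, a', b')) * hv +
        (eZ j - eZ i + C ((a' j : ℤ) - a i) * fZ) * v * hv' + g' (δ, a', b') * hw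
    poly := fun δ m => by
      obtain ⟨P, hP⟩ := h.poly δ m
      obtain ⟨P', hP'⟩ := h'.poly δ m
      refine ⟨P * P', fun a b h1 h2 => ?_⟩
      rw [map_mul, Pi.mul_apply, hP a b h1 h2, hP' a b h1 h2] }
  add_mem' {g g'} h h' := {
    relI := fun δ δ' a b a' b' i j h1 h2 hij hk p1 p2 p3 p4 => by
      rw [Pi.add_apply, Pi.add_apply, add_sub_add_comm]
      exact dvd_add (h.relI δ δ' a b a' b' i j h1 h2 hij hk p1 p2 p3 p4)
        (h'.relI δ δ' a b a' b' i j h1 h2 hij hk p1 p2 p3 p4)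
    relIIa := fun δ a b a' i j h1 h2 hij hk => by
      rw [Pi.add_apply, Pi.add_apply, add_sub_add_comm]
      exact dvd_add (h.relIIa δ a b a' i j h1 h2 hij hk) (h'.relIIa δ a b a' i j h1 h2 hij hk)
    relIIb := fun δ a b b' i j h1 h2 hij hk => by
      rw [Pi.add_apply, Pi.add_apply, add_sub_add_comm]
      exact dvd_add (h.relIIb δ a b b' i j h1 h2 hij hk) (h'.relIIb δ a b b' i j h1 h2 hij hk)
    relIIc := fun δ a b a' b' i j h1 h2 h3 hij hk hk' heq => by
      obtain ⟨w, hw⟩ := h.relIIc δ a b a' b' i j h1 h2 h3 hij hk hk' heq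
      obtain ⟨w', hw'⟩ := h'.relIIc δ a b a' b' i j h1 h2 h3 hij hk hk' heq
      refine ⟨w + w', ?_⟩
      simp only [Pi.add_apply]
      linear_combination hw + hw'
    poly := fun δ m => by
      obtain ⟨P, hP⟩ := h.poly δ m
      obtain ⟨P', hP'⟩ := h'.poly δ m
      refine ⟨P + P', fun a b h1 h2 => ?_⟩
      rw [map_add, Pi.add_apply, hP a b h1 h2, hP' a b h1 h2] }
  algebraMap_mem' s := {
    relI := fun δ δ' a b a' b' i j _ _ _ _ _ _ _ _ => by simp
    relIIa := fun δ a b a' i j _ _ _ _ => by simp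
    relIIb := fun δ a b b' i j _ _ _ _ => by simp
    relIIc := fun δ a b a' b' i j _ _ _ _ _ _ _ => by simp
    poly := fun δ m => ⟨C s, fun a b _ _ => by simp⟩ }

lemma mem_totalChow {n r d : ℕ} {g : Triple n → SZ n} : g ∈ totalChow n r d ↔ Rels n r d g :=
  Iff.rfl

/-- Restriction to the fixed points. -/
def restrictF (n r d : ℕ) : (Triple n → SZ n) →ₐ[SZ n] (FixedPt n r d → SZ n) :=
  AlgHom.pi fun t => Pi.evalAlgHom (SZ n) _ t.1

/-- The algebra of tuples satisfying the relations. -/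
def chow (n r d : ℕ) : Subalgebra (SZ n) (FixedPt n r d → SZ n) :=
  (totalChow n r d).map (restrictF n r d)

lemma extTuple_apply {n r d : ℕ} (g : FixedPt n r d → SZ n) (t : FixedPt n r d) :
    extTuple n r d g t.1 = g t := by
  simp [extTuple, t.2]

lemma mem_chow {n r d : ℕ} {g : FixedPt n r d → SZ n} :
    g ∈ chow n r d ↔ Rels n r d (extTuple n r d g) := by
  constructor
  · rintro ⟨c, hc, rfl⟩
    exact (mem_totalChow.1 hc).congr fun t ht => (extTuple_apply (restrictF n r d c) ⟨t, ht⟩).symm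
  · intro h
    exact ⟨_, h, funext fun t => extTuple_apply g t⟩

lemma restrictF_mem_chow {n r d : ℕ} {c : Triple n → SZ n} (h : Rels n r d c) :
    restrictF n r d c ∈ chow n r d := ⟨c, h, rfl⟩

/-! ### Products over integer intervals -/

lemma prod_Ico_mul_prod_Ico {R : Type*} [CommMonoid R] (h : ℤ → R) {x y z : ℤ} (hxy : x ≤ y)
    (hyz : y ≤ z) : (∏ k ∈ Ico x y, h k) * ∏ k ∈ Ico y z, h k = ∏ k ∈ Ico x z, h k := by
  rw [← Finset.prod_union (Finset.Ico_disjoint_Ico_consecutive x y z),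
    Finset.Ico_union_Ico_eq_Ico hxy hyz]

lemma prod_Ico_swap {R : Type*} [CommMonoid R] (h : ℤ → R) {x x' y y' : ℤ} (h1 : x ≤ y)
    (h2 : x ≤ y') (h3 : x' ≤ y) (h4 : x' ≤ y') :
    (∏ k ∈ Ico x y, h k) * ∏ k ∈ Ico x' y', h k =
      (∏ k ∈ Ico x y', h k) * ∏ k ∈ Ico x' y, h k := by
  wlog hy : y ≤ y' generalizing y y'
  · exact (this h2 h1 h4 h3 (not_le.1 hy).le).symm
  rw [← prod_Ico_mul_prod_Ico h h1 hy, ← prod_Ico_mul_prod_Ico h h3 hy]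
  ac_rfl

lemma prod_Ico_shift {R : Type*} [CommMonoid R] (h : ℤ → R) (x y s : ℤ) :
    ∏ k ∈ Ico x y, h (k + s) = ∏ k ∈ Ico (x + s) (y + s), h k := by
  rw [← Finset.map_add_right_Ico x y s, Finset.prod_map]
  rfl

lemma prod_Ico_int_eq_prod_range {R : Type*} [CommMonoid R] (h : ℤ → R) (x : ℤ) (N : ℕ) :
    ∏ k ∈ Ico x (x + N), h k = ∏ l ∈ Finset.range N, h (x + l) := by
  induction N with
  | zero => simp
  | succ N ih =>
    rw [Finset.prod_range_succ, ← ih, ← prod_Ico_mul_prod_Ico h (y := x + N) (by omega)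
      (by push_cast; omega)]
    congr 1
    have : Ico (x + N) (x + (N + 1 : ℕ)) = {x + (N : ℤ)} := by
      ext k
      simp only [Finset.mem_Ico, Finset.mem_singleton]
      omega
    rw [this, Finset.prod_singleton]

lemma prod_univ_eq_mul_mul {ι R : Type*} [Fintype ι] [DecidableEq ι] [CommMonoid R] {i j : ι}
    (hij : i ≠ j) (F : ι → R) :
    ∏ k, F k = F i * F j * ∏ k ∈ Finset.univ \ {i, j}, F k := by
  rw [← Finset.prod_pair hij, mul_comm, Finset.prod_sdiff (Finset.subset_univ _)]

lemma sum_univ_eq_add_add {ι R : Type*} [Fintype ι] [DecidableEq ι] [AddCommMonoid R] {i j : ι}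
    (hij : i ≠ j) (F : ι → R) :
    ∑ k, F k = F i + F j + ∑ k ∈ Finset.univ \ {i, j}, F k := by
  rw [← Finset.sum_pair hij, add_comm, Finset.sum_sdiff (Finset.subset_univ _)]

lemma add_eq_add_of_sum_eq {n : ℕ} {i j : Fin n} (hij : i ≠ j) {a a' : Fin n → ℕ}
    (h : ∀ k, k ≠ i → k ≠ j → a k = a' k) (hs : ∑ k, a k = ∑ k, a' k) :
    a i + a j = a' i + a' j := by
  rw [sum_univ_eq_add_add hij, sum_univ_eq_add_add hij a',
    Finset.sum_congr rfl fun k hk => ?_] at hs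
  · exact Nat.add_right_cancel hs
  · simp only [Finset.mem_sdiff, Finset.mem_insert, Finset.mem_singleton, not_or] at hk
    exact h k hk.2.1 hk.2.2

lemma inF.add_eq_add_left {n r d : ℕ} {δ : Fin n → Bool} {a b a' : Fin n → ℕ} {i j : Fin n}
    (h : inF n r d (δ, a, b)) (h' : inF n r d (δ, a', b)) (hij : i ≠ j)
    (hk : ∀ k, k ≠ i → k ≠ j → a k = a' k) : a i + a j = a' i + a' j := by
  refine add_eq_add_of_sum_eq hij hk ?_
  have h1 := h.2.1
  have h2 := h'.2.1
  simp only [Finset.sum_add_distrib] at h1 h2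
  omega

lemma inF.add_eq_add_right {n r d : ℕ} {δ : Fin n → Bool} {a b b' : Fin n → ℕ} {i j : Fin n}
    (h : inF n r d (δ, a, b)) (h' : inF n r d (δ, a, b')) (hij : i ≠ j)
    (hk : ∀ k, k ≠ i → k ≠ j → b k = b' k) : b i + b j = b' i + b' j := by
  refine add_eq_add_of_sum_eq hij hk ?_
  have h1 := h.2.1
  have h2 := h'.2.1
  simp only [Finset.sum_add_distrib] at h1 h2
  omega

lemma inF.left_eq_of_not {n r d : ℕ} {δ : Fin n → Bool} {a b a' : Fin n → ℕ} {i j : Fin n}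
    (h : inF n r d (δ, a, b)) (h' : inF n r d (δ, a', b)) (hij : i ≠ j)
    (hk : ∀ k, k ≠ i → k ≠ j → a k = a' k) (hδ : ¬ (δ i = true ∧ δ j = true)) : a = a' := by
  have h1 := h.add_eq_add_left h' hij hk
  have h2 : ∀ k, δ k = false → a k = a' k := fun k hk =>
    (h.2.2 k hk).1.trans (h'.2.2 k hk).1.symm
  funext k
  by_cases hki : k = i
  · subst hki
    cases hi : δ k
    · exact h2 k hi
    · cases hj : δ j
      · have := h2 j hj
        omega
      · exact (hδ ⟨hi, hj⟩).elim
  · by_cases hkj : k = j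
    · subst hkj
      cases hj : δ k
      · exact h2 k hj
      · cases hi : δ i
        · have := h2 i hi
          omega
        · exact (hδ ⟨hi, hj⟩).elim
    · exact hk k hki hkj

lemma inF.right_eq_of_not {n r d : ℕ} {δ : Fin n → Bool} {a b b' : Fin n → ℕ} {i j : Fin n}
    (h : inF n r d (δ, a, b)) (h' : inF n r d (δ, a, b')) (hij : i ≠ j)
    (hk : ∀ k, k ≠ i → k ≠ j → b k = b' k) (hδ : ¬ (δ i = true ∧ δ j = true)) : b = b' := by
  have hswap : ∀ {a b : Fin n → ℕ}, inF n r d (δ, a, b) → inF n r d (δ, b, a) :=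
    fun h => inF_of_add_eq h (add_comm _ _)
  exact (hswap h).left_eq_of_not (hswap h') hij hk hδ

/-! ### Interval classes -/

/-- The linear factor `U - (e_i + k f)`. -/
def linFactor {n : ℕ} (i : Fin n) (k : ℤ) : Polynomial (SZ n) :=
  Polynomial.X - Polynomial.C (eZ i + C k * fZ)

/-- The product of the linear factors `U - (e_i + k f)`, over `i` in the support of `δ` and
`u_i ≤ k < v_i`. -/
def boxPoly {n : ℕ} (δ : Fin n → Bool) (u v : Fin n → ℤ) : Polynomial (SZ n) :=
  ∏ i, if δ i = true then ∏ k ∈ Ico (u i) (v i), linFactor i k else 1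

/-- The product of the linear factors `U - (e_i + k f)`, over `i` in the support of `δ` and
`c - b_i ≤ k < c + a_i + κ`. -/
def ivPoly {n : ℕ} (κ : ℕ) (c : ℤ) (t : Triple n) : Polynomial (SZ n) :=
  boxPoly t.1 (fun i => c - t.2.2 i) (fun i => c + t.2.1 i + κ)

lemma boxPoly_split {n : ℕ} {δ : Fin n → Bool} {u v w : Fin n → ℤ} (huv : ∀ i, u i ≤ v i)
    (hvw : ∀ i, v i ≤ w i) : boxPoly δ u w = boxPoly δ u v * boxPoly δ v w := by
  rw [boxPoly, boxPoly, boxPoly, ← Finset.prod_mul_distrib]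
  refine Finset.prod_congr rfl fun i _ => ?_
  split_ifs
  · exact (prod_Ico_mul_prod_Ico _ (huv i) (hvw i)).symm
  · exact (one_mul 1).symm

lemma map_linFactor_rho_of_ne {n : ℕ} {i j p : Fin n} (hp : p ≠ j) (k s : ℤ) :
    (linFactor p k).map (rho i j s : SZ n →+* SZ n) = linFactor p k := by
  simp [linFactor, rho, eZ, fZ, hp]

lemma map_linFactor_rho {n : ℕ} (i j : Fin n) (k s : ℤ) :
    (linFactor j k).map (rho i j s : SZ n →+* SZ n) = linFactor i (k - s) := by
  simp [linFactor, rho, eZ, fZ]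
  ring

lemma C_lin_dvd_sub_of_map_eq {n : ℕ} {i j : Fin n} (hij : i ≠ j) {s : ℤ}
    {p q : Polynomial (SZ n)}
    (h : p.map (rho i j s : SZ n →+* SZ n) = q.map (rho i j s : SZ n →+* SZ n)) :
    Polynomial.C (lin i j s) ∣ p - q := by
  rw [Polynomial.C_dvd_iff_dvd_coeff]
  intro m
  rw [lin_dvd_iff hij, Polynomial.coeff_sub, map_sub, sub_eq_zero]
  simpa using congrArg (fun p => Polynomial.coeff p m) h

lemma C_lin_dvd_boxPoly_sub {n : ℕ} {i j : Fin n} (hij : i ≠ j) {s : ℤ} {δ δ' : Fin n → Bool}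
    {u v u' v' : Fin n → ℤ} (hδ : ∀ k, k ≠ i → k ≠ j → δ k = δ' k)
    (hu : ∀ k, k ≠ i → k ≠ j → u k = u' k) (hv : ∀ k, k ≠ i → k ≠ j → v k = v' k)
    (h : ((if δ i = true then ∏ k ∈ Ico (u i) (v i), linFactor i k else 1) *
        if δ j = true then ∏ k ∈ Ico (u j - s) (v j - s), linFactor i k else 1) =
      ((if δ' i = true then ∏ k ∈ Ico (u' i) (v' i), linFactor i k else 1) *
        if δ' j = true then ∏ k ∈ Ico (u' j - s) (v' j - s), linFactor i k else 1)) :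
    Polynomial.C (lin i j s) ∣ boxPoly δ u v - boxPoly δ' u' v' := by
  apply C_lin_dvd_sub_of_map_eq hij
  have hmul : ∀ p q : Polynomial (SZ n), (p * q).map (rho i j s : SZ n →+* SZ n) =
      p.map (rho i j s : SZ n →+* SZ n) * q.map (rho i j s : SZ n →+* SZ n) :=
    fun _ _ => Polynomial.map_mul _
  rw [boxPoly, boxPoly, prod_univ_eq_mul_mul hij, prod_univ_eq_mul_mul hij, hmul, hmul (_ * _)]
  refine congrArg₂ (· * ·) ?_ ?_
  · have key : ∀ (δ : Fin n → Bool) (u v : Fin n → ℤ), Polynomial.map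
        (rho i j s : SZ n →+* SZ n)
        ((if δ i = true then ∏ k ∈ Ico (u i) (v i), linFactor i k else 1) *
          if δ j = true then ∏ k ∈ Ico (u j) (v j), linFactor j k else 1) =
        ((if δ i = true then ∏ k ∈ Ico (u i) (v i), linFactor i k else 1) *
          if δ j = true then ∏ k ∈ Ico (u j - s) (v j - s), linFactor i k else 1) := by
      intro δ u v
      rw [Polynomial.map_mul, apply_ite (Polynomial.map _), apply_ite (Polynomial.map _),
        Polynomial.map_prod, Polynomial.map_prod]
      simp_rw [map_linFactor_rho_of_ne hij, map_linFactor_rho, Polynomial.map_one, sub_eq_add_neg,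
        prod_Ico_shift (linFactor i)]
    rw [key, key, h]
  · refine congrArg _ ?_
    refine Finset.prod_congr rfl fun k hk => ?_
    simp only [Finset.mem_sdiff, Finset.mem_insert, Finset.mem_singleton, not_or] at hk
    rw [hδ k hk.2.1 hk.2.2, hu k hk.2.1 hk.2.2, hv k hk.2.1 hk.2.2]

lemma C_lin_dvd_upper_sub {n r d : ℕ} {i j : Fin n} (hij : i ≠ j) {δ : Fin n → Bool}
    {a b a' : Fin n → ℕ} (h : inF n r d (δ, a, b)) (h' : inF n r d (δ, a', b))
    (hk : ∀ k, k ≠ i → k ≠ j → a k = a' k) (c : ℤ) (κ : ℕ) :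
    Polynomial.C (lin i j ((a' j : ℤ) - a i)) ∣
      boxPoly δ (fun _ => c) (fun i => c + a i + κ) -
        boxPoly δ (fun _ => c) (fun i => c + a' i + κ) := by
  by_cases hδ : δ i = true ∧ δ j = true
  · refine C_lin_dvd_boxPoly_sub hij (fun _ _ _ => rfl) (fun _ _ _ => rfl)
      (fun k h1 h2 => by rw [hk k h1 h2]) ?_
    have hs := h.add_eq_add_left h' hij hk
    simp only [hδ.1, hδ.2, if_true]
    have e1 : c + a j + κ - ((a' j : ℤ) - a i) = c + a' i + κ := by omega
    have e2 : c + a' j + κ - ((a' j : ℤ) - a i) = c + a i + κ := by omega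
    rw [e1, e2]
    exact prod_Ico_swap _ (by omega) (by omega) (by omega) (by omega)
  · rw [h.left_eq_of_not h' hij hk hδ, sub_self]
    exact dvd_zero _

lemma C_lin_dvd_lower_sub {n r d : ℕ} {i j : Fin n} (hij : i ≠ j) {δ : Fin n → Bool}
    {a b b' : Fin n → ℕ} (h : inF n r d (δ, a, b)) (h' : inF n r d (δ, a, b'))
    (hk : ∀ k, k ≠ i → k ≠ j → b k = b' k) (c : ℤ) :
    Polynomial.C (lin i j ((b i : ℤ) - b' j)) ∣
      boxPoly δ (fun i => c - b i) (fun _ => c) -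
        boxPoly δ (fun i => c - b' i) (fun _ => c) := by
  by_cases hδ : δ i = true ∧ δ j = true
  · refine C_lin_dvd_boxPoly_sub hij (fun _ _ _ => rfl)
      (fun k h1 h2 => by rw [hk k h1 h2]) (fun _ _ _ => rfl) ?_
    have hs := h.add_eq_add_right h' hij hk
    simp only [hδ.1, hδ.2, if_true]
    have e1 : c - b j - ((b i : ℤ) - b' j) = c - b' i := by omega
    have e2 : c - b' j - ((b i : ℤ) - b' j) = c - b i := by omega
    rw [e1, e2, mul_comm (∏ k ∈ Ico (c - (b' i : ℤ)) c, linFactor i k)]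
    exact prod_Ico_swap _ (by omega) (by omega) (by omega) (by omega)
  · rw [h.right_eq_of_not h' hij hk hδ, sub_self]
    exact dvd_zero _

lemma ivPoly_eq_mul {n : ℕ} (κ : ℕ) (c : ℤ) (δ : Fin n → Bool) (a b : Fin n → ℕ) :
    ivPoly κ c (δ, a, b) = boxPoly δ (fun i => c - b i) (fun _ => c) *
      boxPoly δ (fun _ => c) (fun i => c + a i + κ) :=
  boxPoly_split (fun i => by omega) (fun i => by omega)

lemma C_lin_dvd_ivPoly_sub {n r d : ℕ} {δ δ' : Fin n → Bool} {a b a' b' : Fin n → ℕ} {i j : Fin n}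
    (h : inF n r d (δ, a, b)) (h' : inF n r d (δ', a', b')) (hij : i ≠ j)
    (hk : ∀ k, k ≠ i → k ≠ j → δ k = δ' k ∧ a k = a' k ∧ b k = b' k)
    (hi : δ i = true) (hj' : δ' j = true) (hj : δ j = false) (hi' : δ' i = false) (κ : ℕ) (c : ℤ) :
    Polynomial.C (lin i j ((a' j : ℤ) - a i)) ∣
      ivPoly κ c (δ, a, b) - ivPoly κ c (δ', a', b') := by
  have hs : (a i + b i) + (a j + b j) = (a' i + b' i) + (a' j + b' j) :=
    add_eq_add_of_sum_eq (a := fun i => a i + b i) (a' := fun i => a' i + b' i) hij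
      (fun k h1 h2 => by simp only [(hk k h1 h2).2.1, (hk k h1 h2).2.2])
      (h.2.1.trans h'.2.1.symm)
  obtain ⟨z1, z2⟩ := h.2.2 j hj
  obtain ⟨z3, z4⟩ := h'.2.2 i hi'
  simp only at z1 z2 z3 z4
  refine C_lin_dvd_boxPoly_sub hij (fun k h1 h2 => (hk k h1 h2).1)
    (fun k h1 h2 => by simp only [(hk k h1 h2).2.2])
    (fun k h1 h2 => by simp only [(hk k h1 h2).2.1]) ?_
  simp only [hi, hj, hi', hj', if_true, Bool.false_eq_true, if_false, one_mul, mul_one]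
  congr 2 <;> omega

lemma rels_coeff_ivPoly {n : ℕ} (r d κ : ℕ) (c : ℤ) (m : ℕ) :
    Rels n r d fun t => (ivPoly κ c t).coeff m where
  relI δ δ' a b a' b' i j h h' hij hk hi hj' hj hi' := by
    rw [← Polynomial.coeff_sub]
    exact (Polynomial.C_dvd_iff_dvd_coeff _ _).1
      (C_lin_dvd_ivPoly_sub h h' hij hk hi hj' hj hi' κ c) m
  relIIa δ a b a' i j h h' hij hk := by
    rw [← Polynomial.coeff_sub, ivPoly_eq_mul, ivPoly_eq_mul, ← mul_sub]
    exact (Polynomial.C_dvd_iff_dvd_coeff _ _).1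
      ((C_lin_dvd_upper_sub hij h h' hk c κ).mul_left _) m
  relIIb δ a b b' i j h h' hij hk := by
    rw [← Polynomial.coeff_sub, ivPoly_eq_mul, ivPoly_eq_mul, ← sub_mul]
    exact (Polynomial.C_dvd_iff_dvd_coeff _ _).1
      ((C_lin_dvd_lower_sub hij h h' hk c).mul_right _) m
  relIIc δ a b a' b' i j h h' h'' hij hk hk' heq := by
    rw [← Polynomial.coeff_sub, ← Polynomial.coeff_sub, ← Polynomial.coeff_add]
    refine (Polynomial.C_dvd_iff_dvd_coeff _ _).1 ?_ m
    have h1 := C_lin_dvd_lower_sub hij h h'' hk' c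
    rw [← heq] at h1
    have h2 := mul_dvd_mul h1 (C_lin_dvd_upper_sub hij h h' hk c κ)
    rw [← Polynomial.C_mul, ← sq] at h2
    convert h2 using 1
    · rfl
    · simp only [ivPoly_eq_mul]
      ring
  poly δ M := by
    let Q : Polynomial (MvPolynomial (Fin n) (SZ n)) := ∏ i, if δ i = true then
      ∏ l ∈ Finset.range (M i + κ), (Polynomial.X -
        Polynomial.C (C (eZ i + C (c - M i + l : ℤ) * fZ) + X i)) else 1
    refine ⟨Q.coeff m, fun a b _ hab => ?_⟩
    rw [← Polynomial.coeff_map, Polynomial.map_prod]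
    refine congrArg (fun p => Polynomial.coeff p m) ?_
    rw [ivPoly, boxPoly]
    refine Finset.prod_congr rfl fun i _ => ?_
    rw [apply_ite (Polynomial.map _), Polynomial.map_one, Polynomial.map_prod]
    split_ifs
    · have hM : M i = a i + b i := (congrFun hab i).symm
      have e1 : (c + a i + κ : ℤ) = c - b i + (M i + κ : ℕ) := by push_cast; omega
      dsimp only
      rw [e1, prod_Ico_int_eq_prod_range]
      refine Finset.prod_congr rfl fun l _ => ?_
      simp only [linFactor, Polynomial.map_sub, Polynomial.map_X, map_add]
      congr 2
      rw [hM]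
      simp
      ring
    · rfl

/-! ### Families of polynomials with coefficients in a ring of functions -/

section PolyIn

variable {ι S : Type*} [CommRing S]

/-- Evaluation at a point, on a ring of functions. -/
def evalAt (A : Subring (ι → S)) (i : ι) : A →+* S := (Pi.evalRingHom (fun _ => S) i).comp A.subtype

/-- The family `p` is given by a polynomial with coefficients in `A`. -/
def PolyIn (A : Subring (ι → S)) (p : ι → Polynomial S) : Prop :=
  ∃ P : Polynomial A, ∀ i, P.map (evalAt A i) = p i

variable {A : Subring (ι → S)} {p q : ι → Polynomial S}

lemma PolyIn.coeff_mem (h : PolyIn A p) (k : ℕ) : (fun i => (p i).coeff k) ∈ A := by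
  obtain ⟨P, hP⟩ := h
  convert (P.coeff k).2 using 1
  funext i
  rw [← hP i, Polynomial.coeff_map]
  rfl

lemma PolyIn.of_coeff_mem {N : ℕ} (hN : ∀ i, (p i).natDegree ≤ N)
    (h : ∀ k, (fun i => (p i).coeff k) ∈ A) : PolyIn A p := by
  refine ⟨∑ k ∈ Finset.range (N + 1), Polynomial.monomial k ⟨_, h k⟩, fun i => ?_⟩
  rw [Polynomial.map_sum, (p i).as_sum_range' (N + 1) (Nat.lt_succ_of_le (hN i))]
  refine Finset.sum_congr rfl fun k _ => ?_
  rw [Polynomial.map_monomial]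
  rfl

lemma PolyIn.mul (hp : PolyIn A p) (hq : PolyIn A q) : PolyIn A fun i => p i * q i := by
  obtain ⟨P, hP⟩ := hp
  obtain ⟨Q, hQ⟩ := hq
  exact ⟨P * Q, fun i => by rw [Polynomial.map_mul, hP, hQ]⟩

lemma PolyIn.prod {κ : Type*} (s : Finset κ) {p : κ → ι → Polynomial S}
    (hp : ∀ k ∈ s, PolyIn A (p k)) : PolyIn A fun i => ∏ k ∈ s, p k i := by
  choose! P hP using hp
  refine ⟨∏ k ∈ s, P k, fun i => ?_⟩
  rw [Polynomial.map_prod]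
  exact Finset.prod_congr rfl fun k hk => hP k hk i

lemma PolyIn.X_pow (k : ℕ) : PolyIn A fun _ : ι => (Polynomial.X ^ k : Polynomial S) :=
  ⟨Polynomial.X ^ k, fun i => by simp⟩

lemma PolyIn.comp_X_add_C (hp : PolyIn A p) {c : ι → S} (hc : c ∈ A) :
    PolyIn A fun i => (p i).comp (Polynomial.X + Polynomial.C (c i)) := by
  obtain ⟨P, hP⟩ := hp
  refine ⟨P.comp (Polynomial.X + Polynomial.C ⟨c, hc⟩), fun i => ?_⟩
  rw [Polynomial.map_comp, hP]
  simp [evalAt]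

lemma PolyIn.of_mul_eq (hp : PolyIn A p) (hq : PolyIn A q) {N : ℕ} (hmonic : ∀ i, (q i).Monic)
    (hN : ∀ i, (q i).natDegree = N) {z : ι → Polynomial S} (hz : ∀ i, q i * z i = p i) :
    PolyIn A z := by
  obtain ⟨P, hP⟩ := hp
  obtain ⟨Q, hQ⟩ := hq
  have hQm : Q.Monic := by
    have hcoeff : ∀ k i, (Q.coeff k : ι → S) i = (q i).coeff k := fun k i => by
      rw [← hQ i, Polynomial.coeff_map]
      rfl
    refine Polynomial.monic_of_natDegree_le_of_coeff_eq_one N ?_ ?_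
    · rw [Polynomial.natDegree_le_iff_coeff_eq_zero]
      intro k hk
      apply Subtype.ext
      funext i
      rw [hcoeff, Polynomial.coeff_eq_zero_of_natDegree_lt (by rwa [hN i])]
      rfl
    · apply Subtype.ext
      funext i
      rw [hcoeff, ← hN i]
      exact hmonic i
  refine ⟨P /ₘ Q, fun i => ?_⟩
  rw [Polynomial.map_divByMonic _ hQm, hP, hQ, ← hz i,
      Polynomial.mul_divByMonic_cancel_left _ (hmonic i)]

lemma PolyIn.prod_comp [IsDomain S] {κ : Type*} {s : ι → Finset κ} {y : ι → κ → S} {N : ℕ}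
    (hp : PolyIn A p) (hs : ∀ i, (s i).card = N)
    (hq : PolyIn A fun i => ∏ x ∈ s i, (Polynomial.X - Polynomial.C (y i x))) :
    PolyIn A fun i => ∏ x ∈ s i, (p i).comp (Polynomial.X + Polynomial.C (y i x)) := by
  obtain ⟨P, hP⟩ := hp
  obtain ⟨Q, hQ⟩ := hq
  refine ⟨Polynomial.resultant (Q.map Polynomial.C)
    ((P.map Polynomial.C).comp (Polynomial.X + Polynomial.C Polynomial.X)) N P.natDegree,
    fun i => ?_⟩
  have hC : (Polynomial.mapRingHom (evalAt A i)).comp Polynomial.C =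
      Polynomial.C.comp (evalAt A i) := by
    ext x
    simp
  have e1 : (Q.map Polynomial.C).map (Polynomial.mapRingHom (evalAt A i)) =
      ∏ x ∈ s i, (Polynomial.X - Polynomial.C (Polynomial.C (y i x))) := by
    rw [Polynomial.map_map, hC, ← Polynomial.map_map, hQ, Polynomial.map_prod]
    simp
  have e2 : ((P.map Polynomial.C).comp (Polynomial.X + Polynomial.C Polynomial.X)).map
      (Polynomial.mapRingHom (evalAt A i)) =
      ((p i).map Polynomial.C).comp (Polynomial.X + Polynomial.C Polynomial.X) := by
    rw [Polynomial.map_comp, Polynomial.map_map, hC, ← Polynomial.map_map, hP]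
    simp
  have hdeg : (((p i).map Polynomial.C).comp
      (Polynomial.X + Polynomial.C Polynomial.X)).natDegree ≤ P.natDegree := by
    rw [Polynomial.natDegree_comp, Polynomial.natDegree_X_add_C, mul_one]
    exact Polynomial.natDegree_map_le.trans (hP i ▸ Polynomial.natDegree_map_le)
  have hdegq : (∏ x ∈ s i,
      (Polynomial.X - Polynomial.C (Polynomial.C (y i x)))).natDegree = N := by
    rw [Polynomial.natDegree_prod_of_monic _ _ fun x _ => Polynomial.monic_X_sub_C _]
    simp [hs i]
  rw [← Polynomial.coe_mapRingHom, ← Polynomial.resultant_map_map, e1, e2, ← hdegq,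
    Polynomial.resultant_prod_left _ _ _ _ (by simp) hdeg]
  refine Finset.prod_congr rfl fun x _ => ?_
  rw [Polynomial.natDegree_X_sub_C, Polynomial.resultant_X_sub_C_left _ _ _ hdeg,
    Polynomial.eval_comp, Polynomial.eval_map, Polynomial.comp]
  simp [add_comm]

lemma PolyIn.congr (hp : PolyIn A p) (h : ∀ i, p i = q i) : PolyIn A q := by
  rwa [← funext h]

end PolyIn

/-! ### Homogeneity -/

/-- The scaling homomorphism, multiplying each variable by a new variable. -/
def scal {n : ℕ} : SZ n →+* Polynomial (SZ n) :=
  (aeval (R := ℤ) fun o => Polynomial.C (X o) * Polynomial.X : SZ n →ₐ[ℤ] Polynomial (SZ n))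

/-- Homogeneous elements, expressed through the scaling homomorphism. -/
def IsHom {n : ℕ} (D : ℕ) (x : SZ n) : Prop := scal x = Polynomial.C x * Polynomial.X ^ D

lemma isHom_zero {n : ℕ} (D : ℕ) : IsHom D (0 : SZ n) := by simp [IsHom]

lemma isHom_one {n : ℕ} : IsHom 0 (1 : SZ n) := by simp [IsHom]

lemma isHom_intCast {n : ℕ} (k : ℤ) : IsHom 0 (C k : SZ n) := by
  simp [IsHom, scal]

lemma isHom_X {n : ℕ} (o : Option (Fin n)) : IsHom 1 (X o : SZ n) := by
  simp [IsHom, scal]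

lemma IsHom.mul {n D E : ℕ} {x y : SZ n} (hx : IsHom D x) (hy : IsHom E y) :
    IsHom (D + E) (x * y) := by
  unfold IsHom at *
  rw [map_mul, hx, hy, Polynomial.C_mul, pow_add]
  ring

lemma IsHom.add {n D : ℕ} {x y : SZ n} (hx : IsHom D x) (hy : IsHom D y) : IsHom D (x + y) := by
  unfold IsHom at *
  rw [map_add, hx, hy, Polynomial.C_add, add_mul]

lemma IsHom.sub {n D : ℕ} {x y : SZ n} (hx : IsHom D x) (hy : IsHom D y) : IsHom D (x - y) := by
  unfold IsHom at *
  rw [map_sub, hx, hy, Polynomial.C_sub, sub_mul]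

lemma isHom_sum {n D : ℕ} {κ : Type*} (s : Finset κ) {x : κ → SZ n}
    (h : ∀ k ∈ s, IsHom D (x k)) : IsHom D (∑ k ∈ s, x k) := by
  unfold IsHom at *
  rw [map_sum, map_sum, Finset.sum_mul]
  exact Finset.sum_congr rfl h

lemma isHom_prod {n : ℕ} {κ : Type*} (s : Finset κ) {D : κ → ℕ} {x : κ → SZ n}
    (h : ∀ k ∈ s, IsHom (D k) (x k)) : IsHom (∑ k ∈ s, D k) (∏ k ∈ s, x k) := by
  unfold IsHom at *
  rw [map_prod, map_prod, ← Finset.prod_pow_eq_pow_sum, ← Finset.prod_mul_distrib]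
  exact Finset.prod_congr rfl h

lemma isHom_mul_fZ {n : ℕ} (k : ℤ) : IsHom 1 (C k * fZ : SZ n) := by
  have h := (isHom_intCast (n := n) k).mul (isHom_X none)
  rwa [zero_add] at h

lemma isHom_lin {n : ℕ} (i j : Fin n) (k : ℤ) : IsHom 1 (lin i j k) :=
  ((isHom_X _).sub (isHom_X _)).add (isHom_mul_fZ k)

/-- Polynomials in `U`, homogeneous of total degree `D`. -/
def IsHomPoly {n : ℕ} (D : ℕ) (p : Polynomial (SZ n)) : Prop :=
  (∀ k l, k + l = D → IsHom l (p.coeff k)) ∧ p.natDegree ≤ D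

lemma isHomPoly_one {n : ℕ} : IsHomPoly 0 (1 : Polynomial (SZ n)) := by
  refine ⟨fun k l h => ?_, by simp⟩
  obtain ⟨rfl, rfl⟩ : k = 0 ∧ l = 0 := by omega
  simpa using isHom_one

lemma IsHomPoly.mul {n D E : ℕ} {p q : Polynomial (SZ n)} (hp : IsHomPoly D p)
    (hq : IsHomPoly E q) : IsHomPoly (D + E) (p * q) := by
  refine ⟨fun k l hkl => ?_, Polynomial.natDegree_mul_le_of_le hp.2 hq.2⟩
  rw [Polynomial.coeff_mul]
  refine isHom_sum _ fun x hx => ?_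
  rw [Finset.HasAntidiagonal.mem_antidiagonal] at hx
  by_cases h1 : x.1 ≤ D
  · by_cases h2 : x.2 ≤ E
    · have := (hp.1 x.1 (D - x.1) (by omega)).mul (hq.1 x.2 (E - x.2) (by omega))
      rwa [show D - x.1 + (E - x.2) = l by omega] at this
    · rw [Polynomial.coeff_eq_zero_of_natDegree_lt (hq.2.trans_lt (not_le.1 h2)), mul_zero]
      exact isHom_zero l
  · rw [Polynomial.coeff_eq_zero_of_natDegree_lt (hp.2.trans_lt (not_le.1 h1)), zero_mul]
    exact isHom_zero l

lemma isHomPoly_prod {n : ℕ} {κ : Type*} (s : Finset κ) {D : κ → ℕ} {p : κ → Polynomial (SZ n)}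
    (h : ∀ k ∈ s, IsHomPoly (D k) (p k)) : IsHomPoly (∑ k ∈ s, D k) (∏ k ∈ s, p k) := by
  classical
  induction s using Finset.induction_on with
  | empty => simpa using isHomPoly_one
  | insert k s hk ih =>
    rw [Finset.sum_insert hk, Finset.prod_insert hk]
    exact (h k (Finset.mem_insert_self k s)).mul
      (ih fun l hl => h l (Finset.mem_insert_of_mem hl))

lemma isHomPoly_linFactor {n : ℕ} (i : Fin n) (k : ℤ) : IsHomPoly 1 (linFactor i k) := by
  refine ⟨fun m l h => ?_, (Polynomial.natDegree_X_sub_C_le _)⟩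
  have h2 : IsHom 1 (eZ i + C k * fZ) :=
    (isHom_X _).add (isHom_mul_fZ k)
  obtain ⟨rfl, rfl⟩ | ⟨rfl, rfl⟩ : (m = 0 ∧ l = 1) ∨ (m = 1 ∧ l = 0) := by omega
  · simpa [linFactor] using (isHom_zero 1).sub h2
  · have h1 : (linFactor i k).coeff 1 = 1 := by
      rw [linFactor, Polynomial.coeff_sub, Polynomial.coeff_X_one, Polynomial.coeff_C_succ,
        sub_zero]
    rw [h1]
    exact isHom_one

/-- The roots of `ivPoly`. -/
def ivRoots {n : ℕ} (κ : ℕ) (c : ℤ) (t : Triple n) : Finset (Σ _ : Fin n, ℤ) :=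
  (Finset.univ.filter fun i => t.1 i = true).sigma fun i => Ico (c - t.2.2 i) (c + t.2.1 i + κ)

lemma ivPoly_eq_prod {n : ℕ} (κ : ℕ) (c : ℤ) (t : Triple n) :
    ivPoly κ c t = ∏ x ∈ ivRoots κ c t, linFactor x.1 x.2 := by
  rw [ivRoots, Finset.prod_sigma, Finset.prod_filter]
  rfl

lemma card_ivRoots {n r d : ℕ} (κ : ℕ) (c : ℤ) {t : Triple n} (ht : inF n r d t) :
    (ivRoots κ c t).card = d + κ * (n - r) := by
  rw [ivRoots, Finset.card_sigma]
  have h1 : ∀ i, (Ico (c - t.2.2 i) (c + t.2.1 i + κ)).card = t.2.1 i + t.2.2 i + κ := by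
    intro i
    rw [Int.card_Ico]
    omega
  simp_rw [h1]
  rw [Finset.sum_add_distrib, Finset.sum_const, ht.1, smul_eq_mul, mul_comm κ, Finset.sum_filter]
  congr 1
  rw [← ht.2.1]
  refine Finset.sum_congr rfl fun i _ => ?_
  split_ifs with h
  · rfl
  · have := ht.2.2 i (by simpa using h)
    omega

lemma monic_ivPoly {n : ℕ} (κ : ℕ) (c : ℤ) (t : Triple n) : (ivPoly κ c t).Monic := by
  rw [ivPoly_eq_prod]
  exact Polynomial.monic_prod_of_monic _ _ fun x _ => Polynomial.monic_X_sub_C _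

lemma natDegree_ivPoly {n r d : ℕ} (κ : ℕ) (c : ℤ) {t : Triple n} (ht : inF n r d t) :
    (ivPoly κ c t).natDegree = d + κ * (n - r) := by
  rw [ivPoly_eq_prod, Polynomial.natDegree_prod_of_monic _ _ fun x _ => Polynomial.monic_X_sub_C _,
    ← card_ivRoots κ c ht, Finset.card_eq_sum_ones]
  exact Finset.sum_congr rfl fun x _ => Polynomial.natDegree_X_sub_C _

lemma isHomPoly_ivPoly {n r d : ℕ} (κ : ℕ) (c : ℤ) {t : Triple n} (ht : inF n r d t) :
    IsHomPoly (d + κ * (n - r)) (ivPoly κ c t) := by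
  rw [ivPoly_eq_prod, ← card_ivRoots κ c ht, Finset.card_eq_sum_ones]
  exact isHomPoly_prod _ fun x _ => isHomPoly_linFactor _ _

/-! ### The class of the diagonal -/

/-- The linear factor `T + e_j - e_i + k f`. -/
def dFactor {n : ℕ} (i j : Fin n) (k : ℤ) : Polynomial (SZ n) :=
  Polynomial.X + Polynomial.C (lin i j k)

/-- The contribution of the pair `(i, j)` to the class of the diagonal at `(s, t)`. -/
def zBlock {n : ℕ} {R : Type*} [CommMonoid R] (g : ℤ → R) (s t : Triple n) (i j : Fin n) : R :=
  if s.1 i = true then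
    if t.1 j = true then
      (∏ k ∈ Ico (-(s.2.1 i : ℤ)) (t.2.1 j - s.2.1 i), g k) *
        ∏ k ∈ Ico ((s.2.2 i : ℤ) - t.2.2 j + 1) (s.2.2 i + 1), g k
    else ∏ k ∈ Ico (-(s.2.1 i : ℤ)) (s.2.2 i + 1), g k
  else 1

/-- The restriction to the fixed point `(s, t)` of the class of the diagonal, twisted by `T`. -/
def zPoly {n : ℕ} (s t : Triple n) : Polynomial (SZ n) := ∏ i, ∏ j, zBlock (dFactor i j) s t i j

/-- The restriction to the fixed point `(s, t)` of the class of the diagonal. -/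
def zVal {n : ℕ} (s t : Triple n) : SZ n := ∏ i, ∏ j, zBlock (lin i j) s t i j

lemma map_zBlock {n : ℕ} {R R' : Type*} [CommMonoid R] [CommMonoid R'] (φ : R →* R') (g : ℤ → R)
    (s t : Triple n) (i j : Fin n) : φ (zBlock g s t i j) = zBlock (φ ∘ g) s t i j := by
  unfold zBlock
  split_ifs <;> simp [map_prod]

lemma zBlock_dFactor_eval_zero {n : ℕ} (s t : Triple n) (i j : Fin n) :
    (zBlock (dFactor i j) s t i j).eval 0 = zBlock (lin i j) s t i j := by
  have h := map_zBlock ((Polynomial.evalRingHom (0 : SZ n)) : _ →* SZ n) (dFactor i j) s t i j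
  rw [MonoidHom.coe_coe, Polynomial.coe_evalRingHom] at h
  rw [h]
  refine congrArg (zBlock · s t i j) ?_
  funext k
  simp [dFactor]

lemma zPoly_eval_zero {n : ℕ} (s t : Triple n) : (zPoly s t).eval 0 = zVal s t := by
  simp only [zPoly, zVal, Polynomial.eval_prod, zBlock_dFactor_eval_zero]

lemma zBlock_induction {n : ℕ} {R : Type*} [CommMonoid R] {g : ℤ → R} {D : ℕ → R → Prop}
    (h1 : D 0 1) (hmul : ∀ k l x y, D k x → D l y → D (k + l) (x * y)) (hg : ∀ k, D 1 (g k))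
    (s t : Triple n) (i j : Fin n) :
    D (if s.1 i = true then if t.1 j = true then t.2.1 j + t.2.2 j
      else s.2.1 i + s.2.2 i + 1 else 0) (zBlock g s t i j) := by
  have hprod : ∀ (x : ℤ) (N : ℕ), D N (∏ k ∈ Ico x (x + N), g k) := by
    intro x N
    rw [prod_Ico_int_eq_prod_range]
    induction N with
    | zero => simpa using h1
    | succ N ih =>
      rw [Finset.prod_range_succ]
      exact hmul _ _ _ _ ih (hg _)
  unfold zBlock
  split_ifs
  · convert hmul _ _ _ _ (hprod (-(s.2.1 i : ℤ)) (t.2.1 j))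
      (hprod ((s.2.2 i : ℤ) - t.2.2 j + 1) (t.2.2 j)) using 3 <;> congr 1 <;> omega
  · convert hprod (-(s.2.1 i : ℤ)) (s.2.1 i + s.2.2 i + 1) using 2
    congr 1
    push_cast
    omega
  · exact h1

/-- The degree of the class of the diagonal. -/
def zDeg (n r d : ℕ) : ℕ := (n - (n - r)) * (d + (n - r)) + (n - r) * d

lemma sum_zBlock_degree {n r d : ℕ} {s t : Triple n} (hs : inF n r d s) (ht : inF n r d t) :
    ∑ i, ∑ j, (if s.1 i = true then if t.1 j = true then t.2.1 j + t.2.2 j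
      else s.2.1 i + s.2.2 i + 1 else 0) = zDeg n r d := by
  have hsum : ∀ {t : Triple n}, inF n r d t →
      ∑ i ∈ Finset.univ.filter (fun i => t.1 i = true), (t.2.1 i + t.2.2 i) = d := by
    intro t ht
    rw [Finset.sum_filter]
    conv_rhs => rw [← ht.2.1]
    refine Finset.sum_congr rfl fun i _ => ?_
    split_ifs with h
    · rfl
    · have := ht.2.2 i (by simpa using h)
      omega
  have hcompl : (Finset.univ.filter fun j => ¬ t.1 j = true).card = n - (n - r) := by
    have h := Finset.card_filter_add_card_filter_not (s := (Finset.univ : Finset (Fin n)))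
      (fun j => t.1 j = true)
    rw [ht.1, Finset.card_univ, Fintype.card_fin] at h
    omega
  have h1 : ∀ i, ∑ j, (if s.1 i = true then if t.1 j = true then t.2.1 j + t.2.2 j
      else s.2.1 i + s.2.2 i + 1 else 0) = if s.1 i = true then
        d + (n - (n - r)) * (s.2.1 i + s.2.2 i + 1) else 0 := by
    intro i
    split_ifs with h
    · rw [Finset.sum_ite, hsum ht, Finset.sum_const, hcompl, smul_eq_mul]
    · simp
  simp_rw [h1]
  rw [← Finset.sum_filter, Finset.sum_add_distrib, Finset.sum_const, hs.1, ← Finset.mul_sum,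
    Finset.sum_add_distrib, hsum hs, Finset.sum_const, hs.1, zDeg]
  simp only [smul_eq_mul, mul_one]
  ring

lemma isHom_zVal {n r d : ℕ} {s t : Triple n} (hs : inF n r d s) (ht : inF n r d t) :
    IsHom (zDeg n r d) (zVal s t) := by
  rw [← sum_zBlock_degree hs ht]
  exact isHom_prod _ fun i _ => isHom_prod _ fun j _ =>
    zBlock_induction (D := IsHom) isHom_one (fun _ _ _ _ => IsHom.mul) (isHom_lin i j) s t i j

lemma natDegree_zPoly {n r d : ℕ} {s t : Triple n} (hs : inF n r d s) (ht : inF n r d t) :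
    (zPoly s t).Monic ∧ (zPoly s t).natDegree = zDeg n r d := by
  have h : ∀ i j, (zBlock (dFactor i j) s t i j).Monic ∧ (zBlock (dFactor i j) s t i j).natDegree =
      (if s.1 i = true then if t.1 j = true then t.2.1 j + t.2.2 j
        else s.2.1 i + s.2.2 i + 1 else 0) := by
    intro i j
    refine zBlock_induction (D := fun k (p : Polynomial (SZ n)) => p.Monic ∧ p.natDegree = k)
      (by simp) ?_ ?_ s t i j
    · rintro k l x y ⟨hx, rfl⟩ ⟨hy, rfl⟩
      exact ⟨hx.mul hy, hx.natDegree_mul hy⟩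
    · intro k
      exact ⟨Polynomial.monic_X_add_C _, Polynomial.natDegree_X_add_C _⟩
  have h2 : ∀ i, (∏ j, zBlock (dFactor i j) s t i j).Monic := fun i =>
    Polynomial.monic_prod_of_monic _ _ fun j _ => (h i j).1
  refine ⟨Polynomial.monic_prod_of_monic _ _ fun i _ => h2 i, ?_⟩
  rw [zPoly, Polynomial.natDegree_prod_of_monic _ _ fun i _ => h2 i, ← sum_zBlock_degree hs ht]
  refine Finset.sum_congr rfl fun i _ => ?_
  rw [Polynomial.natDegree_prod_of_monic _ _ fun j _ => (h i j).1]
  exact Finset.sum_congr rfl fun j _ => (h i j).2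

lemma zVal_eq_zero {n r d : ℕ} {s t : Triple n} (hs : inF n r d s) (ht : inF n r d t)
    (hst : s ≠ t) : zVal s t = 0 := by
  obtain ⟨i, hi, hi2⟩ : ∃ i, s.1 i = true ∧ (t.1 i = true →
      s.2.1 i < t.2.1 i ∨ s.2.2 i < t.2.2 i) := by
    by_contra! hcon
    apply hst
    have hsub : (Finset.univ.filter fun i => s.1 i = true) ⊆
        Finset.univ.filter fun i => t.1 i = true := fun i hi => by
      simp only [Finset.mem_filter, Finset.mem_univ, true_and] at hi ⊢
      exact (hcon i hi).1
    have hδ : s.1 = t.1 := by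
      have := Finset.eq_of_subset_of_card_le hsub (by rw [hs.1, ht.1])
      funext i
      have h2 := Finset.ext_iff.1 this i
      simp only [Finset.mem_filter, Finset.mem_univ, true_and] at h2
      exact Bool.eq_iff_iff.2 h2
    have hle : ∀ i, t.2.1 i ≤ s.2.1 i ∧ t.2.2 i ≤ s.2.2 i := by
      intro i
      cases h : s.1 i
      · have := ht.2.2 i (hδ ▸ h)
        omega
      · exact (hcon i h).2
    have heq : ∀ i, t.2.1 i + t.2.2 i = s.2.1 i + s.2.2 i := by
      have h2 := (Finset.sum_eq_sum_iff_of_le (s := Finset.univ)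
        (f := fun i => t.2.1 i + t.2.2 i) (g := fun i => s.2.1 i + s.2.2 i)
        fun i _ => add_le_add (hle i).1 (hle i).2).1 (ht.2.1.trans hs.2.1.symm)
      exact fun i => h2 i (Finset.mem_univ i)
    refine Prod.ext hδ (Prod.ext ?_ ?_) <;> funext i <;> have := heq i <;> have := hle i <;> omega
  refine Finset.prod_eq_zero (Finset.mem_univ i) (Finset.prod_eq_zero (Finset.mem_univ i) ?_)
  have hlin : lin i i 0 = 0 := by simp [lin]
  unfold zBlock
  rw [if_pos hi]
  split_ifs with h
  · rcases hi2 h with h2 | h2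
    · rw [Finset.prod_eq_zero (i := 0) (by simp only [Finset.mem_Ico]; omega) hlin, zero_mul]
    · rw [mul_comm, Finset.prod_eq_zero (i := 0) (by simp only [Finset.mem_Ico]; omega) hlin,
        zero_mul]
  · exact Finset.prod_eq_zero (i := 0) (by simp only [Finset.mem_Ico]; omega) hlin

lemma zVal_self_ne_zero {n : ℕ} (t : Triple n) : zVal t t ≠ 0 := by
  refine Finset.prod_ne_zero_iff.2 fun i _ => Finset.prod_ne_zero_iff.2 fun j _ => ?_
  have key : ∀ k, (i ≠ j ∨ k ≠ 0) → lin i j k ≠ 0 := fun k => lin_ne_zero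
  unfold zBlock
  split_ifs with h1 h2
  · refine mul_ne_zero ?_ ?_ <;> refine Finset.prod_ne_zero_iff.2 fun k hk => key k ?_ <;>
      rw [Finset.mem_Ico] at hk <;> by_cases hij : i = j
    · subst hij; right; omega
    · exact Or.inl hij
    · subst hij; right; omega
    · exact Or.inl hij
  · refine Finset.prod_ne_zero_iff.2 fun k hk => key k (Or.inl ?_)
    rintro rfl
    exact h2 h1
  · exact one_ne_zero

/-! ### The class of the diagonal as a quotient of resultants -/

/-- The product of `T + y - x` over the roots `x` of `ivPoly κ c s` and `y` of `ivPoly κ' c' t`. -/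
def resPoly {n : ℕ} (κ : ℕ) (c : ℤ) (κ' : ℕ) (c' : ℤ) (s t : Triple n) : Polynomial (SZ n) :=
  ∏ x ∈ ivRoots κ' c' t, (ivPoly κ c s).comp
    (Polynomial.X + Polynomial.C (eZ x.1 + C x.2 * fZ))

/-- The product of the `g (m - k)` over `c - b_i ≤ k < c + a_i + κ`. -/
def ivBlock {n : ℕ} {R : Type*} [CommMonoid R] (g : ℤ → R) (κ : ℕ) (c : ℤ) (s : Triple n)
    (i : Fin n) (m : ℤ) : R :=
  ∏ k ∈ Ico (c - s.2.2 i) (c + s.2.1 i + κ), g (m - k)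

lemma ivPoly_comp {n : ℕ} (κ : ℕ) (c : ℤ) (s : Triple n) (j : Fin n) (m : ℤ) :
    (ivPoly κ c s).comp (Polynomial.X + Polynomial.C (eZ j + C m * fZ)) =
      ∏ i, if s.1 i = true then ivBlock (dFactor i j) κ c s i m else 1 := by
  rw [ivPoly, boxPoly, Polynomial.prod_comp]
  refine Finset.prod_congr rfl fun i _ => ?_
  split_ifs
  · rw [Polynomial.prod_comp]
    refine Finset.prod_congr rfl fun k _ => ?_
    simp [linFactor, dFactor, lin]
    ring
  · simp

lemma resPoly_eq_prod {n : ℕ} (κ : ℕ) (c : ℤ) (κ' : ℕ) (c' : ℤ) (s t : Triple n) :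
    resPoly κ c κ' c' s t = ∏ i, ∏ j, if s.1 i = true then if t.1 j = true then
      ∏ m ∈ Ico (c' - t.2.2 j) (c' + t.2.1 j + κ'), ivBlock (dFactor i j) κ c s i m else 1
        else 1 := by
  rw [resPoly, ivRoots, Finset.prod_sigma, Finset.prod_filter, Finset.prod_comm]
  refine Finset.prod_congr rfl fun j _ => ?_
  by_cases hj : t.1 j = true
  · simp_rw [hj, if_true, ivPoly_comp]
    rw [Finset.prod_comm]
    refine Finset.prod_congr rfl fun i _ => ?_
    split_ifs <;> simp
  · simp [hj]

lemma ivBlock_eq {n : ℕ} {R : Type*} [CommMonoid R] (g : ℤ → R) (κ : ℕ) (c : ℤ) (s : Triple n)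
    (i : Fin n) (m : ℤ) : ivBlock g κ c s i m =
      ∏ k ∈ Ico (m - c - s.2.1 i - κ + 1) (m - c + s.2.2 i + 1), g k := by
  refine Finset.prod_bij' (fun k _ => m - k) (fun k _ => m - k) ?_ ?_ ?_ ?_ ?_
  · intro k hk; rw [Finset.mem_Ico] at *; omega
  · intro k hk; rw [Finset.mem_Ico] at *; omega
  · intro k _; omega
  · intro k _; omega
  · intro k _; rfl

lemma prod_Ico_self_add_one {R : Type*} [CommMonoid R] (h : ℤ → R) (x : ℤ) :
    ∏ k ∈ Ico x (x + 1), h k = h x := by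
  have hx : Ico x (x + 1) = {x} := by
    ext k
    rw [Finset.mem_Ico, Finset.mem_singleton]
    omega
  rw [hx, Finset.prod_singleton]

lemma prod_Ico_add_one {R : Type*} [CommMonoid R] (h : ℤ → R) {x y : ℤ} (hxy : x ≤ y) :
    ∏ k ∈ Ico x (y + 1), h k = (∏ k ∈ Ico x y, h k) * h y := by
  rw [← prod_Ico_mul_prod_Ico h hxy (by omega : y ≤ y + 1), prod_Ico_self_add_one]

lemma prod_Ico_eq_mul {R : Type*} [CommMonoid R] (h : ℤ → R) {x y : ℤ} (hxy : x < y) :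
    ∏ k ∈ Ico x y, h k = h x * ∏ k ∈ Ico (x + 1) y, h k := by
  rw [← prod_Ico_mul_prod_Ico h (by omega : x ≤ x + 1) (by omega : x + 1 ≤ y),
    prod_Ico_self_add_one]

lemma zBlock_mul_aux {R : Type*} [CommMonoid R] (g Y Y' : ℤ → R) (a b : ℤ) (a' b' : ℕ)
    (h1 : ∀ m, Y m = Y' m * g (m + b)) (h2 : ∀ m, Y m = Y' (m + 1) * g (m - a)) :
    ((∏ k ∈ Ico (-a) (a' - a), g k) * ∏ k ∈ Ico (b - b' + 1) (b + 1), g k) *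
      ((∏ m ∈ Ico (-b' : ℤ) (a' + 1), Y m) * ∏ m ∈ Ico (1 - b' : ℤ) (1 + a'), Y' m) =
    Y 0 * ((∏ m ∈ Ico (1 - b' : ℤ) (1 + a'), Y m) * ∏ m ∈ Ico (-b' : ℤ) a', Y m) := by
  have e1 : ∏ m ∈ Ico (-b' : ℤ) (a' + 1), Y m =
      Y (-b') * ∏ m ∈ Ico (1 - b' : ℤ) (1 + a'), Y m := by
    rw [prod_Ico_eq_mul _ (by omega), add_comm (-(b' : ℤ)) 1, add_comm (a' : ℤ) 1, ← sub_eq_add_neg]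
  have e2 : ∏ m ∈ Ico (0 : ℤ) a', Y m =
      (∏ m ∈ Ico (1 : ℤ) (1 + a'), Y' m) * ∏ k ∈ Ico (-a) (a' - a), g k := by
    simp_rw [h2]
    rw [Finset.prod_mul_distrib, prod_Ico_shift Y']
    simp_rw [sub_eq_add_neg]
    rw [prod_Ico_shift g, zero_add, zero_add, add_comm (a' : ℤ) 1]
  have e3 : ∏ m ∈ Ico (-b' : ℤ) 0, Y m =
      (∏ m ∈ Ico (-b' : ℤ) 0, Y' m) * ∏ k ∈ Ico (b - b') b, g k := by
    simp_rw [h1]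
    rw [Finset.prod_mul_distrib, prod_Ico_shift g, zero_add, neg_add_eq_sub]
  have e4 : ∏ m ∈ Ico (1 - b' : ℤ) (1 + a'), Y' m =
      (∏ m ∈ Ico (1 - b' : ℤ) 1, Y' m) * ∏ m ∈ Ico (1 : ℤ) (1 + a'), Y' m :=
    (prod_Ico_mul_prod_Ico _ (by omega) (by omega)).symm
  have e5 : (∏ m ∈ Ico (-b' : ℤ) 0, Y' m) * Y' 0 = Y' (-b') * ∏ m ∈ Ico (1 - b' : ℤ) 1, Y' m := by
    rw [← prod_Ico_add_one _ (by omega), prod_Ico_eq_mul _ (by omega), zero_add,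
      add_comm (-(b' : ℤ)) 1, ← sub_eq_add_neg]
  have e6 : (∏ k ∈ Ico (b - b') b, g k) * g b =
      g (b - b') * ∏ k ∈ Ico (b - b' + 1) (b + 1), g k := by
    rw [← prod_Ico_add_one _ (by omega), prod_Ico_eq_mul _ (by omega)]
  have e7 : ∏ m ∈ Ico (-b' : ℤ) a', Y m =
      (∏ m ∈ Ico (-b' : ℤ) 0, Y m) * ∏ m ∈ Ico (0 : ℤ) a', Y m :=
    (prod_Ico_mul_prod_Ico _ (by omega) (by omega)).symm
  rw [e7, e1, e2, e3, e4, h1 0, h1 (-b'), zero_add, neg_add_eq_sub]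
  calc _ = (Y' (-b') * ∏ m ∈ Ico (1 - b' : ℤ) 1, Y' m) *
        (g (b - b') * ∏ k ∈ Ico (b - b' + 1) (b + 1), g k) *
        ((∏ k ∈ Ico (-a) (a' - a), g k) * (∏ m ∈ Ico (1 - b' : ℤ) (1 + a'), Y m) *
          ∏ m ∈ Ico (1 : ℤ) (1 + a'), Y' m) := by ac_rfl
    _ = _ := by
        rw [← e5, ← e6]
        ac_rfl

lemma ivBlock_one_zero_eq {n : ℕ} {R : Type*} [CommMonoid R] (g : ℤ → R) (s : Triple n)
    (i : Fin n) (m : ℤ) : ivBlock g 1 0 s i m = ivBlock g 0 1 s i m * g (m + s.2.2 i) ∧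
      ivBlock g 1 0 s i m = ivBlock g 0 1 s i (m + 1) * g (m - s.2.1 i) := by
  simp only [ivBlock_eq, Nat.cast_zero, Nat.cast_one, sub_zero, add_sub_cancel_right,
    sub_add_cancel]
  constructor
  · rw [show m - 1 - s.2.1 i + 1 = m - s.2.1 i by omega, show m - 1 + s.2.2 i + 1 = m + s.2.2 i
      by omega, prod_Ico_add_one g (by omega)]
  · rw [prod_Ico_eq_mul g (by omega), mul_comm]

lemma zBlock_mul_ivBlock {n : ℕ} {R : Type*} [CommMonoid R] (g : ℤ → R) (s t : Triple n)
    (i j : Fin n) (hi : s.1 i = true) (hj : t.1 j = true) :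
    zBlock g s t i j *
      ((∏ m ∈ Ico (0 - t.2.2 j : ℤ) (0 + t.2.1 j + (1 : ℕ)), ivBlock g 1 0 s i m) *
        ∏ m ∈ Ico (1 - t.2.2 j : ℤ) (1 + t.2.1 j + (0 : ℕ)), ivBlock g 0 1 s i m) =
    ivBlock g 1 0 s i 0 *
      ((∏ m ∈ Ico (1 - t.2.2 j : ℤ) (1 + t.2.1 j + (0 : ℕ)), ivBlock g 1 0 s i m) *
        ∏ m ∈ Ico (0 - t.2.2 j : ℤ) (0 + t.2.1 j + (0 : ℕ)),
          ivBlock g 1 0 s i m) := by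
  rw [zBlock, if_pos hi, if_pos hj]
  simp only [Nat.cast_zero, Nat.cast_one, zero_sub, zero_add, add_zero]
  exact zBlock_mul_aux g (ivBlock g 1 0 s i) (ivBlock g 0 1 s i) (s.2.1 i) (s.2.2 i) (t.2.1 j)
    (t.2.2 j) (fun m => (ivBlock_one_zero_eq g s i m).1) fun m => (ivBlock_one_zero_eq g s i m).2

lemma zBlock_mul_ite {n : ℕ} {R : Type*} [CommMonoid R] (g : ℤ → R) (s t : Triple n)
    (i j : Fin n) :
    zBlock g s t i j *
      ((if s.1 i = true then if t.1 j = true then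
        ∏ m ∈ Ico (0 - t.2.2 j : ℤ) (0 + t.2.1 j + (1 : ℕ)), ivBlock g 1 0 s i m else 1 else 1) *
       if s.1 i = true then if t.1 j = true then
        ∏ m ∈ Ico (1 - t.2.2 j : ℤ) (1 + t.2.1 j + (0 : ℕ)), ivBlock g 0 1 s i m else 1 else 1) =
    (if s.1 i = true then ivBlock g 1 0 s i 0 else 1) *
      ((if s.1 i = true then if t.1 j = true then
        ∏ m ∈ Ico (1 - t.2.2 j : ℤ) (1 + t.2.1 j + (0 : ℕ)), ivBlock g 1 0 s i m else 1 else 1) *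
       if s.1 i = true then if t.1 j = true then
        ∏ m ∈ Ico (0 - t.2.2 j : ℤ) (0 + t.2.1 j + (0 : ℕ)),
          ivBlock g 1 0 s i m else 1 else 1) := by
  by_cases hi : s.1 i = true
  · by_cases hj : t.1 j = true
    · simp only [hi, hj, if_true]
      exact zBlock_mul_ivBlock g s t i j hi hj
    · simp only [hi, hj, if_true, zBlock]
      rw [ivBlock_eq]
      simp
  · simp only [hi, zBlock]
    simp

lemma zPoly_mul_resPoly {n : ℕ} (s t : Triple n) :
    (resPoly 1 0 1 0 s t * resPoly 0 1 0 1 s t) * zPoly s t =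
      (∏ j, (ivPoly 1 0 s).comp (Polynomial.X + Polynomial.C (eZ j))) *
        (resPoly 1 0 0 1 s t * resPoly 1 0 0 0 s t) := by
  have h0 : ∀ j, (ivPoly 1 0 s).comp (Polynomial.X + Polynomial.C (eZ j)) =
      ∏ i, if s.1 i = true then ivBlock (dFactor i j) 1 0 s i 0 else 1 := by
    intro j
    rw [← ivPoly_comp]
    simp
  rw [Finset.prod_congr rfl fun j _ => h0 j, Finset.prod_comm, mul_comm (_ * _) (zPoly s t)]
  simp only [resPoly_eq_prod, zPoly]
  simp only [← Finset.prod_mul_distrib]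
  exact Finset.prod_congr rfl fun i _ => Finset.prod_congr rfl fun j _ =>
    zBlock_mul_ite (dFactor i j) s t i j

/-! ### The ring generated by external products -/

/-- The ring generated by the external products of homogeneous elements of the Chow ring. -/
def tensorRing (n r d : ℕ) : Subring (FixedPt n r d × FixedPt n r d → SZ n) :=
  Subring.closure {h | ∃ α ∈ chow n r d, ∃ β ∈ chow n r d, ∃ D E, (∀ t, IsHom D (α t)) ∧
    (∀ t, IsHom E (β t)) ∧ h = fun p => α p.1 * β p.2}

lemma mul_mem_tensorRing {n r d D E : ℕ} {α β : FixedPt n r d → SZ n} (hα : α ∈ chow n r d)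
    (hβ : β ∈ chow n r d) (hD : ∀ t, IsHom D (α t)) (hE : ∀ t, IsHom E (β t)) :
    (fun p : FixedPt n r d × FixedPt n r d => α p.1 * β p.2) ∈ tensorRing n r d :=
  Subring.subset_closure ⟨α, hα, β, hβ, D, E, hD, hE, rfl⟩

lemma const_mem_chow {n r d : ℕ} (x : SZ n) : (fun _ => x) ∈ chow n r d :=
  (chow n r d).algebraMap_mem x

lemma const_mem_tensorRing {n r d : ℕ} (x : SZ n) : (fun _ => x) ∈ tensorRing n r d := by
  have h1 : ∀ {D : ℕ} {y : SZ n}, IsHom D y → (fun _ => y) ∈ tensorRing n r d := by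
    intro D y hy
    have := mul_mem_tensorRing (const_mem_chow (n := n) (r := r) (d := d) y)
      (const_mem_chow 1) (fun _ => hy) (fun _ => isHom_one)
    simpa using this
  induction x using MvPolynomial.induction_on with
  | C k => exact h1 (isHom_intCast k)
  | add p q hp hq => exact add_mem hp hq
  | mul_X p o hp => exact mul_mem hp (h1 (isHom_X o))

lemma polyIn_ivPoly {n r d : ℕ} (κ : ℕ) (c : ℤ) :
    PolyIn (tensorRing n r d) (fun p => ivPoly κ c p.1.1) ∧
      PolyIn (tensorRing n r d) (fun p => ivPoly κ c p.2.1) := by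
  have hmem : ∀ k, (fun t : FixedPt n r d => (ivPoly κ c t.1).coeff k) ∈ chow n r d :=
    fun k => restrictF_mem_chow (rels_coeff_ivPoly r d κ c k)
  have hhom : ∀ k (t : FixedPt n r d),
      IsHom (d + κ * (n - r) - k) ((ivPoly κ c t.1).coeff k) := by
    intro k t
    by_cases hk : k ≤ d + κ * (n - r)
    · exact (isHomPoly_ivPoly κ c t.2).1 k _ (by omega)
    · rw [Polynomial.coeff_eq_zero_of_natDegree_lt (by rw [natDegree_ivPoly κ c t.2]; omega)]
      exact isHom_zero _
  constructor
  · refine PolyIn.of_coeff_mem (fun p => (natDegree_ivPoly κ c p.1.2).le) fun k => ?_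
    simpa using mul_mem_tensorRing (hmem k) (const_mem_chow 1) (hhom k) fun _ => isHom_one
  · refine PolyIn.of_coeff_mem (fun p => (natDegree_ivPoly κ c p.2.2).le) fun k => ?_
    simpa using mul_mem_tensorRing (const_mem_chow 1) (hmem k) (fun _ => isHom_one) (hhom k)

lemma polyIn_resPoly {n r d : ℕ} (κ : ℕ) (c : ℤ) (κ' : ℕ) (c' : ℤ) :
    PolyIn (tensorRing n r d) fun p => resPoly κ c κ' c' p.1.1 p.2.1 := by
  have hq : PolyIn (tensorRing n r d) fun p => ∏ x ∈ ivRoots κ' c' p.2.1,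
      (Polynomial.X - Polynomial.C (eZ x.1 + C x.2 * fZ)) :=
    (polyIn_ivPoly κ' c').2.congr fun p => ivPoly_eq_prod κ' c' p.2.1
  exact PolyIn.prod_comp (s := fun p : FixedPt n r d × FixedPt n r d => ivRoots κ' c' p.2.1)
    (y := fun _ x => eZ x.1 + C x.2 * fZ) (polyIn_ivPoly κ c).1
    (fun p => card_ivRoots κ' c' p.2.2) hq

lemma monic_resPoly {n : ℕ} (κ : ℕ) (c : ℤ) (κ' : ℕ) (c' : ℤ) (s t : Triple n) :
    (resPoly κ c κ' c' s t).Monic :=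
  Polynomial.monic_prod_of_monic _ _ fun _ _ => (monic_ivPoly κ c s).comp_X_add_C _

lemma natDegree_resPoly {n r d : ℕ} (κ : ℕ) (c : ℤ) (κ' : ℕ) (c' : ℤ) {s t : Triple n}
    (hs : inF n r d s) (ht : inF n r d t) : (resPoly κ c κ' c' s t).natDegree =
      (d + κ' * (n - r)) * (d + κ * (n - r)) := by
  rw [resPoly, Polynomial.natDegree_prod_of_monic _ _
    fun _ _ => (monic_ivPoly κ c s).comp_X_add_C _]
  rw [Finset.sum_congr rfl fun x _ => by
    rw [Polynomial.natDegree_comp, Polynomial.natDegree_X_add_C, mul_one, natDegree_ivPoly κ c hs],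
    Finset.sum_const, card_ivRoots κ' c' ht, smul_eq_mul]

lemma polyIn_zPoly (n r d : ℕ) : PolyIn (tensorRing n r d) fun p => zPoly p.1.1 p.2.1 := by
  refine PolyIn.of_mul_eq
    (N := (d + 1 * (n - r)) * (d + 1 * (n - r)) + (d + 0 * (n - r)) * (d + 0 * (n - r)))
    ((PolyIn.prod Finset.univ fun j _ =>
      (polyIn_ivPoly 1 0).1.comp_X_add_C (const_mem_tensorRing (eZ j))).mul
        ((polyIn_resPoly 1 0 0 1).mul (polyIn_resPoly 1 0 0 0)))
    ((polyIn_resPoly 1 0 1 0).mul (polyIn_resPoly 0 1 0 1)) (fun p => ?_) (fun p => ?_)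
    (fun p => zPoly_mul_resPoly p.1.1 p.2.1)
  · exact (monic_resPoly _ _ _ _ _ _).mul (monic_resPoly _ _ _ _ _ _)
  · rw [(monic_resPoly _ _ _ _ _ _).natDegree_mul (monic_resPoly _ _ _ _ _ _),
      natDegree_resPoly _ _ _ _ p.1.2 p.2.2, natDegree_resPoly _ _ _ _ p.1.2 p.2.2]

lemma zVal_mem_tensorRing (n r d : ℕ) :
    (fun p : FixedPt n r d × FixedPt n r d => zVal p.1.1 p.2.1) ∈ tensorRing n r d := by
  convert (polyIn_zPoly n r d).coeff_mem 0 using 1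
  funext p
  rw [Polynomial.coeff_zero_eq_eval_zero, zPoly_eval_zero]

lemma diagonal_mem_chow {n r d : ℕ} {h : FixedPt n r d × FixedPt n r d → SZ n}
    (hh : h ∈ tensorRing n r d) : (fun t => h (t, t)) ∈ chow n r d := by
  induction hh using Subring.closure_induction with
  | mem x hx =>
    obtain ⟨α, hα, β, hβ, _, _, _, _, rfl⟩ := hx
    exact mul_mem hα hβ
  | zero => exact zero_mem _
  | one => exact one_mem _
  | add x y _ _ hx hy => exact add_mem hx hy
  | neg x _ hx => exact neg_mem hx
  | mul x y _ _ hx hy => exact mul_mem hx hy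

lemma coeff_zPoly_mem_chow (n r d k : ℕ) :
    (fun t : FixedPt n r d => (zPoly t.1 t.1).coeff k) ∈ chow n r d :=
  diagonal_mem_chow ((polyIn_zPoly n r d).coeff_mem k)

/-! ### Integrality at one prime at a time -/

section PrimeLoc

variable {S : Type*} [CommRing S]

/-- The localization of `S` at a prime element, inside the field of fractions. -/
def primeLoc {π : S} (hπ : Prime π) : Subring (FractionRing S) where
  carrier := {x | ∃ s y : S, ¬ π ∣ s ∧
    algebraMap S (FractionRing S) s * x = algebraMap S (FractionRing S) y}
  mul_mem' := by
    rintro x x' ⟨s, y, hs, hx⟩ ⟨s', y', hs', hx'⟩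
    refine ⟨s * s', y * y', fun h => (hπ.dvd_or_dvd h).elim hs hs', ?_⟩
    rw [map_mul, map_mul, ← hx, ← hx']
    ring
  add_mem' := by
    rintro x x' ⟨s, y, hs, hx⟩ ⟨s', y', hs', hx'⟩
    refine ⟨s * s', s' * y + s * y', fun h => (hπ.dvd_or_dvd h).elim hs hs', ?_⟩
    rw [map_mul, map_add, map_mul, map_mul, ← hx, ← hx']
    ring
  one_mem' := ⟨1, 1, hπ.not_dvd_one, by simp⟩
  zero_mem' := ⟨1, 0, hπ.not_dvd_one, by simp⟩
  neg_mem' := by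
    rintro x ⟨s, y, hs, hx⟩
    exact ⟨s, -y, hs, by rw [mul_neg, hx, map_neg]⟩

variable {π : S} (hπ : Prime π)

lemma algebraMap_mem_primeLoc (x : S) : algebraMap S (FractionRing S) x ∈ primeLoc hπ :=
  ⟨1, x, hπ.not_dvd_one, by simp⟩

variable [IsDomain S]

lemma inv_mem_primeLoc {s : S} (hs : ¬ π ∣ s) :
    (algebraMap S (FractionRing S) s)⁻¹ ∈ primeLoc hπ := by
  refine ⟨s, 1, hs, ?_⟩
  rw [map_one, mul_inv_cancel₀]
  rintro h
  rw [FaithfulSMul.algebraMap_eq_zero_iff] at h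
  exact hs (h ▸ dvd_zero π)

lemma exists_of_forall_mem_primeLoc [UniqueFactorizationMonoid S] {x : FractionRing S}
    (h : ∀ (π : S) (hπ : Prime π), x ∈ primeLoc hπ) :
    ∃ y, algebraMap S (FractionRing S) y = x := by
  obtain ⟨a, b, hab, rfl⟩ := IsFractionRing.exists_reduced_fraction S x
  have hb0 : (b : S) ≠ 0 := nonZeroDivisors.coe_ne_zero b
  by_cases hb : IsUnit (b : S)
  · obtain ⟨c, hc⟩ := hb.exists_right_inv
    refine ⟨a * c, ?_⟩
    rw [IsLocalization.eq_mk'_iff_mul_eq, ← map_mul, mul_assoc, mul_comm c, hc, mul_one]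
  · obtain ⟨π, hπ, hdvd⟩ := WfDvdMonoid.exists_irreducible_factor hb hb0
    obtain ⟨s, y, hs, hx⟩ := h π hπ.prime
    have h1 : s * a = y * b := by
      apply FaithfulSMul.algebraMap_injective S (FractionRing S)
      rw [map_mul, map_mul, ← hx, mul_assoc, IsLocalization.mk'_spec]
    have h2 : π ∣ a := (hπ.prime.dvd_or_dvd (h1 ▸ hdvd.mul_left y)).resolve_left hs
    exact (hπ.not_isUnit (hab h2 hdvd)).elim

end PrimeLoc

lemma exists_mul_eq_prod {ι S : Type*} [Fintype ι] [CommRing S] [IsDomain S]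
    (A : Subalgebra S (ι → S)) {R : ι → S} (hR : R ∈ A) :
    ∃ h ∈ A, ∀ t, R t * h t = ∏ t', R t' := by
  classical
  set p : Polynomial S := ∏ t, (Polynomial.X - Polynomial.C (R t)) with hp
  have hroot : ∀ t, p.eval (R t) = 0 := fun t => by
    rw [hp, Polynomial.eval_prod]
    exact Finset.prod_eq_zero (Finset.mem_univ t) (by simp)
  have hc : p.coeff 0 = (-1) ^ Fintype.card ι * ∏ t, R t := by
    rw [Polynomial.coeff_zero_eq_eval_zero, hp, Polynomial.eval_prod]
    simp [Finset.prod_neg]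
  refine ⟨(-1) ^ (Fintype.card ι + 1) * Polynomial.aeval R p.divX,
    mul_mem (pow_mem (neg_mem (one_mem _)) _) (Polynomial.aeval_mem_adjoin_singleton S R |> fun h =>
      Algebra.adjoin_le (by simpa using hR) h), fun t => ?_⟩
  have h1 : (Polynomial.aeval R p.divX : ι → S) t = p.divX.eval (R t) := by
    rw [← Polynomial.coe_aeval_eq_eval]
    exact (Polynomial.aeval_algHom_apply (Pi.evalAlgHom S (fun _ => S) t) R p.divX).symm
  have h2 := hroot t
  rw [← Polynomial.divX_mul_X_add p, Polynomial.eval_add, Polynomial.eval_mul, Polynomial.eval_X,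
    Polynomial.eval_C, hc] at h2
  have h3 : ((-1 : S) ^ Fintype.card ι) * (-1) ^ Fintype.card ι = 1 := by
    rw [← mul_pow]; simp
  simp only [Pi.mul_apply, Pi.pow_apply, Pi.neg_apply, Pi.one_apply, h1]
  linear_combination (-(-1 : S) ^ Fintype.card ι) * h2 + (∏ t, R t) * h3

/-! ### Integrality away from the mixed linear forms -/

/-- The fixed points on one component of the fixed locus of the torus of `GL_n`. -/
abbrev CompPt (n r d : ℕ) (δ : Fin n → Bool) (m : Fin n → ℕ) :=
  {t : FixedPt n r d // t.1.1 = δ ∧ t.1.2.1 + t.1.2.2 = m}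

/-- The functions on a component that are polynomials in the `a_i f`. -/
def compRing (n r d : ℕ) (δ : Fin n → Bool) (m : Fin n → ℕ) :
    Subalgebra (SZ n) (CompPt n r d δ m → SZ n) :=
  (AlgHom.pi fun t : CompPt n r d δ m =>
    (MvPolynomial.aeval fun i => (t.1.1.2.1 i : SZ n) * fZ :
      MvPolynomial (Fin n) (SZ n) →ₐ[SZ n] SZ n)).range

lemma mem_compRing {n r d : ℕ} {δ : Fin n → Bool} {m : Fin n → ℕ}
    {g : CompPt n r d δ m → SZ n} : g ∈ compRing n r d δ m ↔ ∃ P : MvPolynomial (Fin n) (SZ n),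
      ∀ t, g t = MvPolynomial.eval (fun i => (t.1.1.2.1 i : SZ n) * fZ) P := by
  constructor
  · rintro ⟨P, rfl⟩
    exact ⟨P, fun t => by simp⟩
  · rintro ⟨P, hP⟩
    exact ⟨P, funext fun t => by simp [hP]⟩

lemma mem_compRing_of_mem_chow {n r d : ℕ} {g : FixedPt n r d → SZ n} (hg : g ∈ chow n r d)
    (δ : Fin n → Bool) (m : Fin n → ℕ) : (fun t => g t.1) ∈ compRing n r d δ m := by
  obtain ⟨P, hP⟩ := (mem_chow.1 hg).poly δ m
  refine mem_compRing.2 ⟨P, ?_⟩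
  rintro ⟨⟨⟨_, a, b⟩, ht⟩, rfl, hm⟩
  rw [← extTuple_apply g]
  exact hP a b ht hm

/-- The off-diagonal part of the Euler class, twisted by `T`. -/
def offPoly {n : ℕ} (t : Triple n) : Polynomial (SZ n) :=
  ∏ i, ∏ j, if i = j then 1 else zBlock (dFactor i j) t t i j

/-- The off-diagonal part of the Euler class. -/
def offVal {n : ℕ} (t : Triple n) : SZ n :=
  ∏ i, ∏ j, if i = j then 1 else zBlock (lin i j) t t i j

lemma offPoly_coeff_zero {n : ℕ} (t : Triple n) : (offPoly t).coeff 0 = offVal t := by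
  rw [Polynomial.coeff_zero_eq_eval_zero, offPoly, offVal, Polynomial.eval_prod]
  refine Finset.prod_congr rfl fun i _ => ?_
  rw [Polynomial.eval_prod]
  refine Finset.prod_congr rfl fun j _ => ?_
  rw [apply_ite (Polynomial.eval 0), Polynomial.eval_one, zBlock_dFactor_eval_zero]

lemma prod_prod_eq_diag_mul {n : ℕ} {R : Type*} [CommMonoid R] (F : Fin n → Fin n → R) :
    ∏ i, ∏ j, F i j = (∏ i, F i i) * ∏ i, ∏ j, if i = j then 1 else F i j := by
  rw [← Finset.prod_mul_distrib]
  refine Finset.prod_congr rfl fun i _ => ?_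
  rw [← Finset.mul_prod_erase _ _ (Finset.mem_univ i),
    ← Finset.mul_prod_erase _ (fun j => if i = j then 1 else F i j) (Finset.mem_univ i),
    if_pos rfl, one_mul]
  refine congrArg _ (Finset.prod_congr rfl fun j hj => ?_)
  rw [if_neg (Finset.ne_of_mem_erase hj).symm]

/-- The polynomial `∏ (T + (l - a_i) f)` over `δ_i = 1` and `0 ≤ l ≤ m_i`. -/
def diagPoly {n : ℕ} (δ : Fin n → Bool) (m a : Fin n → ℕ) : Polynomial (SZ n) :=
  ∏ i ∈ Finset.univ.filter (fun i => δ i = true), ∏ l ∈ Finset.range (m i + 1),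
    (Polynomial.X + Polynomial.C (C ((l : ℤ) - a i) * fZ))

lemma X_mul_zBlock_diag {n : ℕ} (t : Triple n) (i : Fin n) (hi : t.1 i = true) :
    Polynomial.X * zBlock (dFactor i i) t t i i =
      ∏ l ∈ Finset.range (t.2.1 i + t.2.2 i + 1),
        (Polynomial.X + Polynomial.C (C ((l : ℤ) - t.2.1 i) * fZ)) := by
  have h0 : dFactor i i 0 = Polynomial.X := by simp [dFactor, lin]
  have h1 : ∀ l : ℕ, Polynomial.X + Polynomial.C (C ((l : ℤ) - t.2.1 i) * fZ) =
      dFactor i i (-(t.2.1 i : ℤ) + l) := fun l => by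
    rw [dFactor, lin, sub_self, zero_add, neg_add_eq_sub]
  have h2 : ∏ k ∈ Ico (-(t.2.1 i : ℤ)) (t.2.2 i + 1), dFactor i i k =
      (∏ k ∈ Ico (-(t.2.1 i : ℤ)) 0, dFactor i i k) *
        (dFactor i i 0 * ∏ k ∈ Ico (1 : ℤ) (t.2.2 i + 1), dFactor i i k) := by
    rw [← prod_Ico_mul_prod_Ico (dFactor i i) (by omega : -(t.2.1 i : ℤ) ≤ 0) (by omega),
      prod_Ico_eq_mul (dFactor i i) (by omega : (0 : ℤ) < t.2.2 i + 1), zero_add]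
  rw [Finset.prod_congr rfl fun l _ => h1 l, ← prod_Ico_int_eq_prod_range,
    show -(t.2.1 i : ℤ) + (t.2.1 i + t.2.2 i + 1 : ℕ) = t.2.2 i + 1 by push_cast; omega, h2, h0,
    zBlock, if_pos hi, if_pos hi, sub_self, sub_self, zero_add, mul_left_comm]

lemma diagPoly_mul_offPoly {n r d : ℕ} {t : Triple n} (ht : inF n r d t) :
    diagPoly t.1 (t.2.1 + t.2.2) t.2.1 * offPoly t = Polynomial.X ^ (n - r) * zPoly t t := by
  have h : ∏ i, zBlock (dFactor i i) t t i i =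
      ∏ i ∈ Finset.univ.filter (fun i => t.1 i = true), zBlock (dFactor i i) t t i i := by
    rw [Finset.prod_filter]
    refine Finset.prod_congr rfl fun i _ => ?_
    split_ifs with hi
    · rfl
    · rw [zBlock, if_neg hi]
  rw [zPoly, prod_prod_eq_diag_mul, ← offPoly, ← mul_assoc, h, ← ht.1, ← Finset.prod_const,
    ← Finset.prod_mul_distrib, diagPoly]
  refine congrArg (· * _) (Finset.prod_congr rfl fun i hi => ?_)
  exact (X_mul_zBlock_diag t i (Finset.mem_filter.1 hi).2).symm

lemma offVal_mem_compRing (n r d : ℕ) (δ : Fin n → Bool) (m : Fin n → ℕ) :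
    (fun t => offVal t.1.1) ∈ compRing n r d δ m := by
  have hfac : ∀ (i : Fin n) (l : ℕ), PolyIn (compRing n r d δ m).toSubring fun t =>
      Polynomial.X + Polynomial.C (C ((l : ℤ) - t.1.1.2.1 i) * fZ) := by
    intro i l
    have hc : (fun t : CompPt n r d δ m => (C ((l : ℤ) - t.1.1.2.1 i) * fZ : SZ n)) ∈
        (compRing n r d δ m).toSubring :=
      mem_compRing.2 ⟨C ((l : SZ n) * fZ) - X i, fun t => by simp; ring⟩
    simpa using (PolyIn.X_pow 1).comp_X_add_C hc
  have hmonic : ∀ a : Fin n → ℕ, (diagPoly δ m a).Monic ∧ (diagPoly δ m a).natDegree =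
      ∑ i ∈ Finset.univ.filter (fun i => δ i = true), (m i + 1) := by
    intro a
    have h1 : ∀ i, (∏ l ∈ Finset.range (m i + 1),
        (Polynomial.X + Polynomial.C (C ((l : ℤ) - a i) * fZ : SZ n))).Monic := fun i =>
      Polynomial.monic_prod_of_monic _ _ fun l _ => Polynomial.monic_X_add_C _
    refine ⟨Polynomial.monic_prod_of_monic _ _ fun i _ => h1 i, ?_⟩
    rw [diagPoly, Polynomial.natDegree_prod_of_monic _ _ fun i _ => h1 i]
    refine Finset.sum_congr rfl fun i _ => ?_
    rw [Polynomial.natDegree_prod_of_monic _ _ fun l _ => Polynomial.monic_X_add_C _,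
      Finset.sum_congr rfl fun l _ => Polynomial.natDegree_X_add_C _]
    simp
  have hdiag : PolyIn (compRing n r d δ m).toSubring fun t => diagPoly δ m t.1.1.2.1 :=
    PolyIn.prod _ fun i _ => PolyIn.prod _ fun l _ => hfac i l
  have hz : PolyIn (compRing n r d δ m).toSubring fun t => zPoly t.1.1 t.1.1 :=
    PolyIn.of_coeff_mem (fun t => (natDegree_zPoly t.1.2 t.1.2).2.le) fun k =>
      mem_compRing_of_mem_chow (coeff_zPoly_mem_chow n r d k) δ m
  have hoff : PolyIn (compRing n r d δ m).toSubring fun t => offPoly t.1.1 := by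
    refine PolyIn.of_mul_eq ((PolyIn.X_pow (n - r)).mul hz) hdiag (fun t => (hmonic _).1)
      (fun t => (hmonic _).2) fun t => ?_
    rw [← diagPoly_mul_offPoly t.1.2, t.2.1, t.2.2]
  simpa only [offPoly_coeff_zero, Subalgebra.mem_toSubring] using hoff.coeff_mem 0

lemma prod_Ico_mul_fZ {n : ℕ} (a b : ℕ) :
    (∏ k ∈ Ico (-(a : ℤ)) 0, (C k * fZ : SZ n)) * ∏ k ∈ Ico (1 : ℤ) (b + 1), (C k * fZ : SZ n) =
      C ((-1) ^ a * ((a.factorial : ℤ) * b.factorial)) * fZ ^ (a + b) := by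
  have ha : ∏ k ∈ Ico (-(a : ℤ)) 0, (C k * fZ : SZ n) =
      C ((-1) ^ a * (a.factorial : ℤ)) * fZ ^ a := by
    induction a with
    | zero => simp
    | succ a ih =>
      rw [prod_Ico_eq_mul _ (by omega), show -((a + 1 : ℕ) : ℤ) + 1 = -a by push_cast; ring, ih,
        Nat.factorial_succ, pow_succ (fZ : SZ n)]
      push_cast
      simp only [map_mul, map_neg, map_add, map_pow, map_one, map_natCast]
      ring
  have hb : ∏ k ∈ Ico (1 : ℤ) (b + 1), (C k * fZ : SZ n) = C (b.factorial : ℤ) * fZ ^ b := by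
    induction b with
    | zero => simp
    | succ b ih =>
      rw [prod_Ico_add_one _ (by omega)]
      push_cast
      rw [ih, Nat.factorial_succ, pow_succ (fZ : SZ n)]
      push_cast
      simp only [map_mul, map_add, map_one, map_natCast]
      ring
  rw [ha, hb]
  simp only [map_mul]
  ring

lemma zVal_self {n r d : ℕ} {t : Triple n} (ht : inF n r d t) : zVal t t =
    C ((-1) ^ (∑ i, t.2.1 i) * ((∏ i, ((t.2.1 i).factorial : ℤ)) *
      ∏ i, ((t.2.2 i).factorial : ℤ))) * fZ ^ (∑ i, (t.2.1 i + t.2.2 i)) * offVal t := by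
  rw [zVal, prod_prod_eq_diag_mul, ← offVal]
  have h : ∀ i, zBlock (lin i i) t t i i =
      C ((-1) ^ t.2.1 i * (((t.2.1 i).factorial : ℤ) * (t.2.2 i).factorial)) *
        fZ ^ (t.2.1 i + t.2.2 i) := by
    intro i
    by_cases hi : t.1 i = true
    · rw [← prod_Ico_mul_fZ, zBlock, if_pos hi, if_pos hi]
      simp [lin]
    · have := ht.2.2 i (by simpa using hi)
      rw [zBlock, if_neg hi, this.1, this.2]
      simp
  rw [Finset.prod_congr rfl fun i _ => h i, Finset.prod_mul_distrib, ← map_prod,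
    Finset.prod_mul_distrib, Finset.prod_mul_distrib, Finset.prod_pow_eq_pow_sum,
    Finset.prod_pow_eq_pow_sum]

/-- The field of fractions of `S`. -/
abbrev FracS (n : ℕ) := FractionRing (SZ n)

/-- The inclusion of `S` into its field of fractions. -/
abbrev toFrac {n : ℕ} : SZ n →+* FracS n := algebraMap (SZ n) (FracS n)

lemma toFrac_injective {n : ℕ} : Function.Injective (toFrac (n := n)) :=
  FaithfulSMul.algebraMap_injective _ _

/-- The inclusion of `S_ℚ` into the field of fractions of `S`. -/
def ratToFrac {n : ℕ} : SQ n →+* FracS n :=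
  MvPolynomial.eval₂Hom (Rat.castHom (FracS n)) fun o => toFrac (X o)

lemma ratToFrac_toQ {n : ℕ} (x : SZ n) : ratToFrac (toQ x) = toFrac x := by
  have h : (ratToFrac (n := n)).comp toQ = toFrac := by
    refine MvPolynomial.ringHom_ext (fun k => ?_) fun o => ?_
    · simp [ratToFrac, toQ]
    · simp [ratToFrac, toQ]
  exact RingHom.congr_fun h x

lemma exists_sum_eval_div {n : ℕ} (m : Fin n → ℕ) (P : MvPolynomial (Fin n) (SZ n)) :
    ∃ y : SZ n, ∑ c ∈ Finset.Icc 0 m, toFrac (MvPolynomial.eval (fun i => (c i : SZ n) * fZ) P) /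
      toFrac (C ((-1) ^ (∑ i, c i) * ((∏ i, ((c i).factorial : ℤ)) *
        ∏ i, (((m - c) i).factorial : ℤ))) * fZ ^ (∑ i, m i)) = toFrac y := by
  obtain ⟨y, hy⟩ := exists_alternating_sum_eval 0 m P
  refine ⟨y, ?_⟩
  have hf : toFrac (fZ : SZ n) ≠ 0 :=
    (map_ne_zero_iff _ toFrac_injective).2 (MvPolynomial.X_ne_zero _)
  have hy' := congrArg ratToFrac hy
  have hfQ : ratToFrac (fQ : SQ n) = toFrac fZ := by simp [ratToFrac, fQ, fZ]
  rw [map_mul, map_pow, hfQ, ratToFrac_toQ, map_sum] at hy'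
  apply mul_left_cancel₀ (pow_ne_zero (∑ i, m i) hf)
  rw [← hy', Finset.mul_sum]
  refine Finset.sum_congr rfl fun c _ => ?_
  have hC : ∀ q : ℚ, ratToFrac (C q : SQ n) = (q : FracS n) := fun q => by simp [ratToFrac]
  have hC' : ∀ k : ℤ, toFrac (C k : SZ n) = (k : FracS n) := fun k => by
    rw [← ratToFrac_toQ, toQ, MvPolynomial.map_C, hC]
    simp
  rw [map_mul ratToFrac, ratToFrac_toQ, hC, map_mul toFrac, hC', map_pow]
  simp only [Pi.zero_apply, zero_add, Pi.sub_apply]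
  push_cast
  have h1 : ((-1 : FracS n) ^ ∑ i, c i) * (-1) ^ (∑ i, c i) = 1 := by
    rw [← mul_pow]; simp
  have h2 : ((∏ i, ((c i).factorial : FracS n)) * ∏ i, ((m i - c i).factorial : FracS n)) ≠ 0 :=
    mul_ne_zero (Finset.prod_ne_zero_iff.2 fun i _ => Nat.cast_ne_zero.2 (Nat.factorial_ne_zero _))
      (Finset.prod_ne_zero_iff.2 fun i _ => Nat.cast_ne_zero.2 (Nat.factorial_ne_zero _))
  have h3 : ((-1 : FracS n) ^ ∑ i, c i) ≠ 0 := left_ne_zero_of_mul_eq_one h1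
  field_simp
  rw [pow_two, h1, mul_one]

/-- The push-forward to a point, by localization. -/
def pushFwd {n r d : ℕ} (g : FixedPt n r d → SZ n) : FracS n :=
  ∑ t, toFrac (g t) / toFrac (zVal t.1 t.1)

lemma not_dvd_offVal {n : ℕ} {π : SZ n} (hπ : Prime π)
    (h : ∀ i j k, i ≠ j → ¬ π ∣ lin i j k) (t : Triple n) : ¬ π ∣ offVal t := by
  rw [offVal, hπ.dvd_finsetProd_iff]
  rintro ⟨i, -, hi⟩
  rw [hπ.dvd_finsetProd_iff] at hi
  obtain ⟨j, -, hj⟩ := hi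
  have hprod : ∀ s : Finset ℤ, i ≠ j → ¬ π ∣ ∏ k ∈ s, lin i j k := by
    intro s hij hs
    obtain ⟨k, -, hk⟩ := (hπ.dvd_finsetProd_iff _).1 hs
    exact h i j k hij hk
  unfold zBlock at hj
  split_ifs at hj with hij h1 h2
  · exact hπ.not_dvd_one hj
  · exact (hπ.dvd_or_dvd hj).elim (hprod _ hij) (hprod _ hij)
  · exact hprod _ hij hj
  · exact hπ.not_dvd_one hj

lemma sum_compPt {n r d : ℕ} {δ : Fin n → Bool} {m : Fin n → ℕ} (t₀ : CompPt n r d δ m)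
    {R : Type*} [AddCommMonoid R] (F : (Fin n → ℕ) → R) :
    ∑ t : CompPt n r d δ m, F t.1.1.2.1 = ∑ c ∈ Finset.Icc 0 m, F c := by
  refine Finset.sum_bij (fun t _ => t.1.1.2.1) ?_ ?_ ?_ (fun _ _ => rfl)
  · intro t _
    refine Finset.mem_Icc.2 ⟨zero_le, ?_⟩
    exact le_self_add.trans t.2.2.le
  · rintro ⟨⟨⟨δ', a, b⟩, h⟩, h1, h2⟩ - ⟨⟨⟨δ'', a', b'⟩, h'⟩, h1', h2'⟩ - rfl
    dsimp only at h1 h2 h1' h2'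
    subst h1 h1'
    have : b = b' := add_left_cancel (h2.trans h2'.symm)
    subst this
    rfl
  · intro c hc
    have hcm : c + (m - c) = m := add_tsub_cancel_of_le (Finset.mem_Icc.1 hc).2
    obtain ⟨⟨⟨δ', a, b⟩, h⟩, h1, h2⟩ := t₀
    dsimp only at h1 h2
    subst h1
    exact ⟨⟨⟨(δ', c, m - c), inF_of_add_eq h (h2.trans hcm.symm)⟩, rfl, hcm⟩,
      Finset.mem_univ _, rfl⟩

lemma sum_compPt_mem_primeLoc {n r d : ℕ} {π : SZ n} (hπ : Prime π)
    (h : ∀ i j k, i ≠ j → ¬ π ∣ lin i j k) {g : FixedPt n r d → SZ n} (hg : g ∈ chow n r d)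
    (δ : Fin n → Bool) (m : Fin n → ℕ) :
    ∑ t : CompPt n r d δ m, toFrac (g t.1) / toFrac (zVal t.1.1 t.1.1) ∈ primeLoc hπ := by
  rcases isEmpty_or_nonempty (CompPt n r d δ m) with hE | ⟨⟨t₀⟩⟩
  · simp [zero_mem]
  obtain ⟨η, hη, hη'⟩ := exists_mul_eq_prod _ (offVal_mem_compRing n r d δ m)
  obtain ⟨P, hP⟩ := mem_compRing.1 (mul_mem (mem_compRing_of_mem_chow hg δ m) hη)
  obtain ⟨y, hy⟩ := exists_sum_eval_div m P
  rw [← sum_compPt t₀] at hy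
  have hprod : ¬ π ∣ ∏ t : CompPt n r d δ m, offVal t.1.1 := by
    rw [hπ.dvd_finsetProd_iff]
    rintro ⟨t, -, ht⟩
    exact not_dvd_offVal hπ h _ ht
  have key : ∑ t : CompPt n r d δ m, toFrac (g t.1) / toFrac (zVal t.1.1 t.1.1) =
      (toFrac (∏ t : CompPt n r d δ m, offVal t.1.1))⁻¹ * toFrac y := by
    rw [← hy, Finset.mul_sum]
    refine Finset.sum_congr rfl fun t _ => ?_
    have hb : m - t.1.1.2.1 = t.1.1.2.2 :=
      (congrArg (· - t.1.1.2.1) t.2.2.symm).trans (add_tsub_cancel_left _ _)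
    have hm : ∑ i, m i = ∑ i, (t.1.1.2.1 i + t.1.1.2.2 i) :=
      Finset.sum_congr rfl fun i _ => (congrFun t.2.2 i).symm
    have h0 : ∏ t : CompPt n r d δ m, offVal t.1.1 ≠ 0 := fun h0 => hprod (h0 ▸ dvd_zero π)
    rw [← hP t, hb, hm, zVal_self t.1.2]
    have h1 := hη' t
    rw [← h1] at h0 ⊢
    have h2 := (map_ne_zero_iff _ (toFrac_injective (n := n))).2 (right_ne_zero_of_mul h0)
    simp only [Pi.mul_apply, map_mul toFrac]
    rw [inv_mul_eq_div, div_div, ← mul_assoc (_ * _) _ (toFrac (η t)), mul_div_mul_right _ _ h2]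
  rw [key]
  exact mul_mem (inv_mem_primeLoc hπ hprod) (algebraMap_mem_primeLoc hπ y)

lemma pushFwd_mem_primeLoc_of_not_dvd {n r d : ℕ} {π : SZ n} (hπ : Prime π)
    (h : ∀ i j k, i ≠ j → ¬ π ∣ lin i j k) {g : FixedPt n r d → SZ n} (hg : g ∈ chow n r d) :
    pushFwd g ∈ primeLoc hπ := by
  classical
  let κ : FixedPt n r d → (Fin n → Bool) × (Fin n → ℕ) := fun t => (t.1.1, t.1.2.1 + t.1.2.2)
  rw [pushFwd, ← Finset.sum_fiberwise_of_maps_to (t := Finset.univ.image κ)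
    (fun t ht => Finset.mem_image_of_mem κ ht)]
  refine sum_mem fun c _ => ?_
  convert sum_compPt_mem_primeLoc hπ h hg c.1 c.2 using 1
  exact Finset.sum_subtype _ (fun t => by simp [κ, Prod.ext_iff]) _

/-! ### Integrality at the mixed linear forms: the weights -/

section BlockProd

variable {n : ℕ} {R : Type*} [CommMonoid R]

/-- The product of `g p q m` over a family of multisets of integers `m`. -/
def blockProd (g : Fin n → Fin n → ℤ → R) (J : Fin n → Fin n → Multiset ℤ) : R :=
  ∏ p, ∏ q, ((J p q).map (g p q)).prod

lemma blockProd_add (g : Fin n → Fin n → ℤ → R) (J J' : Fin n → Fin n → Multiset ℤ) :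
    blockProd g (J + J') = blockProd g J * blockProd g J' := by
  simp only [blockProd, Pi.add_apply, Multiset.map_add, Multiset.prod_add, Finset.prod_mul_distrib]

lemma map_blockProd {R' : Type*} [CommMonoid R'] (φ : R →* R') (g : Fin n → Fin n → ℤ → R)
    (J : Fin n → Fin n → Multiset ℤ) :
    φ (blockProd g J) = blockProd (fun p q m => φ (g p q m)) J := by
  simp only [blockProd, map_prod, map_multiset_prod, Multiset.map_map, Function.comp_def]

/-- The family `J` without the pairs opposite `(i, j, k)` and `(j, i, -k)`. -/
def stripIdx (i j : Fin n) (k : ℤ) (J : Fin n → Fin n → Multiset ℤ) (p q : Fin n) : Multiset ℤ :=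
  (J p q).filter fun m => ¬ ((p, q, m) = (i, j, k) ∨ (p, q, m) = (j, i, -k))

lemma blockProd_eq_mul_strip {i j : Fin n} (hij : i ≠ j) (k : ℤ) (g : Fin n → Fin n → ℤ → R)
    (J : Fin n → Fin n → Multiset ℤ) : blockProd g J = g i j k ^ (J i j).count k *
      g j i (-k) ^ (J j i).count (-k) * blockProd g (stripIdx i j k J) := by
  have h : ∀ p q, ((J p q).map (g p q)).prod =
      (if (p, q) = (i, j) then g i j k ^ (J i j).count k else 1) *
      (if (p, q) = (j, i) then g j i (-k) ^ (J j i).count (-k) else 1) *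
        ((stripIdx i j k J p q).map (g p q)).prod := by
    intro p q
    have hsplit := Multiset.filter_add_not
      (fun m => (p, q, m) = (i, j, k) ∨ (p, q, m) = (j, i, -k)) (J p q)
    conv_lhs => rw [← hsplit, Multiset.map_add, Multiset.prod_add]
    refine congrArg (· * _) ?_
    by_cases h1 : (p, q) = (i, j)
    · obtain ⟨rfl, rfl⟩ := Prod.mk.inj h1
      rw [if_pos rfl, if_neg (by simp [hij]), mul_one]
      simp [hij, Multiset.filter_eq', Multiset.prod_replicate]
    · by_cases h2 : (p, q) = (j, i)
      · obtain ⟨rfl, rfl⟩ := Prod.mk.inj h2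
        rw [if_neg h1, if_pos rfl, one_mul]
        simp [hij, hij.symm, Multiset.filter_eq', Multiset.prod_replicate]
      · rw [if_neg h1, if_neg h2, one_mul, Multiset.filter_eq_nil.2]
        · simp
        · rintro m - (hm | hm)
          · exact h1 (by simp_all)
          · exact h2 (by simp_all)
  have hprod : ∀ (u v : Fin n) (x : R), ∏ p, ∏ q, (if (p, q) = (u, v) then x else 1) = x := by
    intro u v x
    rw [← Finset.prod_product', Finset.univ_product_univ]
    simp
  rw [blockProd, Finset.prod_congr rfl fun p _ => Finset.prod_congr rfl fun q _ => h p q]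
  simp only [Finset.prod_mul_distrib, hprod]
  rfl

end BlockProd

lemma not_lin_dvd_blockProd_strip {n : ℕ} {i j : Fin n} (hij : i ≠ j) (k : ℤ)
    {J : Fin n → Fin n → Multiset ℤ} (hJ : ∀ p, 0 ∉ J p p) :
    ¬ lin i j k ∣ blockProd lin (stripIdx i j k J) := by
  have hπ := prime_lin hij k
  rw [blockProd, hπ.dvd_finsetProd_iff]
  rintro ⟨p, -, hp⟩
  obtain ⟨q, -, hq⟩ := (hπ.dvd_finsetProd_iff _).1 hp
  obtain ⟨x, hx, hdvd⟩ := hπ.exists_mem_multiset_map_dvd hq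
  rw [stripIdx, Multiset.mem_filter, not_or] at hx
  rcases lin_dvd_lin hij hdvd with ⟨rfl, rfl, rfl⟩ | ⟨rfl, rfl, rfl⟩ | ⟨rfl, rfl⟩
  · exact hx.2.1 rfl
  · exact hx.2.2 rfl
  · exact hJ _ hx.1

lemma monic_blockProd_dFactor {n : ℕ} (J : Fin n → Fin n → Multiset ℤ) :
    (blockProd dFactor J).Monic :=
  Polynomial.monic_prod_of_monic _ _ fun _ _ => Polynomial.monic_prod_of_monic _ _ fun _ _ =>
    Polynomial.monic_multiset_prod_of_monic _ _ fun _ _ => Polynomial.monic_X_add_C _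

lemma blockProd_dFactor_eval_zero {n : ℕ} (J : Fin n → Fin n → Multiset ℤ) :
    (blockProd dFactor J).eval 0 = blockProd lin J := by
  have h := map_blockProd ((Polynomial.evalRingHom (0 : SZ n)) : _ →* SZ n) dFactor J
  rw [MonoidHom.coe_coe, Polynomial.coe_evalRingHom] at h
  rw [h]
  refine congrArg (blockProd · J) ?_
  funext p q m
  simp [dFactor]

/-- Two families of weights with opposite pole along `lin i j k`, agreeing modulo it. -/
lemma lin_dvd_blockProd_strip_sub {n : ℕ} {i j : Fin n} (hij : i ≠ j) (k : ℤ)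
    {J J' : Fin n → Fin n → Multiset ℤ} {B : Polynomial (SZ n)} (hB : B.Monic)
    (hc : (J i j).count k + (J j i).count (-k) = (J' i j).count k + (J' j i).count (-k))
    (h : (blockProd dFactor J * B).map (rho i j k : SZ n →+* SZ n) =
      (blockProd dFactor J' * B).map (rho i j k : SZ n →+* SZ n)) :
    lin i j k ∣ blockProd lin (stripIdx i j k J) - blockProd lin (stripIdx i j k J') := by
  have hd : (dFactor i j k).map (rho i j k : SZ n →+* SZ n) = Polynomial.X ∧
      (dFactor j i (-k)).map (rho i j k : SZ n →+* SZ n) = Polynomial.X := by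
    simp [dFactor, lin_neg_swap, rho_lin hij]
  have hJ : ∀ J : Fin n → Fin n → Multiset ℤ,
      (blockProd dFactor J).map (rho i j k : SZ n →+* SZ n) =
        Polynomial.X ^ ((J i j).count k + (J j i).count (-k)) *
          (blockProd dFactor (stripIdx i j k J)).map (rho i j k : SZ n →+* SZ n) := by
    intro J
    rw [blockProd_eq_mul_strip hij k dFactor J, Polynomial.map_mul, Polynomial.map_mul,
      Polynomial.map_pow, Polynomial.map_pow, hd.1, hd.2, pow_add]
  rw [Polynomial.map_mul, Polynomial.map_mul, hJ, hJ J', hc] at h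
  have h1 := mul_left_cancel₀ (pow_ne_zero _ Polynomial.X_ne_zero)
    (mul_right_cancel₀ (hB.map _).ne_zero h)
  rw [lin_dvd_iff hij, map_sub, sub_eq_zero, ← blockProd_dFactor_eval_zero,
    ← blockProd_dFactor_eval_zero]
  have h2 := congrArg (Polynomial.eval 0) h1
  have h3 : ∀ p : Polynomial (SZ n), (p.map (rho i j k : SZ n →+* SZ n)).eval 0 =
      rho i j k (p.eval 0) := fun p => by
    rw [← Polynomial.coeff_zero_eq_eval_zero, Polynomial.coeff_map,
      Polynomial.coeff_zero_eq_eval_zero]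
    rfl
  rwa [h3, h3] at h2

lemma inv_blockProd_mem_primeLoc {n : ℕ} {i j : Fin n} (hij : i ≠ j) (k : ℤ)
    {J : Fin n → Fin n → Multiset ℤ} (hJ : ∀ p, 0 ∉ J p p) (h1 : (J i j).count k = 0)
    (h2 : (J j i).count (-k) = 0) : (toFrac (blockProd lin J))⁻¹ ∈ primeLoc (prime_lin hij k) := by
  rw [blockProd_eq_mul_strip hij k lin J, h1, h2, pow_zero, pow_zero, one_mul, one_mul]
  exact inv_mem_primeLoc _ (not_lin_dvd_blockProd_strip hij k hJ)

lemma inv_blockProd_add_inv_mem_primeLoc {n : ℕ} {i j : Fin n} (hij : i ≠ j) (k : ℤ)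
    {J J' : Fin n → Fin n → Multiset ℤ} (hJ : ∀ p, 0 ∉ J p p) (hJ' : ∀ p, 0 ∉ J' p p)
    (h1 : (J i j).count k = (J' j i).count (-k)) (h2 : (J j i).count (-k) = (J' i j).count k)
    (h3 : (J i j).count k + (J j i).count (-k) = 1) {B : Polynomial (SZ n)} (hB : B.Monic)
    (h : (blockProd dFactor J * B).map (rho i j k : SZ n →+* SZ n) =
      (blockProd dFactor J' * B).map (rho i j k : SZ n →+* SZ n)) :
    toFrac (lin i j k) * (toFrac (blockProd lin J))⁻¹ ∈ primeLoc (prime_lin hij k) ∧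
      (toFrac (blockProd lin J))⁻¹ + (toFrac (blockProd lin J'))⁻¹ ∈
        primeLoc (prime_lin hij k) := by
  have hE := not_lin_dvd_blockProd_strip hij k hJ
  have hE' := not_lin_dvd_blockProd_strip hij k hJ'
  obtain ⟨y, hy⟩ := lin_dvd_blockProd_strip_sub hij k hB (by omega) h
  have hO := inv_mem_primeLoc (prime_lin hij k) hE
  have hO' := inv_mem_primeLoc (prime_lin hij k) hE'
  rw [blockProd_eq_mul_strip hij k lin J, blockProd_eq_mul_strip hij k lin J', ← h1, ← h2,
    lin_neg_swap i j k]
  set E := blockProd lin (stripIdx i j k J)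
  set E' := blockProd lin (stripIdx i j k J')
  have hL : toFrac (lin i j k) ≠ 0 :=
    (map_ne_zero_iff _ toFrac_injective).2 (prime_lin hij k).ne_zero
  have hE0 : toFrac E ≠ 0 :=
    (map_ne_zero_iff _ toFrac_injective).2 fun h0 => hE (h0 ▸ dvd_zero _)
  have hE0' : toFrac E' ≠ 0 :=
    (map_ne_zero_iff _ toFrac_injective).2 fun h0 => hE' (h0 ▸ dvd_zero _)
  have hyK : toFrac E - toFrac E' = toFrac (lin i j k) * toFrac y := by
    rw [← map_sub, ← map_mul, hy]
  have hprod := mul_mem (algebraMap_mem_primeLoc (prime_lin hij k) y) (mul_mem hO hO')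
  rcases Nat.add_eq_one_iff.1 h3 with ⟨e1, e2⟩ | ⟨e1, e2⟩ <;> rw [e1, e2]
  · constructor
    · convert neg_mem hO using 1
      simp only [pow_zero, pow_one, one_mul, map_mul, map_neg]
      field_simp
    · convert hprod using 1
      simp only [pow_zero, pow_one, one_mul, mul_one, map_mul, map_neg]
      field_simp
      linear_combination hyK
  · constructor
    · convert hO using 1
      simp only [pow_zero, pow_one, mul_one, map_mul]
      field_simp
    · convert neg_mem hprod using 1
      simp only [pow_zero, pow_one, one_mul, mul_one, map_mul, map_neg]
      field_simp
      linear_combination -hyK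

/-! ### Integrality at the mixed linear forms: the involutions -/

/-- The involution `a_i ↦ a_j - k`, `a_j ↦ a_i + k`, where it makes sense. -/
def swapFn {n : ℕ} (i j : Fin n) (k : ℤ) (a : Fin n → ℕ) : Fin n → ℕ :=
  if -(a i : ℤ) ≤ k ∧ k ≤ a j then
    Function.update (Function.update a i (a j - k).toNat) j (a i + k).toNat
  else a

lemma swapFn_of_ne {n : ℕ} {i j p : Fin n} (k : ℤ) (a : Fin n → ℕ) (hi : p ≠ i) (hj : p ≠ j) :
    swapFn i j k a p = a p := by
  unfold swapFn
  split_ifs <;> simp [hi, hj]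

lemma swapFn_cases {n : ℕ} {i j : Fin n} (hij : i ≠ j) (k : ℤ) (a : Fin n → ℕ) :
    (-(a i : ℤ) ≤ k ∧ k ≤ a j ∧ (swapFn i j k a i : ℤ) = a j - k ∧
      (swapFn i j k a j : ℤ) = a i + k) ∨
      (¬ (-(a i : ℤ) ≤ k ∧ k ≤ a j) ∧ swapFn i j k a = a) := by
  unfold swapFn
  split_ifs with h
  · left
    simp only [Function.update_self, Function.update_of_ne hij]
    omega
  · exact Or.inr ⟨h, rfl⟩

lemma swapFn_swapFn {n : ℕ} {i j : Fin n} (hij : i ≠ j) (k : ℤ) (a : Fin n → ℕ) :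
    swapFn i j k (swapFn i j k a) = a := by
  rcases swapFn_cases hij k a with ⟨h1, h2, h3, h4⟩ | ⟨h1, h2⟩
  · rcases swapFn_cases hij k (swapFn i j k a) with ⟨h1', h2', h3', h4'⟩ | ⟨h1', -⟩
    · funext p
      by_cases hi : p = i
      · subst hi; omega
      by_cases hj : p = j
      · subst hj; omega
      rw [swapFn_of_ne k _ hi hj, swapFn_of_ne k _ hi hj]
    · omega
  · rw [h2, h2]

lemma sum_swapFn {n : ℕ} {i j : Fin n} (hij : i ≠ j) (k : ℤ) (a : Fin n → ℕ) :
    ∑ p, swapFn i j k a p = ∑ p, a p := by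
  have h : swapFn i j k a i + swapFn i j k a j = a i + a j := by
    rcases swapFn_cases hij k a with ⟨h1, h2, h3, h4⟩ | ⟨h1, h2⟩
    · omega
    · rw [h2]
  rw [sum_univ_eq_add_add hij, sum_univ_eq_add_add hij a, h]
  refine congrArg _ (Finset.sum_congr rfl fun p hp => ?_)
  simp only [Finset.mem_sdiff, Finset.mem_insert, Finset.mem_singleton, not_or] at hp
  exact swapFn_of_ne k a hp.2.1 hp.2.2

lemma swapFn_eq_zero {n : ℕ} {δ : Fin n → Bool} {i j : Fin n} (hi : δ i = true) (hj : δ j = true)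
    (k : ℤ) {a : Fin n → ℕ} (ha : ∀ p, δ p = false → a p = 0) (p : Fin n) (hp : δ p = false) :
    swapFn i j k a p = 0 := by
  rw [swapFn_of_ne k a (by rintro rfl; simp_all) (by rintro rfl; simp_all), ha p hp]

lemma inF.swapFn_left {n r d : ℕ} {δ : Fin n → Bool} {a b : Fin n → ℕ} (h : inF n r d (δ, a, b))
    {i j : Fin n} (hij : i ≠ j) (hi : δ i = true) (hj : δ j = true) (k : ℤ) :
    inF n r d (δ, swapFn i j k a, b) := by
  refine ⟨h.1, ?_, fun p hp => ⟨swapFn_eq_zero hi hj k (fun p hp => (h.2.2 p hp).1) p hp,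
    (h.2.2 p hp).2⟩⟩
  have h2 := h.2.1
  dsimp only at h2 ⊢
  rw [Finset.sum_add_distrib, sum_swapFn hij, ← Finset.sum_add_distrib, h2]

lemma inF.swap {n r d : ℕ} {δ : Fin n → Bool} {a b : Fin n → ℕ} (h : inF n r d (δ, a, b)) :
    inF n r d (δ, b, a) := inF_of_add_eq h (add_comm _ _)

lemma inF.swapFn_right {n r d : ℕ} {δ : Fin n → Bool} {a b : Fin n → ℕ} (h : inF n r d (δ, a, b))
    {i j : Fin n} (hij : i ≠ j) (hi : δ i = true) (hj : δ j = true) (k : ℤ) :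
    inF n r d (δ, a, swapFn i j k b) := (h.swap.swapFn_left hij hi hj k).swap

/-- The transposition of `δ_i = 1` and `δ_j = 0`, moving `(a_i, b_i)` to `(a_i + k, b_i - k)`,
where it makes sense. -/
def passPt {n : ℕ} (i j : Fin n) (k : ℤ) (t : Triple n) : Triple n :=
  if t.1 i = true ∧ t.1 j = false ∧ -(t.2.1 i : ℤ) ≤ k ∧ k ≤ t.2.2 i then
    (Function.update (Function.update t.1 i false) j true,
      Function.update (Function.update t.2.1 i 0) j (t.2.1 i + k).toNat,
      Function.update (Function.update t.2.2 i 0) j (t.2.2 i - k).toNat)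
  else t

lemma passPt_of_ne {n : ℕ} {i j p : Fin n} (k : ℤ) (t : Triple n) (hi : p ≠ i) (hj : p ≠ j) :
    (passPt i j k t).1 p = t.1 p ∧ (passPt i j k t).2.1 p = t.2.1 p ∧
      (passPt i j k t).2.2 p = t.2.2 p := by
  unfold passPt
  split_ifs <;> simp [hi, hj]

lemma passPt_cases {n : ℕ} {i j : Fin n} (hij : i ≠ j) (k : ℤ) (t : Triple n) :
    (t.1 i = true ∧ t.1 j = false ∧ -(t.2.1 i : ℤ) ≤ k ∧ k ≤ t.2.2 i ∧
      (passPt i j k t).1 i = false ∧ (passPt i j k t).1 j = true ∧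
      (passPt i j k t).2.1 i = 0 ∧ (passPt i j k t).2.2 i = 0 ∧
      ((passPt i j k t).2.1 j : ℤ) = t.2.1 i + k ∧ ((passPt i j k t).2.2 j : ℤ) = t.2.2 i - k) ∨
    (¬ (t.1 i = true ∧ t.1 j = false ∧ -(t.2.1 i : ℤ) ≤ k ∧ k ≤ t.2.2 i) ∧
      passPt i j k t = t) := by
  unfold passPt
  split_ifs with h
  · left
    obtain ⟨h1, h2, h3, h4⟩ := h
    simp only [Function.update_self, Function.update_of_ne hij]
    refine ⟨h1, h2, h3, h4, trivial, trivial, trivial, trivial, ?_, ?_⟩ <;> omega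
  · exact Or.inr ⟨h, rfl⟩

lemma inF.pass {n r d : ℕ} {t : Triple n} (h : inF n r d t) {i j : Fin n} (hij : i ≠ j) (k : ℤ) :
    inF n r d (passPt i j k t) := by
  rcases passPt_cases hij k t with ⟨h1, h2, h3, h4, h5, h6, h7, h8, h9, h10⟩ | ⟨-, h2⟩
  · refine ⟨?_, ?_, fun p hp => ?_⟩
    · have h0 := h.1
      rw [Finset.card_filter, sum_univ_eq_add_add hij] at h0 ⊢
      rw [← h0, h1, h2, h5, h6]
      simp only [Bool.false_eq_true, if_true, if_false]
      refine congrArg _ (Finset.sum_congr rfl fun p hp => ?_)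
      simp only [Finset.mem_sdiff, Finset.mem_insert, Finset.mem_singleton, not_or] at hp
      rw [(passPt_of_ne k t hp.2.1 hp.2.2).1]
    · have h0 := h.2.1
      have hj := h.2.2 j h2
      rw [sum_univ_eq_add_add hij] at h0 ⊢
      rw [← h0, Finset.sum_congr rfl fun p hp => ?_]
      · refine congrArg (· + _) ?_
        omega
      · simp only [Finset.mem_sdiff, Finset.mem_insert, Finset.mem_singleton, not_or] at hp
        rw [(passPt_of_ne k t hp.2.1 hp.2.2).2.1, (passPt_of_ne k t hp.2.1 hp.2.2).2.2]
    · by_cases hi : p = i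
      · subst hi; exact ⟨h7, h8⟩
      by_cases hj : p = j
      · subst hj; simp_all
      have hne := passPt_of_ne k t hi hj
      rw [hne.2.1, hne.2.2]
      exact h.2.2 p (hne.1 ▸ hp)
  · rwa [h2]

lemma inF.pass_pass {n r d : ℕ} {t : Triple n} (h : inF n r d t) {i j : Fin n} (hij : i ≠ j)
    (k : ℤ) (hi : t.1 i = true) (hj : t.1 j = false) :
    passPt j i (-k) (passPt i j k t) = t ∨ passPt i j k t = t := by
  rcases passPt_cases hij k t with ⟨h1, h2, h3, h4, h5, h6, h7, h8, h9, h10⟩ | ⟨-, h2⟩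
  · left
    have h0 := h.2.2 j hj
    rcases passPt_cases hij.symm (-k) (passPt i j k t) with
      ⟨h1', h2', h3', h4', h5', h6', h7', h8', h9', h10'⟩ | ⟨h1', -⟩
    · refine Prod.ext ?_ (Prod.ext ?_ ?_) <;> funext p <;> by_cases hpi : p = i
      · subst hpi; rw [h6', h1]
      · by_cases hpj : p = j
        · subst hpj; rw [h5', h2]
        · rw [(passPt_of_ne _ _ hpj hpi).1, (passPt_of_ne _ _ hpi hpj).1]
      · subst hpi; omega
      · by_cases hpj : p = j
        · subst hpj; omega
        · rw [(passPt_of_ne _ _ hpj hpi).2.1, (passPt_of_ne _ _ hpi hpj).2.1]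
      · subst hpi; omega
      · by_cases hpj : p = j
        · subst hpj; omega
        · rw [(passPt_of_ne _ _ hpj hpi).2.2, (passPt_of_ne _ _ hpi hpj).2.2]
    · exact (h1' ⟨h6, h5, by omega, by omega⟩).elim
  · exact Or.inr h2

/-- The involution of the fixed points moving along `lin i j k` and changing `a`. -/
def moveLeft {n : ℕ} (i j : Fin n) (k : ℤ) (t : Triple n) : Triple n :=
  if t.1 i = true then
    if t.1 j = true then (t.1, swapFn i j k t.2.1, t.2.2) else passPt i j k t
  else passPt j i (-k) t

/-- The involution of the fixed points moving along `lin i j k` and changing only `b`. -/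
def moveRight {n : ℕ} (i j : Fin n) (k : ℤ) (t : Triple n) : Triple n :=
  if t.1 i = true ∧ t.1 j = true then (t.1, t.2.1, swapFn j i k t.2.2) else t

lemma inF.moveLeft_mem {n r d : ℕ} {t : Triple n} (h : inF n r d t) {i j : Fin n} (hij : i ≠ j)
    (k : ℤ) : inF n r d (moveLeft i j k t) := by
  unfold moveLeft
  split_ifs with hi hj
  · exact h.swapFn_left hij hi hj k
  · exact h.pass hij k
  · exact h.pass hij.symm (-k)

lemma inF.moveRight_mem {n r d : ℕ} {t : Triple n} (h : inF n r d t) {i j : Fin n} (hij : i ≠ j)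
    (k : ℤ) : inF n r d (moveRight i j k t) := by
  unfold moveRight
  split_ifs with hδ
  · exact h.swapFn_right hij.symm hδ.2 hδ.1 k
  · exact h

lemma moveRight_moveRight {n : ℕ} {i j : Fin n} (hij : i ≠ j) (k : ℤ) (t : Triple n) :
    moveRight i j k (moveRight i j k t) = t := by
  by_cases h : t.1 i = true ∧ t.1 j = true
  · have h1 : moveRight i j k t = (t.1, t.2.1, swapFn j i k t.2.2) := if_pos h
    rw [h1, moveRight, if_pos h, swapFn_swapFn hij.symm]
  · have h1 : moveRight i j k t = t := if_neg h
    rw [h1, h1]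

lemma inF.moveLeft_invol {n r d : ℕ} {t : Triple n} (h : inF n r d t) {i j : Fin n}
    (hij : i ≠ j) (k : ℤ) : moveLeft i j k (moveLeft i j k t) = t := by
  by_cases hi : t.1 i = true
  · by_cases hj : t.1 j = true
    · have h1 : moveLeft i j k t = (t.1, swapFn i j k t.2.1, t.2.2) := by
        rw [moveLeft, if_pos hi, if_pos hj]
      rw [h1, moveLeft, if_pos hi, if_pos hj, swapFn_swapFn hij]
    · have h1 : moveLeft i j k t = passPt i j k t := by
        rw [moveLeft, if_pos hi, if_neg hj]
      rcases passPt_cases hij k t with hp | ⟨-, h2⟩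
      · have h2 := hp.2.2.2.2.1
        rw [h1, moveLeft, if_neg (by simp [h2])]
        rcases h.pass_pass hij k hi (by simpa using hj) with h3 | h3
        · exact h3
        · rw [h3] at h2
          simp [h2] at hi
      · rw [h1, h2, h1, h2]
  · have h1 : moveLeft i j k t = passPt j i (-k) t := by
      rw [moveLeft, if_neg hi]
    rcases passPt_cases hij.symm (-k) t with hp | ⟨-, h2⟩
    · have h2 := hp.2.2.2.2.1
      rw [h1, moveLeft, if_pos hp.2.2.2.2.2.1, if_neg (by simp [h2])]
      rcases h.pass_pass hij.symm (-k) hp.1 (by simpa using hi) with h3 | h3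
      · rwa [neg_neg] at h3
      · rw [h3] at h2
        simp [hp.1] at h2
    · rw [h1, h2, h1, h2]

lemma sum_comp_of_involutive {n r d : ℕ} {R : Type*} [AddCommMonoid R] {σ : Triple n → Triple n}
    (h : ∀ t, inF n r d t → inF n r d (σ t)) (h' : ∀ t, inF n r d t → σ (σ t) = t)
    (f : Triple n → R) : ∑ t : FixedPt n r d, f (σ t.1) = ∑ t : FixedPt n r d, f t.1 :=
  let e : FixedPt n r d → FixedPt n r d := fun t => ⟨σ t.1, h _ t.2⟩
  have he : Function.Involutive e := fun t => Subtype.ext (h' _ t.2)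
  Equiv.sum_comp he.toPerm fun t => f t.1

/-! ### Integrality at the mixed linear forms -/

lemma Rels.lin_dvd_sub_left {n r d : ℕ} {G : Triple n → SZ n} (hG : Rels n r d G)
    {δ : Fin n → Bool} {a b : Fin n → ℕ} (h : inF n r d (δ, a, b)) {i j : Fin n} (hij : i ≠ j)
    (hi : δ i = true) (hj : δ j = true) (k : ℤ) :
    lin i j k ∣ G (δ, a, b) - G (δ, swapFn i j k a, b) := by
  rcases swapFn_cases hij k a with ⟨h1, h2, h3, h4⟩ | ⟨-, h2⟩
  · have := hG.relIIa δ a b _ i j h (h.swapFn_left hij hi hj k) hij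
      fun p hpi hpj => (swapFn_of_ne k a hpi hpj).symm
    rwa [h4, add_sub_cancel_left] at this
  · rw [h2, sub_self]
    exact dvd_zero _

lemma Rels.lin_dvd_sub_right {n r d : ℕ} {G : Triple n → SZ n} (hG : Rels n r d G)
    {δ : Fin n → Bool} {a b : Fin n → ℕ} (h : inF n r d (δ, a, b)) {i j : Fin n} (hij : i ≠ j)
    (hi : δ i = true) (hj : δ j = true) (k : ℤ) :
    lin i j k ∣ G (δ, a, b) - G (δ, a, swapFn j i k b) := by
  rcases swapFn_cases hij.symm k b with ⟨h1, h2, h3, h4⟩ | ⟨-, h2⟩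
  · have := hG.relIIb δ a b _ i j h (h.swapFn_right hij.symm hj hi k) hij
      fun p hpi hpj => (swapFn_of_ne k b hpj hpi).symm
    rwa [h3, sub_sub_cancel] at this
  · rw [h2, sub_self]
    exact dvd_zero _

lemma Rels.lin_sq_dvd {n r d : ℕ} {G : Triple n → SZ n} (hG : Rels n r d G)
    {δ : Fin n → Bool} {a b : Fin n → ℕ} (h : inF n r d (δ, a, b)) {i j : Fin n} (hij : i ≠ j)
    (hi : δ i = true) (hj : δ j = true) (k : ℤ) :
    lin i j k ^ 2 ∣ G (δ, a, b) - G (δ, swapFn i j k a, b) - G (δ, a, swapFn j i k b) +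
      G (δ, swapFn i j k a, swapFn j i k b) := by
  rcases swapFn_cases hij k a with ⟨h1, h2, h3, h4⟩ | ⟨-, h2⟩
  · rcases swapFn_cases hij.symm k b with ⟨h1', h2', h3', h4'⟩ | ⟨-, h2'⟩
    · have := hG.relIIc δ a b _ _ i j h (h.swapFn_left hij hi hj k)
        (h.swapFn_right hij.symm hj hi k) hij
        (fun p hpi hpj => (swapFn_of_ne k a hpi hpj).symm)
        (fun p hpi hpj => (swapFn_of_ne k b hpj hpi).symm) (by rw [h4, h3']; ring)
      rwa [h4, add_sub_cancel_left] at this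
    · rw [h2']
      ring_nf
      exact dvd_zero _
  · rw [h2]
    ring_nf
    exact dvd_zero _

lemma Rels.lin_dvd_sub_pass {n r d : ℕ} {G : Triple n → SZ n} (hG : Rels n r d G) {t : Triple n}
    (h : inF n r d t) {i j : Fin n} (hij : i ≠ j) (k : ℤ) :
    lin i j k ∣ G t - G (passPt i j k t) := by
  rcases passPt_cases hij k t with ⟨h1, h2, h3, h4, h5, h6, h7, h8, h9, h10⟩ | ⟨-, h2⟩
  · have := hG.relI t.1 (passPt i j k t).1 t.2.1 t.2.2 (passPt i j k t).2.1
      (passPt i j k t).2.2 i j h (h.pass hij k) hij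
      (fun p hpi hpj => ?_) h1 h6 h2 h5
    · rwa [h9, add_sub_cancel_left] at this
    · have := passPt_of_ne k t hpi hpj
      exact ⟨this.1.symm, this.2.1.symm, this.2.2.symm⟩
  · rw [h2, sub_self]
    exact dvd_zero _

lemma map_rho_zPoly_eq {n r d : ℕ} {i j : Fin n} (hij : i ≠ j) (k : ℤ) {t t' : Triple n}
    (ht : inF n r d t) (ht' : inF n r d t')
    (h : ∀ G : Triple n → SZ n, Rels n r d G → lin i j k ∣ G t - G t') :
    (zPoly t t).map (rho i j k : SZ n →+* SZ n) =
      (zPoly t' t').map (rho i j k : SZ n →+* SZ n) := by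
  ext1 m
  rw [Polynomial.coeff_map, Polynomial.coeff_map]
  have hm := h _ (mem_chow.1 (coeff_zPoly_mem_chow n r d m))
  have e := extTuple_apply (fun t : FixedPt n r d => (zPoly t.1 t.1).coeff m)
  rw [e ⟨t, ht⟩, e ⟨t', ht'⟩, lin_dvd_iff hij, map_sub, sub_eq_zero] at hm
  exact hm

/-- The weights of the tangent space at `(δ, a, b)` contributed by `a`. -/
def leftIdx {n : ℕ} (δ : Fin n → Bool) (a : Fin n → ℕ) (p q : Fin n) : Multiset ℤ :=
  if δ p = true then
    if δ q = true then (Ico (-(a p : ℤ)) (a q - a p)).val else (Ico (-(a p : ℤ)) 0).val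
  else 0

/-- The weights of the tangent space at `(δ, a, b)` contributed by `b`. -/
def rightIdx {n : ℕ} (δ : Fin n → Bool) (b : Fin n → ℕ) (p q : Fin n) : Multiset ℤ :=
  if δ p = true then
    if δ q = true then (Ico ((b p : ℤ) - b q + 1) (b p + 1)).val else (Ico (0 : ℤ) (b p + 1)).val
  else 0

lemma zero_notMem_leftIdx {n : ℕ} (δ : Fin n → Bool) (a : Fin n → ℕ) (p : Fin n) :
    0 ∉ leftIdx δ a p p := by
  unfold leftIdx
  split_ifs <;> simp

lemma zero_notMem_rightIdx {n : ℕ} (δ : Fin n → Bool) (b : Fin n → ℕ) (p : Fin n) :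
    0 ∉ rightIdx δ b p p := by
  unfold rightIdx
  split_ifs <;> simp

lemma count_val_eq_ite (s : Finset ℤ) (m : ℤ) : s.val.count m = if m ∈ s then 1 else 0 := by
  simp only [Multiset.count_eq_of_nodup s.nodup, Finset.mem_val]

lemma blockProd_left_mul_right {n : ℕ} {R : Type*} [CommMonoid R] (g : Fin n → Fin n → ℤ → R)
    (t : Triple n) : blockProd g (leftIdx t.1 t.2.1) * blockProd g (rightIdx t.1 t.2.2) =
      ∏ p, ∏ q, zBlock (g p q) t t p q := by
  rw [blockProd, blockProd, ← Finset.prod_mul_distrib]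
  refine Finset.prod_congr rfl fun p _ => ?_
  rw [← Finset.prod_mul_distrib]
  refine Finset.prod_congr rfl fun q _ => ?_
  unfold leftIdx rightIdx zBlock
  split_ifs
  · rfl
  · exact prod_Ico_mul_prod_Ico _ (by omega) (by omega)
  · simp

lemma inv_left_mem_primeLoc {n r d : ℕ} {i j : Fin n} (hij : i ≠ j) (k : ℤ)
    {δ : Fin n → Bool} {a b : Fin n → ℕ} (h : inF n r d (δ, a, b))
    (hi : δ i = true) (hj : δ j = true) :
    toFrac (lin i j k) * (toFrac (blockProd lin (leftIdx δ a)))⁻¹ ∈ primeLoc (prime_lin hij k) ∧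
      (toFrac (blockProd lin (leftIdx δ a)))⁻¹ +
        (toFrac (blockProd lin (leftIdx δ (swapFn i j k a))))⁻¹ ∈ primeLoc (prime_lin hij k) := by
  have hc : ∀ a : Fin n → ℕ,
      (leftIdx δ a i j).count k = (if -(a i : ℤ) ≤ k ∧ k < a j - a i then 1 else 0) ∧
      (leftIdx δ a j i).count (-k) = if -(a j : ℤ) ≤ -k ∧ -k < a i - a j then 1 else 0 := by
    intro a
    simp only [leftIdx, hi, hj, if_true, count_val_eq_ite, Finset.mem_Ico, and_self]
  obtain ⟨c1, c2⟩ := hc a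
  obtain ⟨c3, c4⟩ := hc (swapFn i j k a)
  by_cases triv : swapFn i j k a = a ∧ (leftIdx δ a i j).count k = 0 ∧
      (leftIdx δ a j i).count (-k) = 0
  · have := inv_blockProd_mem_primeLoc hij k (zero_notMem_leftIdx δ a) triv.2.1 triv.2.2
    rw [triv.1]
    exact ⟨mul_mem (algebraMap_mem_primeLoc _ _) this, add_mem this this⟩
  rcases swapFn_cases hij k a with ⟨h1, h2, h3, h4⟩ | ⟨h1, h2⟩
  · by_cases he : k = a j - a i
    · refine (triv ⟨?_, by rw [c1, if_neg (by omega)], by rw [c2, if_neg (by omega)]⟩).elim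
      funext p
      by_cases hpi : p = i
      · subst hpi; omega
      by_cases hpj : p = j
      · subst hpj; omega
      exact swapFn_of_ne k a hpi hpj
    · refine inv_blockProd_add_inv_mem_primeLoc hij k (zero_notMem_leftIdx _ _)
        (zero_notMem_leftIdx _ _) ?_ ?_ ?_ (monic_blockProd_dFactor (rightIdx δ b)) ?_
      · rw [c1, c4]
        split_ifs <;> omega
      · rw [c2, c3]
        split_ifs <;> omega
      · rw [c1, c2]
        split_ifs <;> omega
      · have e1 := blockProd_left_mul_right dFactor (δ, a, b)
        have e2 := blockProd_left_mul_right dFactor (δ, swapFn i j k a, b)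
        dsimp only at e1 e2
        rw [e1, e2]
        exact map_rho_zPoly_eq hij k h (h.swapFn_left hij hi hj k)
          fun G hG => hG.lin_dvd_sub_left h hij hi hj k
  · exact (triv ⟨h2, by rw [c1, if_neg (by omega)], by rw [c2, if_neg (by omega)]⟩).elim

lemma inv_right_mem_primeLoc {n r d : ℕ} {i j : Fin n} (hij : i ≠ j) (k : ℤ)
    {δ : Fin n → Bool} {a b : Fin n → ℕ} (h : inF n r d (δ, a, b))
    (hi : δ i = true) (hj : δ j = true) :
    toFrac (lin i j k) * (toFrac (blockProd lin (rightIdx δ b)))⁻¹ ∈ primeLoc (prime_lin hij k) ∧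
      (toFrac (blockProd lin (rightIdx δ b)))⁻¹ +
        (toFrac (blockProd lin (rightIdx δ (swapFn j i k b))))⁻¹ ∈ primeLoc (prime_lin hij k) := by
  have hc : ∀ b : Fin n → ℕ,
      (rightIdx δ b i j).count k = (if (b i : ℤ) - b j + 1 ≤ k ∧ k < b i + 1 then 1 else 0) ∧
      (rightIdx δ b j i).count (-k) =
        if (b j : ℤ) - b i + 1 ≤ -k ∧ -k < b j + 1 then 1 else 0 := by
    intro b
    simp only [rightIdx, hi, hj, if_true, count_val_eq_ite, Finset.mem_Ico, and_self]
  obtain ⟨c1, c2⟩ := hc b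
  obtain ⟨c3, c4⟩ := hc (swapFn j i k b)
  by_cases triv : swapFn j i k b = b ∧ (rightIdx δ b i j).count k = 0 ∧
      (rightIdx δ b j i).count (-k) = 0
  · have := inv_blockProd_mem_primeLoc hij k (zero_notMem_rightIdx δ b) triv.2.1 triv.2.2
    rw [triv.1]
    exact ⟨mul_mem (algebraMap_mem_primeLoc _ _) this, add_mem this this⟩
  rcases swapFn_cases hij.symm k b with ⟨h1, h2, h3, h4⟩ | ⟨h1, h2⟩
  · by_cases he : k = b i - b j
    · refine (triv ⟨?_, by rw [c1, if_neg (by omega)], by rw [c2, if_neg (by omega)]⟩).elim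
      funext p
      by_cases hpi : p = i
      · subst hpi; omega
      by_cases hpj : p = j
      · subst hpj; omega
      exact swapFn_of_ne k b hpj hpi
    · refine inv_blockProd_add_inv_mem_primeLoc hij k (zero_notMem_rightIdx _ _)
        (zero_notMem_rightIdx _ _) ?_ ?_ ?_ (monic_blockProd_dFactor (leftIdx δ a)) ?_
      · rw [c1, c4]
        split_ifs <;> omega
      · rw [c2, c3]
        split_ifs <;> omega
      · rw [c1, c2]
        split_ifs <;> omega
      · have e1 := blockProd_left_mul_right dFactor (δ, a, b)
        have e2 := blockProd_left_mul_right dFactor (δ, a, swapFn j i k b)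
        dsimp only at e1 e2
        rw [mul_comm, mul_comm _ (blockProd dFactor (leftIdx δ a)), e1, e2]
        exact map_rho_zPoly_eq hij k h (h.swapFn_right hij.symm hj hi k)
          fun G hG => hG.lin_dvd_sub_right h hij hi hj k
  · exact (triv ⟨h2, by rw [c1, if_neg (by omega)], by rw [c2, if_neg (by omega)]⟩).elim

lemma zVal_self_eq_blockProd {n : ℕ} (t : Triple n) :
    zVal t t = blockProd lin (leftIdx t.1 t.2.1 + rightIdx t.1 t.2.2) := by
  rw [blockProd_add, blockProd_left_mul_right]
  rfl

lemma primeLoc_le_of_dvd {S : Type*} [CommRing S] {π π' : S} (hπ : Prime π) (hπ' : Prime π')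
    (h : π' ∣ π) : primeLoc hπ' ≤ primeLoc hπ := by
  rintro x ⟨s, y, hs, hx⟩
  exact ⟨s, y, fun hy => hs (h.trans hy), hx⟩

/-- The summand of the localization formula at `t`. -/
def locTerm {n : ℕ} (G : Triple n → SZ n) (t : Triple n) : FracS n :=
  toFrac (G t) * (toFrac (zVal t t))⁻¹

lemma mul_add_mem_of_lin_dvd {n : ℕ} {i j : Fin n} (hij : i ≠ j) (k : ℤ) {x x' : SZ n}
    {α α' : FracS n} (h : lin i j k ∣ x - x')
    (h1 : toFrac (lin i j k) * α ∈ primeLoc (prime_lin hij k))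
    (h2 : α + α' ∈ primeLoc (prime_lin hij k)) :
    toFrac x * α + toFrac x' * α' ∈ primeLoc (prime_lin hij k) := by
  obtain ⟨y, hy⟩ := h
  have hy' : toFrac x = toFrac x' + toFrac (lin i j k) * toFrac y := by
    rw [← map_mul, ← hy, map_sub]
    ring
  convert add_mem (mul_mem (algebraMap_mem_primeLoc _ y) h1)
    (mul_mem (algebraMap_mem_primeLoc _ x') h2) using 1
  rw [hy']
  ring

lemma locTerm_add_pass_mem {n r d : ℕ} {G : Triple n → SZ n} (hG : Rels n r d G) {t : Triple n}
    (ht : inF n r d t) {i j : Fin n} (hij : i ≠ j) (k : ℤ) (hi : t.1 i = true)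
    (hj : t.1 j = false) :
    locTerm G t + locTerm G (passPt i j k t) ∈ primeLoc (prime_lin hij k) := by
  have hJ : ∀ t : Triple n, ∀ p, 0 ∉ (leftIdx t.1 t.2.1 + rightIdx t.1 t.2.2) p p := fun t p => by
    rw [Pi.add_apply, Pi.add_apply, Multiset.mem_add, not_or]
    exact ⟨zero_notMem_leftIdx _ _ _, zero_notMem_rightIdx _ _ _⟩
  have hcount : ∀ (t : Triple n) (p q : Fin n) (m : ℤ), t.1 p = true → t.1 q = false →
      ((leftIdx t.1 t.2.1 + rightIdx t.1 t.2.2) p q).count m =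
        (if -(t.2.1 p : ℤ) ≤ m ∧ m ≤ t.2.2 p then 1 else 0) ∧
      ((leftIdx t.1 t.2.1 + rightIdx t.1 t.2.2) q p).count (-m) = 0 := by
    intro t p q m hp hq
    simp only [Pi.add_apply, leftIdx, rightIdx, hp, hq, if_true, Multiset.count_add,
      count_val_eq_ite, Finset.mem_Ico, Bool.false_eq_true, if_false, Multiset.count_zero,
      and_true]
    split_ifs <;> omega
  unfold locTerm
  rw [zVal_self_eq_blockProd, zVal_self_eq_blockProd]
  obtain ⟨c1, c2⟩ := hcount t i j k hi hj
  rcases passPt_cases hij k t with ⟨h1, h2, h3, h4, h5, h6, h7, h8, h9, h10⟩ | ⟨h1, h2⟩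
  · obtain ⟨c3, c4⟩ := hcount (passPt i j k t) j i (-k) h6 h5
    rw [neg_neg] at c4
    have key := inv_blockProd_add_inv_mem_primeLoc hij k (hJ t) (hJ (passPt i j k t))
      (by rw [c1, c3]; split_ifs <;> omega) (by rw [c2, c4])
      (by rw [c1, c2, if_pos ⟨h3, h4⟩]) Polynomial.monic_one (by
        rw [mul_one, mul_one, blockProd_add, blockProd_add, blockProd_left_mul_right,
          blockProd_left_mul_right]
        exact map_rho_zPoly_eq hij k ht (ht.pass hij k) fun G hG => hG.lin_dvd_sub_pass ht hij k)
    exact mul_add_mem_of_lin_dvd hij k (hG.lin_dvd_sub_pass ht hij k) key.1 key.2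
  · rw [h2]
    have := inv_blockProd_mem_primeLoc hij k (hJ t)
      (by rw [c1, if_neg fun h => h1 ⟨hi, hj, h⟩]) c2
    exact add_mem (mul_mem (algebraMap_mem_primeLoc _ _) this)
      (mul_mem (algebraMap_mem_primeLoc _ _) this)

lemma locTerm_mem_of_not {n : ℕ} (G : Triple n → SZ n) (t : Triple n) {i j : Fin n} (hij : i ≠ j)
    (k : ℤ) (hi : t.1 i = false) (hj : t.1 j = false) :
    locTerm G t ∈ primeLoc (prime_lin hij k) := by
  refine mul_mem (algebraMap_mem_primeLoc _ _) ?_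
  rw [zVal_self_eq_blockProd]
  refine inv_blockProd_mem_primeLoc hij k (fun p => ?_) ?_ ?_
  · rw [Pi.add_apply, Pi.add_apply, Multiset.mem_add, not_or]
    exact ⟨zero_notMem_leftIdx _ _ _, zero_notMem_rightIdx _ _ _⟩
  · simp [leftIdx, rightIdx, hi]
  · simp [leftIdx, rightIdx, hj]

lemma locTerm_sum_swap_mem {n r d : ℕ} {G : Triple n → SZ n} (hG : Rels n r d G)
    {δ : Fin n → Bool} {a b : Fin n → ℕ} (h : inF n r d (δ, a, b)) {i j : Fin n} (hij : i ≠ j)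
    (k : ℤ) (hi : δ i = true) (hj : δ j = true) :
    locTerm G (δ, a, b) + locTerm G (δ, swapFn i j k a, b) + locTerm G (δ, a, swapFn j i k b) +
      locTerm G (δ, swapFn i j k a, swapFn j i k b) ∈ primeLoc (prime_lin hij k) := by
  obtain ⟨l1, l2⟩ := inv_left_mem_primeLoc hij k h hi hj
  obtain ⟨r1, r2⟩ := inv_right_mem_primeLoc hij k h hi hj
  obtain ⟨u, hu⟩ := hG.lin_dvd_sub_right (h.swapFn_left hij hi hj k) hij hi hj k
  obtain ⟨v, hv⟩ := hG.lin_dvd_sub_left (h.swapFn_right hij.symm hj hi k) hij hi hj k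
  obtain ⟨w, hw⟩ := hG.lin_sq_dvd h hij hi hj k
  simp only [locTerm, zVal_self_eq_blockProd, blockProd_add, map_mul, mul_inv]
  set α := (toFrac (blockProd lin (leftIdx δ a)))⁻¹
  set α' := (toFrac (blockProd lin (leftIdx δ (swapFn i j k a))))⁻¹
  set β := (toFrac (blockProd lin (rightIdx δ b)))⁻¹
  set β' := (toFrac (blockProd lin (rightIdx δ (swapFn j i k b))))⁻¹
  set g₀ := G (δ, a, b)
  set g₁ := G (δ, swapFn i j k a, b)
  set g₂ := G (δ, a, swapFn j i k b)
  set g₃ := G (δ, swapFn i j k a, swapFn j i k b)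
  have hu' := congrArg toFrac hu
  have hv' := congrArg toFrac hv
  have hw' := congrArg toFrac hw
  simp only [map_sub, map_add, map_mul, map_pow] at hu' hv' hw'
  have m := fun x : SZ n => algebraMap_mem_primeLoc (prime_lin hij k) x
  convert add_mem (add_mem (add_mem (mul_mem (m w) (mul_mem l1 r1))
    (mul_mem (m u) (mul_mem l2 r1))) (mul_mem (m v) (mul_mem r2 l1)))
      (mul_mem (m g₃) (mul_mem l2 r2)) using 1
  linear_combination α * β * hw' + (α + α') * β * hu' + (β + β') * α * hv'

lemma locTerm_sum_moves_mem {n r d : ℕ} {G : Triple n → SZ n} (hG : Rels n r d G) {t : Triple n}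
    (ht : inF n r d t) {i j : Fin n} (hij : i ≠ j) (k : ℤ) :
    locTerm G t + locTerm G (moveLeft i j k t) + locTerm G (moveRight i j k t) +
      locTerm G (moveLeft i j k (moveRight i j k t)) ∈ primeLoc (prime_lin hij k) := by
  have hdouble : ∀ x y : FracS n, x + y ∈ primeLoc (prime_lin hij k) →
      x + y + x + y ∈ primeLoc (prime_lin hij k) := fun x y h => by
    rw [add_assoc (x + y)]
    exact add_mem h h
  by_cases hi : t.1 i = true
  · by_cases hj : t.1 j = true
    · have h2 : moveRight i j k t = (t.1, t.2.1, swapFn j i k t.2.2) := if_pos ⟨hi, hj⟩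
      have h1 : ∀ a b, moveLeft i j k (t.1, a, b) = (t.1, swapFn i j k a, b) := fun a b => by
        simp [moveLeft, hi, hj]
      rw [h2, h1, h1]
      exact locTerm_sum_swap_mem hG ht hij k hi hj
    · have h2 : moveRight i j k t = t := if_neg fun h => hj h.2
      have h1 : moveLeft i j k t = passPt i j k t := by simp [moveLeft, hi, hj]
      rw [h2, h1]
      exact hdouble _ _ (locTerm_add_pass_mem hG ht hij k hi (by simpa using hj))
  · have h2 : moveRight i j k t = t := if_neg fun h => hi h.1
    have h1 : moveLeft i j k t = passPt j i (-k) t := by simp [moveLeft, hi]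
    rw [h2, h1]
    apply hdouble
    by_cases hj : t.1 j = true
    · refine primeLoc_le_of_dvd (prime_lin hij k) (prime_lin hij.symm (-k)) ?_
        (locTerm_add_pass_mem hG ht hij.symm (-k) hj (by simpa using hi))
      rw [lin_neg_swap, neg_dvd]
    · rcases passPt_cases hij.symm (-k) t with h | ⟨-, h⟩
      · exact (hj h.1).elim
      · rw [h]
        have := locTerm_mem_of_not G t hij k (by simpa using hi) (by simpa using hj)
        exact add_mem this this

lemma pushFwd_mem_primeLoc_lin {n r d : ℕ} {i j : Fin n} (hij : i ≠ j) (k : ℤ)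
    {g : FixedPt n r d → SZ n} (hg : g ∈ chow n r d) :
    pushFwd g ∈ primeLoc (prime_lin hij k) := by
  set G := extTuple n r d g with hGdef
  have hG : Rels n r d G := mem_chow.1 hg
  have h0 : pushFwd g = ∑ t : FixedPt n r d, locTerm G t.1 :=
    Finset.sum_congr rfl fun t _ => by rw [locTerm, hGdef, extTuple_apply, div_eq_mul_inv]
  have hL := fun f : Triple n → FracS n => sum_comp_of_involutive (n := n) (r := r) (d := d)
    (fun t ht => ht.moveLeft_mem hij k) (fun t ht => ht.moveLeft_invol hij k) f
  have hR := fun f : Triple n → FracS n => sum_comp_of_involutive (n := n) (r := r) (d := d)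
    (fun t ht => ht.moveRight_mem hij k) (fun t _ => moveRight_moveRight hij k t) f
  have h4 : (4 : FracS n) * pushFwd g = ∑ t : FixedPt n r d, (locTerm G t.1 +
      locTerm G (moveLeft i j k t.1) + locTerm G (moveRight i j k t.1) +
        locTerm G (moveLeft i j k (moveRight i j k t.1))) := by
    rw [Finset.sum_add_distrib, Finset.sum_add_distrib, Finset.sum_add_distrib,
      hL (locTerm G), hR (locTerm G), hR fun t => locTerm G (moveLeft i j k t), hL (locTerm G), h0]
    ring
  have h4' : ¬ lin i j k ∣ (4 : SZ n) := by
    rw [lin_dvd_iff hij, map_ofNat]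
    norm_num
  have hinv := inv_mem_primeLoc (prime_lin hij k) h4'
  rw [map_ofNat] at hinv
  have := mul_mem hinv (h4 ▸ sum_mem fun (t : FixedPt n r d) _ =>
    locTerm_sum_moves_mem hG t.2 hij k : 4 * pushFwd g ∈ primeLoc (prime_lin hij k))
  rwa [inv_mul_cancel_left₀ (by norm_num)] at this

/-- Integration over the quot scheme takes values in `S`. -/
theorem exists_toFrac_eq_pushFwd {n r d : ℕ} {g : FixedPt n r d → SZ n} (hg : g ∈ chow n r d) :
    ∃ y, toFrac y = pushFwd g := by
  refine exists_of_forall_mem_primeLoc fun π hπ => ?_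
  by_cases h : ∃ i j k, i ≠ j ∧ π ∣ lin i j k
  · obtain ⟨i, j, k, hij, hdvd⟩ := h
    exact primeLoc_le_of_dvd hπ (prime_lin hij k)
      (hπ.dvd_prime_iff_associated (prime_lin hij k) |>.1 hdvd).symm.dvd
      (pushFwd_mem_primeLoc_lin hij k hg)
  · push Not at h
    exact pushFwd_mem_primeLoc_of_not_dvd hπ h hg

/-! ### Homogeneous decomposition of the diagonal -/

/-- `(α, β, D, E)` is a pair of homogeneous classes of total degree `R`. -/
def IsHomPair (n r d R : ℕ)
    (q : (FixedPt n r d → SZ n) × (FixedPt n r d → SZ n) × ℕ × ℕ) : Prop :=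
  q.1 ∈ chow n r d ∧ q.2.1 ∈ chow n r d ∧ (∀ t, IsHom q.2.2.1 (q.1 t)) ∧
    (∀ t, IsHom q.2.2.2 (q.2.1 t)) ∧ q.2.2.1 + q.2.2.2 = R

lemma exists_list_of_mem_tensorRing {n r d : ℕ} {h : FixedPt n r d × FixedPt n r d → SZ n}
    (hh : h ∈ tensorRing n r d) (R : ℕ) :
    ∃ l : List ((FixedPt n r d → SZ n) × (FixedPt n r d → SZ n) × ℕ × ℕ),
      (∀ q ∈ l, IsHomPair n r d R q) ∧
        ∀ p, (scal (h p)).coeff R = (l.map fun q => q.1 p.1 * q.2.1 p.2).sum := by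
  rw [tensorRing, Subring.mem_closure_iff] at hh
  induction hh using AddSubgroup.closure_induction with
  | mem h hh =>
    obtain ⟨α, hα, β, hβ, D, E, hD, hE, rfl⟩ : ∃ α ∈ chow n r d, ∃ β ∈ chow n r d, ∃ D E,
        (∀ t, IsHom D (α t)) ∧ (∀ t, IsHom E (β t)) ∧ h = fun p => α p.1 * β p.2 := by
      rw [SetLike.mem_coe] at hh
      induction hh using Submonoid.closure_induction with
      | mem h hh => exact hh
      | one => exact ⟨1, one_mem _, 1, one_mem _, 0, 0, fun _ => isHom_one, fun _ => isHom_one,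
          by funext; simp⟩
      | mul h h' _ _ ih ih' =>
        obtain ⟨α, hα, β, hβ, D, E, hD, hE, rfl⟩ := ih
        obtain ⟨α', hα', β', hβ', D', E', hD', hE', rfl⟩ := ih'
        refine ⟨α * α', mul_mem hα hα', β * β', mul_mem hβ hβ', D + D', E + E',
          fun t => (hD t).mul (hD' t), fun t => (hE t).mul (hE' t), ?_⟩
        funext p
        simp only [Pi.mul_apply]
        ring
    have hs : ∀ p : FixedPt n r d × FixedPt n r d, scal (α p.1 * β p.2) =
      Polynomial.C (α p.1 * β p.2) * Polynomial.X ^ (D + E) := fun p => (hD p.1).mul (hE p.2)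
    by_cases hR : D + E = R
    · refine ⟨[(α, β, D, E)], by simpa using ⟨hα, hβ, hD, hE, hR⟩, fun p => ?_⟩
      rw [hs, Polynomial.coeff_C_mul_X_pow, if_pos hR.symm]
      simp
    · refine ⟨[], by simp, fun p => ?_⟩
      rw [hs, Polynomial.coeff_C_mul_X_pow, if_neg fun h => hR h.symm]
      simp
  | zero => exact ⟨[], by simp, by simp⟩
  | add h h' _ _ ih ih' =>
    obtain ⟨l, hl, hsum⟩ := ih
    obtain ⟨l', hl', hsum'⟩ := ih'
    refine ⟨l ++ l', fun q hq => (List.mem_append.1 hq).elim (hl q) (hl' q), fun p => ?_⟩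
    rw [Pi.add_apply, map_add, Polynomial.coeff_add, hsum, hsum', List.map_append, List.sum_append]
  | neg h _ ih =>
    obtain ⟨l, hl, hsum⟩ := ih
    refine ⟨l.map fun q => (-q.1, q.2), fun q hq => ?_, fun p => ?_⟩
    · obtain ⟨q, hq', rfl⟩ := List.mem_map.1 hq
      obtain ⟨h1, h2, h3, h4, h5⟩ := hl q hq'
      refine ⟨neg_mem h1, h2, fun t => ?_, h4, h5⟩
      have := (isHom_zero q.2.2.1).sub (h3 t)
      rwa [zero_sub] at this
    · rw [Pi.neg_apply, map_neg, Polynomial.coeff_neg, hsum, List.map_map]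
      clear hl hsum
      induction l with
      | nil => simp
      | cons q l ih =>
        simp only [List.map_cons, List.sum_cons, neg_add, Function.comp_apply] at ih ⊢
        rw [ih]
        simp

lemma exists_zVal_eq_sum (n r d : ℕ) : ∃ (N : ℕ) (α β : Fin N → FixedPt n r d → SZ n)
    (D E : Fin N → ℕ), (∀ k, α k ∈ chow n r d) ∧ (∀ k, β k ∈ chow n r d) ∧
      (∀ k t, IsHom (D k) (α k t)) ∧ (∀ k t, IsHom (E k) (β k t)) ∧
      (∀ k, D k + E k = zDeg n r d) ∧
      ∀ s t : FixedPt n r d, zVal s.1 t.1 = ∑ k, α k s * β k t := by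
  obtain ⟨l, hl, hsum⟩ := exists_list_of_mem_tensorRing (zVal_mem_tensorRing n r d) (zDeg n r d)
  refine ⟨l.length, fun k => l[k.1].1, fun k => l[k.1].2.1, fun k => l[k.1].2.2.1,
    fun k => l[k.1].2.2.2, fun k => (hl _ (l.getElem_mem _)).1,
    fun k => (hl _ (l.getElem_mem _)).2.1,
    fun k => (hl _ (l.getElem_mem _)).2.2.1, fun k => (hl _ (l.getElem_mem _)).2.2.2.1,
    fun k => (hl _ (l.getElem_mem _)).2.2.2.2, fun s t => ?_⟩
  have h := hsum (s, t)
  rw [isHom_zVal s.2 t.2, Polynomial.coeff_C_mul_X_pow, if_pos rfl] at h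
  rw [h]
  exact (Fin.sum_univ_fun_getElem l fun q => q.1 s * q.2.1 t).symm

lemma scal_injective {n : ℕ} : Function.Injective (scal (n := n)) := by
  have h : (Polynomial.evalRingHom (1 : SZ n)).comp scal = RingHom.id _ := by
    refine MvPolynomial.ringHom_ext (fun k => ?_) fun o => ?_ <;> simp [scal]
  exact Function.LeftInverse.injective (g := Polynomial.evalRingHom (1 : SZ n))
    fun x => RingHom.congr_fun h x

lemma scal_mul_X_pow_of_pushFwd {n r d D : ℕ} {g : FixedPt n r d → SZ n}
    (hg : ∀ t, IsHom D (g t)) {y : SZ n} (hy : toFrac y = pushFwd g) :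
    scal y * Polynomial.X ^ zDeg n r d = Polynomial.C y * Polynomial.X ^ D := by
  let K := FractionRing (Polynomial (SZ n))
  let ι : Polynomial (SZ n) →+* K := algebraMap _ K
  have hι : Function.Injective ι := FaithfulSMul.algebraMap_injective _ _
  have h1 : Function.Injective (ι.comp scal) := hι.comp scal_injective
  have h2 : Function.Injective (ι.comp Polynomial.C) := hι.comp Polynomial.C_injective
  let ψ : FracS n →+* K := IsFractionRing.lift h1
  let θ : FracS n →+* K := IsFractionRing.lift h2
  have hψ : ∀ x, ψ (toFrac x) = ι (scal x) := IsFractionRing.lift_algebraMap h1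
  have hθ : ∀ x, θ (toFrac x) = ι (Polynomial.C x) := IsFractionRing.lift_algebraMap h2
  have hτ : ι Polynomial.X ≠ 0 := (map_ne_zero_iff ι hι).2 Polynomial.X_ne_zero
  apply hι
  rw [map_mul, map_mul, ← hψ, ← hθ, hy, pushFwd, map_sum, map_sum, Finset.sum_mul, Finset.sum_mul]
  refine Finset.sum_congr rfl fun t _ => ?_
  rw [map_div₀, map_div₀, hψ, hψ, hθ, hθ, hg t, isHom_zVal t.2 t.2, map_mul, map_mul, map_pow,
    map_pow]
  rw [← div_div, div_mul_cancel₀ _ (pow_ne_zero _ hτ), mul_div_right_comm]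

/-! ### Graded projective modules -/

/-- An idempotent matrix over `ℤ` splits through a finite free module. -/
lemma exists_split_of_isIdempotentElem {κ : Type*} [Fintype κ] [DecidableEq κ] {e : Matrix κ κ ℤ}
    (he : e * e = e) :
    ∃ (m : ℕ) (A : Matrix κ (Fin m) ℤ) (B : Matrix (Fin m) κ ℤ), A * B = e ∧ B * A = 1 := by
  obtain ⟨m, b⟩ := Submodule.basisOfPid (Pi.basisFun ℤ κ) (LinearMap.range (Matrix.toLin' e))
  let A := (LinearMap.range (Matrix.toLin' e)).subtype ∘ₗ b.equivFun.symm.toLinearMap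
  let B := b.equivFun.toLinearMap ∘ₗ (Matrix.toLin' e).rangeRestrict
  refine ⟨m, LinearMap.toMatrix' A, LinearMap.toMatrix' B, ?_, ?_⟩
  · rw [← LinearMap.toMatrix'_comp]
    have h : A ∘ₗ B = Matrix.toLin' e := by
      ext
      simp [A, B]
    rw [h, LinearMap.toMatrix'_toLin']
  · rw [← LinearMap.toMatrix'_comp]
    have h : B ∘ₗ A = LinearMap.id := by
      refine LinearMap.ext fun x => b.equivFun.symm.injective ?_
      obtain ⟨y, hy⟩ := (b.equivFun.symm x).2
      refine Subtype.ext ?_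
      simp only [A, B, LinearMap.comp_apply, LinearEquiv.coe_coe, LinearEquiv.symm_apply_apply,
        Submodule.subtype_apply, LinearMap.codRestrict_apply, LinearMap.id_apply]
      change Matrix.toLin' e (b.equivFun.symm x).1 = (b.equivFun.symm x).1
      rw [← hy, ← LinearMap.comp_apply, ← Matrix.toLin'_mul, he]
    rw [h, LinearMap.toMatrix'_id]

/-- The projection of `S` onto its constants. -/
def constPart {n : ℕ} : SZ n →+* SZ n := C.comp MvPolynomial.constantCoeff

/-- A matrix all of whose entries are homogeneous, with degree of the `(k, l)` entry
equal to `D l - D k`. -/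
def IsHomMatrix {n N : ℕ} (D : Fin N → ℕ) (A : Matrix (Fin N) (Fin N) (SZ n)) : Prop :=
  ∀ k l, scal (A k l) * Polynomial.X ^ D k = Polynomial.C (A k l) * Polynomial.X ^ D l

lemma isHomMatrix_iff {n N : ℕ} {D : Fin N → ℕ} {A : Matrix (Fin N) (Fin N) (SZ n)} :
    IsHomMatrix D A ↔
      Matrix.diagonal (fun k => (Polynomial.X : Polynomial (SZ n)) ^ D k) * scal.mapMatrix A =
        Polynomial.C.mapMatrix A * Matrix.diagonal fun k => Polynomial.X ^ D k := by
  rw [← Matrix.ext_iff]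
  refine forall₂_congr fun k l => ?_
  rw [Matrix.diagonal_mul, Matrix.mul_diagonal, mul_comm (scal _)]
  rfl

section HomMatrix

variable {n N : ℕ} {D : Fin N → ℕ} {A B : Matrix (Fin N) (Fin N) (SZ n)}

lemma IsHomMatrix.mul (hA : IsHomMatrix D A) (hB : IsHomMatrix D B) : IsHomMatrix D (A * B) := by
  rw [isHomMatrix_iff] at *
  rw [map_mul, map_mul, ← mul_assoc, hA, mul_assoc, hB, mul_assoc]

lemma IsHomMatrix.add (hA : IsHomMatrix D A) (hB : IsHomMatrix D B) : IsHomMatrix D (A + B) := by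
  rw [isHomMatrix_iff] at *
  rw [map_add, map_add, mul_add, add_mul, hA, hB]

lemma IsHomMatrix.one_sub (hA : IsHomMatrix D A) : IsHomMatrix D (1 - A) := by
  rw [isHomMatrix_iff] at *
  rw [map_sub, map_sub, mul_sub, sub_mul, hA, map_one, map_one, mul_one, one_mul]

lemma IsHomMatrix.constPart_map (hA : IsHomMatrix D A) : IsHomMatrix D (constPart.mapMatrix A) := by
  intro k l
  have h : (Polynomial.mapRingHom MvPolynomial.constantCoeff).comp scal =
      Polynomial.C.comp (MvPolynomial.constantCoeff (σ := Option (Fin n)) (R := ℤ)) := by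
    refine MvPolynomial.ringHom_ext (fun k => ?_) fun o => ?_ <;> simp [scal]
  have hk := congr_arg (Polynomial.mapRingHom MvPolynomial.constantCoeff) (hA k l)
  rw [map_mul, ← RingHom.comp_apply _ scal, h] at hk
  have hk' := congr_arg (Polynomial.mapRingHom (C : ℤ →+* SZ n)) hk
  have hs : ∀ z : ℤ, scal (C z : SZ n) = Polynomial.C (C z) := fun z => by simp [scal]
  change scal (C _) * _ = Polynomial.C (C _) * _
  rw [hs]
  simpa only [map_mul, map_pow, RingHom.comp_apply, Polynomial.coe_mapRingHom, Polynomial.map_C,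
    Polynomial.map_X, Polynomial.map_mul, Polynomial.map_pow] using hk'

lemma IsHomMatrix.det_eq_constPart (hA : IsHomMatrix D A) :
    A.det = constPart A.det := by
  have h := congr_arg Matrix.det (isHomMatrix_iff.1 hA)
  rw [Matrix.det_mul, Matrix.det_mul, mul_comm, Matrix.det_diagonal, ← RingHom.map_det,
    ← RingHom.map_det] at h
  have h' := mul_right_cancel₀
    (Finset.prod_ne_zero_iff.2 fun k _ => pow_ne_zero _ Polynomial.X_ne_zero) h
  have h0 : (Polynomial.evalRingHom (0 : SZ n)).comp scal = constPart := by
    refine MvPolynomial.ringHom_ext (fun k => ?_) fun o => ?_ <;> simp [scal, constPart]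
  have h1 := congr_arg (Polynomial.evalRingHom (0 : SZ n)) h'
  rw [← RingHom.comp_apply, h0] at h1
  simpa using h1.symm

/-- A graded idempotent matrix is conjugate to its reduction modulo the irrelevant ideal. -/
lemma IsHomMatrix.exists_conj (hA : IsHomMatrix D A) (h : A * A = A) :
    ∃ U V : Matrix (Fin N) (Fin N) (SZ n), U * V = 1 ∧ V * U = 1 ∧
      A * U = U * constPart.mapMatrix A := by
  set A₀ := constPart.mapMatrix A with hA₀
  have h₀ : A₀ * A₀ = A₀ := by rw [hA₀, ← map_mul, h]
  set U := A * A₀ + (1 - A) * (1 - A₀) with hU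
  have hc : constPart.mapMatrix A₀ = A₀ := by
    ext
    simp [hA₀, constPart]
  have hdet : U.det = 1 := by
    have hhom : IsHomMatrix D U :=
      (hA.mul hA.constPart_map).add (hA.one_sub.mul hA.constPart_map.one_sub)
    rw [hhom.det_eq_constPart, RingHom.map_det, hU, map_add, map_mul, map_mul,
      map_sub, map_sub, map_one, hc, ← hA₀]
    have : A₀ * A₀ + (1 - A₀) * (1 - A₀) = 1 := by
      rw [sub_mul, mul_sub, mul_sub, h₀]
      simp
    rw [this, Matrix.det_one]
  have hunit : IsUnit U.det := by rw [hdet]; exact isUnit_one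
  refine ⟨U, U⁻¹, Matrix.mul_nonsing_inv _ hunit, Matrix.nonsing_inv_mul _ hunit, ?_⟩
  have h1 : A * (1 - A) = 0 := by rw [mul_sub, h, mul_one, sub_self]
  have h2 : (1 - A₀) * A₀ = 0 := by rw [sub_mul, h₀, one_mul, sub_self]
  rw [hU, mul_add, add_mul, ← mul_assoc, ← mul_assoc, h, h1, mul_assoc, mul_assoc, h₀, h2]
  simp

/-- A module which is a retract of a free one through a graded idempotent is free. -/
lemma IsHomMatrix.exists_equiv {M : Type*} [AddCommGroup M] [Module (SZ n) M]
    {Φ : (Fin N → SZ n) →ₗ[SZ n] M} {Ψ : M →ₗ[SZ n] Fin N → SZ n} (h : Φ ∘ₗ Ψ = LinearMap.id)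
    (hhom : IsHomMatrix D (LinearMap.toMatrix' (Ψ ∘ₗ Φ))) :
    ∃ m : ℕ, Nonempty (M ≃ₗ[SZ n] (Fin m → SZ n)) := by
  set A := LinearMap.toMatrix' (Ψ ∘ₗ Φ) with hA
  have hlin : Matrix.toLin' A = Ψ ∘ₗ Φ := Matrix.toLin'_toMatrix' _
  have hsq : A * A = A := by
    rw [hA, ← LinearMap.toMatrix'_comp, LinearMap.comp_assoc, ← LinearMap.comp_assoc _ Ψ Φ, h,
      LinearMap.id_comp]
  obtain ⟨U, V, hUV, hVU, hconj⟩ := hhom.exists_conj hsq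
  have he : MvPolynomial.constantCoeff.mapMatrix A * MvPolynomial.constantCoeff.mapMatrix A =
      MvPolynomial.constantCoeff.mapMatrix A := by rw [← map_mul, hsq]
  obtain ⟨m, P, Q, hPQ, hQP⟩ := exists_split_of_isIdempotentElem he
  obtain ⟨P', Q', hPQ', hQP'⟩ : ∃ (P' : Matrix (Fin N) (Fin m) (SZ n))
      (Q' : Matrix (Fin m) (Fin N) (SZ n)), P' * Q' = constPart.mapMatrix A ∧ Q' * P' = 1 := by
    refine ⟨P.map (C : ℤ →+* SZ n), Q.map (C : ℤ →+* SZ n), ?_, ?_⟩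
    · rw [← Matrix.map_mul, hPQ]
      rfl
    · rw [← Matrix.map_mul, hQP, Matrix.map_one _ (map_zero _) (map_one _)]
  refine ⟨m, ⟨LinearEquiv.ofLinearMap (Matrix.toLin' (Q' * V) ∘ₗ Ψ)
    (Φ ∘ₗ Matrix.toLin' (U * P')) ?_ ?_⟩⟩
  · have hmat : Q' * V * (A * (U * P')) = 1 := by
      rw [← Matrix.mul_assoc A, hconj, ← hPQ', Matrix.mul_assoc U, Matrix.mul_assoc P', hQP',
        Matrix.mul_one, Matrix.mul_assoc, ← Matrix.mul_assoc V, hVU, Matrix.one_mul, hQP']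
    rw [LinearMap.comp_assoc, ← LinearMap.comp_assoc _ Φ Ψ, ← hlin, ← Matrix.toLin'_mul,
      ← Matrix.toLin'_mul, hmat, Matrix.toLin'_one]
  · have hmat : U * P' * (Q' * V) = A := by
      rw [Matrix.mul_assoc, ← Matrix.mul_assoc P', hPQ', ← Matrix.mul_assoc, ← hconj,
        Matrix.mul_assoc, hUV, Matrix.mul_one]
    rw [LinearMap.comp_assoc, ← LinearMap.comp_assoc Ψ, ← Matrix.toLin'_mul, hmat, hlin,
      LinearMap.comp_assoc, h, LinearMap.comp_id, h]

end HomMatrix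

/-! ### Freeness and rank -/

lemma pushFwd_add {n r d : ℕ} (g h : FixedPt n r d → SZ n) :
    pushFwd (g + h) = pushFwd g + pushFwd h := by
  simp only [pushFwd, Pi.add_apply, map_add, add_div, Finset.sum_add_distrib]

lemma pushFwd_smul {n r d : ℕ} (c : SZ n) (g : FixedPt n r d → SZ n) :
    pushFwd (c • g) = toFrac c * pushFwd g := by
  simp only [pushFwd, Pi.smul_apply, smul_eq_mul, map_mul, mul_div_assoc, Finset.mul_sum]

/-- Integration, as a linear map. -/
def integral (n r d : ℕ) : chow n r d →ₗ[SZ n] SZ n where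
  toFun g := (exists_toFrac_eq_pushFwd g.2).choose
  map_add' g h := toFrac_injective <| by
    rw [map_add, (exists_toFrac_eq_pushFwd (g + h).2).choose_spec,
      (exists_toFrac_eq_pushFwd g.2).choose_spec, (exists_toFrac_eq_pushFwd h.2).choose_spec]
    exact pushFwd_add g.1 h.1
  map_smul' c g := toFrac_injective <| by
    rw [RingHom.id_apply, smul_eq_mul, map_mul,
      (exists_toFrac_eq_pushFwd (c • g).2).choose_spec,
      (exists_toFrac_eq_pushFwd g.2).choose_spec]
    exact pushFwd_smul c g.1

lemma toFrac_integral {n r d : ℕ} (g : chow n r d) : toFrac (integral n r d g) = pushFwd g.1 :=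
  (exists_toFrac_eq_pushFwd g.2).choose_spec

lemma exists_equiv_chow (n r d : ℕ) : ∃ m : ℕ, Nonempty (chow n r d ≃ₗ[SZ n] (Fin m → SZ n)) := by
  obtain ⟨N, α, β, D, E, hα, hβ, hD, hE, hDE, hz⟩ := exists_zVal_eq_sum n r d
  let Φ : (Fin N → SZ n) →ₗ[SZ n] chow n r d :=
    Fintype.linearCombination (SZ n) fun k => (⟨α k, hα k⟩ : chow n r d)
  let Ψ : chow n r d →ₗ[SZ n] Fin N → SZ n := LinearMap.pi fun k =>
    integral n r d ∘ₗ LinearMap.mulRight (SZ n) (⟨β k, hβ k⟩ : chow n r d)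
  have hΨ : ∀ g k, toFrac (Ψ g k) = pushFwd (g.1 * β k) := fun g k => toFrac_integral _
  refine IsHomMatrix.exists_equiv (D := D) (Φ := Φ) (Ψ := Ψ) ?_ fun k l => ?_
  · refine LinearMap.ext fun g => Subtype.ext (funext fun s => toFrac_injective ?_)
    have h1 : (Φ (Ψ g)).1 s = ∑ k, Ψ g k * α k s := by
      simp [Φ, Fintype.linearCombination_apply, Finset.sum_apply]
    rw [LinearMap.comp_apply, h1, LinearMap.id_apply, map_sum]
    simp only [map_mul, hΨ, pushFwd, Finset.sum_mul]
    rw [Finset.sum_comm]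
    have h2 : ∀ t : FixedPt n r d, ∑ k, toFrac ((g.1 * β k) t) / toFrac (zVal t.1 t.1) *
        toFrac (α k s) = toFrac (g.1 t) * toFrac (zVal s.1 t.1) / toFrac (zVal t.1 t.1) := by
      intro t
      rw [hz s t, map_sum, Finset.mul_sum, Finset.sum_div]
      refine Finset.sum_congr rfl fun k _ => ?_
      rw [Pi.mul_apply, map_mul, map_mul]
      ring
    simp only [h2]
    rw [Finset.sum_eq_single s, mul_div_cancel_right₀]
    · exact (map_ne_zero_iff _ toFrac_injective).2 (zVal_self_ne_zero s.1)
    · intro t _ hts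
      rw [zVal_eq_zero s.2 t.2 fun h => hts (Subtype.ext h.symm), map_zero, mul_zero, zero_div]
    · simp
  · have hk : LinearMap.toMatrix' (Ψ ∘ₗ Φ) k l = Ψ (⟨α l, hα l⟩ : chow n r d) k := by
      simp [LinearMap.toMatrix'_apply, Φ]
    have h := scal_mul_X_pow_of_pushFwd (g := α l * β k) (fun t => (hD l t).mul (hE k t))
      (hΨ ⟨α l, hα l⟩ k)
    rw [← hDE k, pow_add, pow_add, ← mul_assoc, ← mul_assoc] at h
    rw [hk]
    exact mul_right_cancel₀ (pow_ne_zero _ Polynomial.X_ne_zero) h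

lemma rank_chow (n r d : ℕ) : Module.rank (SZ n) (chow n r d) = Nat.card (FixedPt n r d) := by
  rw [Nat.cast_card]
  apply le_antisymm
  · have h := LinearMap.rank_le_of_injective (chow n r d).val.toLinearMap Subtype.val_injective
    rwa [rank_fun', ← Cardinal.mk_fintype] at h
  · obtain ⟨N, α, β, -, -, hα, -, -, -, -, hz⟩ := exists_zVal_eq_sum n r d
    have hmem : ∀ t : FixedPt n r d, (fun s : FixedPt n r d => zVal s.1 t.1) ∈ chow n r d := by
      intro t
      have h : (fun s : FixedPt n r d => zVal s.1 t.1) = ∑ k, β k t • α k := by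
        funext s
        simp [hz, Finset.sum_apply, mul_comm]
      rw [h]
      exact sum_mem fun k _ => Subalgebra.smul_mem _ (hα k) _
    refine LinearIndependent.cardinal_le_rank
      (v := fun t : FixedPt n r d => (⟨_, hmem t⟩ : chow n r d)) ?_
    refine Fintype.linearIndependent_iff.2 fun c hc t => ?_
    have h : ∑ s, c s * zVal t.1 s.1 = 0 := by
      simpa [Finset.sum_apply] using congr_fun (congr_arg Subtype.val hc) t
    rw [Finset.sum_eq_single t] at h
    · exact (mul_eq_zero.1 h).resolve_right (zVal_self_ne_zero t.1)
    · intro s _ hst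
      rw [zVal_eq_zero t.2 s.2 fun h => hst (Subtype.ext h.symm), mul_zero]
    · simp

/-- (Main Theorem of the paper, integral version.)  The set `M` of tuples
`(f_{(δ,a,b)})_{(δ,a,b) ∈ F}` of elements of `S = ℤ[e_1,…,e_n,f]` satisfying
relations I, II(a), II(b), II(c)′, III′ is a subring of the product ring `S^F`
closed under the diagonal `S`-action, and is a free `S`-module of rank equal to
the cardinality of `F`. -/
theorem quot_scheme_integral_chow_ring (n r d : ℕ) (hrn : r < n) :
    ∃ M : Subalgebra (SZ n) ({t : Triple n // inF n r d t} → SZ n),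
      (M : Set ({t : Triple n // inF n r d t} → SZ n)) =
        {g | RelI n r d (extTuple n r d g) ∧ RelIIa n r d (extTuple n r d g) ∧
          RelIIb n r d (extTuple n r d g) ∧ RelIIc' n r d (extTuple n r d g) ∧
          RelIII' n r d (extTuple n r d g)} ∧
      Module.Free (SZ n) M ∧
      Module.rank (SZ n) M = Nat.card {t : Triple n // inF n r d t} := by
  obtain ⟨m, ⟨e⟩⟩ := exists_equiv_chow n r d
  exact ⟨chow n r d, Set.ext fun g => mem_chow.trans rels_iff, Module.Free.of_equiv e.symm,
    rank_chow n r d⟩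

end
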